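/- arXiv:2212.02079 — 2 statements merged into one kernel-verified Lean document; each statement's English description precedes it below -/
import Mathlib

section
/- Let m ≥ 5 be an integer and let G be a finite 3-connected simple graph with |V(G)| ≥ 2m + 1. Then G has a contractible set W with m ≤ |W| ≤ 2m − 4, i.e. a set W ⊆ V(G) with m ≤ |W| ≤ 2m − 4 such that G[W] is connected and G − W is 2-connected. -/
open SimpleGraph

/-- A graph is `n`-connected if it has more than `n` vertices and remains connected
after deletion of any set of fewer than `n` vertices. -/
def NConnected {V : Type*} (G : SimpleGraph V) (n : ℕ) : Prop :=
  n < Nat.card V ∧ ∀ S : Set V, S.ncard < n → (G.induce (Sᶜ : Set V)).Connected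

/-- `W` is a contractible set of `G` if `G[W]` is connected and `G − W` is `2`-connected. -/
def ContractibleSet {V : Type*} (G : SimpleGraph V) (W : Set V) : Prop :=
  (G.induce W).Connected ∧ NConnected (G.induce (Wᶜ : Set V)) 2

section Prelim
variable {V : Type*} {G : SimpleGraph V}

/-- `S` induces a preconnected subgraph, stated through sets closed under adjacency. -/
def Pre (G : SimpleGraph V) (S : Set V) : Prop :=
  ∀ A ⊆ S, A.Nonempty → (∀ a ∈ A, ∀ b ∈ S, G.Adj a b → b ∈ A) → S ⊆ A

/-- `B` induces a `2`-connected subgraph or a single edge. -/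
def TC (G : SimpleGraph V) (B : Set V) : Prop :=
  2 ≤ B.ncard ∧ ∀ c, Pre G (B \ {c})

/-- The weak form of contractibility, allowing the complement to be a single edge. -/
def Ctr (G : SimpleGraph V) (W : Set V) : Prop :=
  W.Nonempty ∧ Pre G W ∧ TC G Wᶜ

/-- No set is separated from the rest of the graph by two vertices. -/
def TriConn (G : SimpleGraph V) : Prop :=
  ∀ (U : Set V) (a b : V), (∀ u ∈ U, ∀ v, G.Adj u v → v ∈ U ∨ v = a ∨ v = b) →
    (∃ u ∈ U, u ≠ a ∧ u ≠ b) → ∀ v, v ∈ U ∨ v = a ∨ v = b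

theorem Pre.exists_adj {S A : Set V} (h : Pre G S) (hA : A ⊆ S) (hne : A.Nonempty)
    {y : V} (hy : y ∈ S) (hyA : y ∉ A) : ∃ a ∈ A, ∃ b ∈ S, b ∉ A ∧ G.Adj a b := by
  by_contra hcon
  push Not at hcon
  exact hyA (h A hA hne (fun a ha b hb hab => by
    by_contra hbA
    exact hcon a ha b hb hbA hab) hy)

theorem pre_singleton (x : V) : Pre G {x} := by
  intro A hA ⟨a, ha⟩ _ y hy
  have := hA ha
  simp only [Set.mem_singleton_iff] at this hy
  rw [hy, ← this]; exact ha

theorem pre_union {A B : Set V} (hA : Pre G A) (hB : Pre G B) {a b : V} (ha : a ∈ A)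
    (hb : b ∈ B) (hab : a = b ∨ G.Adj a b) : Pre G (A ∪ B) := by
  intro X hX ⟨x, hx⟩ hcl
  have keyA : (X ∩ A).Nonempty → A ⊆ X := fun hne y hy =>
    (hA (X ∩ A) Set.inter_subset_right hne
      (fun u hu v hv huv => ⟨hcl u hu.1 v (Or.inl hv) huv, hv⟩) hy).1
  have keyB : (X ∩ B).Nonempty → B ⊆ X := fun hne y hy =>
    (hB (X ∩ B) Set.inter_subset_right hne
      (fun u hu v hv huv => ⟨hcl u hu.1 v (Or.inr hv) huv, hv⟩) hy).1
  have hiff : a ∈ X ↔ b ∈ X := by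
    rcases hab with rfl | hab
    · rfl
    · exact ⟨fun h => hcl a h b (Or.inr hb) hab, fun h => hcl b h a (Or.inl ha) hab.symm⟩
  rcases hX hx with h | h
  · have h1 := keyA ⟨x, hx, h⟩
    exact Set.union_subset h1 (keyB ⟨b, hiff.1 (h1 ha), hb⟩)
  · have h1 := keyB ⟨x, hx, h⟩
    exact Set.union_subset (keyA ⟨a, hiff.2 (h1 hb), ha⟩) h1

theorem pre_insert {A : Set V} (hA : Pre G A) {a x : V} (ha : a ∈ A) (h : G.Adj x a) :
    Pre G (insert x A) := by
  have := pre_union (pre_singleton (G := G) x) hA (Set.mem_singleton x) ha (Or.inr h)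
  rwa [Set.singleton_union] at this

theorem pre_path {q : ℕ → V} {a b : ℕ} (hab : a ≤ b)
    (h : ∀ i, a ≤ i → i < b → G.Adj (q i) (q (i + 1))) : Pre G (q '' Set.Icc a b) := by
  induction b, hab using Nat.le_induction with
  | base => simpa using pre_singleton (q a)
  | succ n hn ih =>
    have h1 := pre_insert (ih fun i h1 h2 => h i h1 (by omega)) (x := q (n + 1)) (a := q n)
      ⟨n, ⟨hn, le_rfl⟩, rfl⟩ (h n hn (by omega)).symm
    convert h1 using 1
    rw [← Set.image_insert_eq]
    congr 1
    ext i
    simp only [Set.mem_Icc, Set.mem_insert_iff]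
    omega

theorem exists_component {S X : Set V} (hS : Pre G S) (hne : S.Nonempty) (hSX : S ⊆ X) :
    ∃ W, S ⊆ W ∧ W ⊆ X ∧ Pre G W ∧ ∀ a ∈ W, ∀ b ∈ X, G.Adj a b → b ∈ W := by
  obtain ⟨x, hx⟩ := hne
  let P : Set V → Prop := fun A => A ⊆ X ∧ x ∈ A ∧ ∀ a ∈ A, ∀ b ∈ X, G.Adj a b → b ∈ A
  let W : Set V := {y | ∀ A, P A → y ∈ A}
  have hPX : P X := ⟨le_rfl, hSX hx, fun _ _ b hb _ => hb⟩
  have hWX : W ⊆ X := fun y hy => hy X hPX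
  have hWcl : ∀ a ∈ W, ∀ b ∈ X, G.Adj a b → b ∈ W := fun a ha b hb hab A hA =>
    hA.2.2 a (ha A hA) b hb hab
  have hxW : x ∈ W := fun A hA => hA.2.1
  refine ⟨W, ?_, hWX, ?_, hWcl⟩
  · intro y hy A hA
    exact (hS (A ∩ S) Set.inter_subset_right ⟨x, hA.2.1, hx⟩
      (fun a ha b hb hab => ⟨hA.2.2 a ha.1 b (hSX hb) hab, hb⟩) hy).1
  · intro A hAW hAne hAcl
    by_cases hxA : x ∈ A
    · intro y hy
      exact hy A ⟨hAW.trans hWX, hxA, fun a ha b hb hab =>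
        hAcl a ha b (hWcl a (hAW ha) b hb hab) hab⟩
    · exfalso
      obtain ⟨z, hz⟩ := hAne
      have := hAW hz (W \ A) ⟨Set.sdiff_subset.trans hWX, ⟨hxW, hxA⟩, fun a ha b hb hab =>
        ⟨hWcl a ha.1 b hb hab, fun hbA => ha.2 (hAcl b hbA a ha.1 hab.symm)⟩⟩
      exact this.2 hz

theorem Pre.exists_seq {Y : Set V} (hY : Pre G Y) {x y : V} (hx : x ∈ Y) (hy : y ∈ Y) :
    ∃ (n : ℕ) (q : ℕ → V), q 0 = x ∧ q n = y ∧ (∀ i ≤ n, q i ∈ Y) ∧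
      ∀ i < n, G.Adj (q i) (q (i + 1)) := by
  let A : Set V := {y | ∃ (n : ℕ) (q : ℕ → V), q 0 = x ∧ q n = y ∧ (∀ i ≤ n, q i ∈ Y) ∧
      ∀ i < n, G.Adj (q i) (q (i + 1))}
  have hAY : A ⊆ Y := by
    rintro z ⟨n, q, -, rfl, h, -⟩
    exact h n le_rfl
  refine hY A hAY ⟨x, 0, fun _ => x, rfl, rfl, fun _ _ => hx, by simp⟩ ?_ hy
  rintro a ⟨n, q, h0, rfl, hm, had⟩ b hb hab
  refine ⟨n + 1, fun i => if i ≤ n then q i else b, by simp [h0], by simp, ?_, ?_⟩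
  · intro i hi
    by_cases h : i ≤ n
    · simpa [h] using hm i h
    · simpa [h] using hb
  · intro i hi
    by_cases h : i + 1 ≤ n
    · have h' : i ≤ n := by omega
      simpa [h, h'] using had i h
    · have : i = n := by omega
      subst this
      simpa using hab

theorem pre_of_closed_meets {S B : Set V} (hB : Pre G (S ∩ B))
    (h : ∀ A ⊆ S, A.Nonempty → (∀ a ∈ A, ∀ b ∈ S, G.Adj a b → b ∈ A) → (A ∩ B).Nonempty) :
    Pre G S := by
  intro A hA hne hcl
  by_contra hcon
  obtain ⟨y, hy, hyA⟩ := Set.not_subset.1 hcon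
  have h1 := h A hA hne hcl
  obtain ⟨z, hz, hzB⟩ := h (S \ A) Set.sdiff_subset ⟨y, hy, hyA⟩ (fun a ha b hb hab =>
    ⟨hb, fun hbA => ha.2 (hcl b hbA a ha.1 hab.symm)⟩)
  obtain ⟨x, hx, hxB⟩ := h1
  have := hB (A ∩ B) (Set.inter_subset_inter_left _ hA) ⟨x, hx, hxB⟩
    (fun a ha b hb hab => ⟨hcl a ha.1 b hb.1 hab, hb.2⟩) ⟨hz.1, hzB⟩
  exact hz.2 this.1

theorem tc_of_closed_meets [Finite V] {B B' : Set V} (hB : TC G B) (hBB : B ⊆ B')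
    (h : ∀ c, ∀ A ⊆ B' \ {c}, A.Nonempty →
      (∀ a ∈ A, ∀ b ∈ B' \ {c}, G.Adj a b → b ∈ A) → (A ∩ B).Nonempty) : TC G B' := by
  refine ⟨hB.1.trans (Set.ncard_le_ncard hBB), fun c => ?_⟩
  refine pre_of_closed_meets (B := B) ?_ (h c)
  have : B' \ {c} ∩ B = B \ {c} := by
    ext x
    simp only [Set.mem_inter_iff, Set.mem_sdiff]
    exact ⟨fun hx => ⟨hx.2, hx.1.2⟩, fun hx => ⟨⟨hBB hx.1, hx.2⟩, hx.1⟩⟩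
  rw [this]; exact hB.2 c

theorem TC.exists_ne [Finite V] {B : Set V} (hB : TC G B) (c : V) : ∃ x ∈ B, x ≠ c :=
  Set.exists_ne_of_one_lt_ncard hB.1 c

theorem TC.pre {B : Set V} (hB : TC G B) {c : V} (hc : c ∉ B) : Pre G B := by
  simpa [hc] using hB.2 c

theorem tc_pair {a b : V} (h : G.Adj a b) : TC G {a, b} := by
  refine ⟨(Set.ncard_pair h.ne).ge, fun c => ?_⟩
  by_cases hca : c = a
  · subst hca
    have : ({c, b} : Set V) \ {c} = {b} := by
      ext x; simp only [Set.mem_sdiff, Set.mem_insert_iff, Set.mem_singleton_iff]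
      have := h.ne
      constructor
      · tauto
      · rintro rfl; exact ⟨Or.inr rfl, this.symm⟩
    rw [this]; exact pre_singleton b
  by_cases hcb : c = b
  · subst hcb
    have : ({a, c} : Set V) \ {c} = {a} := by
      ext x; simp only [Set.mem_sdiff, Set.mem_insert_iff, Set.mem_singleton_iff]
      have := h.ne
      constructor
      · tauto
      · rintro rfl; exact ⟨Or.inl rfl, this⟩
    rw [this]; exact pre_singleton a
  · have : ({a, b} : Set V) \ {c} = {a, b} := by
      ext x; simp only [Set.mem_sdiff, Set.mem_insert_iff, Set.mem_singleton_iff]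
      constructor
      · tauto
      · rintro (rfl | rfl)
        · exact ⟨Or.inl rfl, fun h => hca h.symm⟩
        · exact ⟨Or.inr rfl, fun h => hcb h.symm⟩
    rw [this]
    exact pre_insert (pre_singleton b) rfl h

end Prelim

section Ears
variable {V : Type*} {G : SimpleGraph V}

theorem exists_ctr_superset [Finite V] (hG : TriConn G) {B S : Set V} (hB : TC G B)
    (hS : Pre G S) (hne : S.Nonempty) (hSB : ∀ s ∈ S, s ∉ B) :
    ∃ W, S ⊆ W ∧ (∀ w ∈ W, w ∉ B) ∧ Ctr G W ∧ ∀ a ∈ W, ∀ b, b ∉ B → G.Adj a b → b ∈ W := by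
  obtain ⟨W, hSW, hWX, hW, hcl⟩ := exists_component (X := Bᶜ) hS hne hSB
  refine ⟨W, hSW, hWX, ⟨hne.mono hSW, hW, ?_⟩, hcl⟩
  refine tc_of_closed_meets hB (fun x hx hxW => hWX hxW hx) ?_
  intro c A hA hAne hAcl
  by_contra hcon
  have hAB : ∀ a ∈ A, a ∉ B := fun a ha hb => hcon ⟨a, ha, hb⟩
  obtain ⟨a, ha⟩ := hAne
  have hall := hG A c c (fun u hu v huv => by
    by_contra hv
    push Not at hv
    by_cases hvW : v ∈ W
    · exact (hA hu).1 (hcl v hvW u (hAB u hu) huv.symm)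
    · exact hv.1 (hAcl u hu v ⟨hvW, hv.2.1⟩ huv)) ⟨a, ha, (hA ha).2, (hA ha).2⟩
  obtain ⟨x, hxB, hxc⟩ := hB.exists_ne c
  rcases hall x with h | h | h
  · exact hAB x h hxB
  · exact hxc h
  · exact hxc h

theorem TC.exists_two_attachments {B D : Set V} (hB : TC G B) (hD : D ⊆ B) (hne : D.Nonempty)
    {x₁ x₂ : V} (h₁ : x₁ ∈ B) (h₂ : x₂ ∈ B) (h₁' : x₁ ∉ D) (h₂' : x₂ ∉ D) (h₁₂ : x₁ ≠ x₂) :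
    ∃ h ∈ B, ∃ h' ∈ B, h ∉ D ∧ h' ∉ D ∧ h ≠ h' ∧ (∃ y ∈ D, G.Adj y h) ∧ ∃ y ∈ D, G.Adj y h' := by
  by_contra hcon
  push Not at hcon
  have hc : ∃ c, c ∉ D ∧ ∀ y ∈ D, ∀ b ∈ B, G.Adj y b → b ∈ D ∨ b = c := by
    by_cases hex : ∃ c ∈ B, c ∉ D ∧ ∃ y ∈ D, G.Adj y c
    · obtain ⟨c, hcB, hcD, hy⟩ := hex
      refine ⟨c, hcD, fun y hyD b hb hyb => ?_⟩
      by_contra hb'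
      push Not at hb'
      exact hcon c hcB b hb hcD hb'.1 hb'.2.symm hy y hyD hyb
    · push Not at hex
      refine ⟨x₁, h₁', fun y hyD b hb hyb => ?_⟩
      by_contra hb'
      push Not at hb'
      exact hex b hb hb'.1 y hyD hyb
  obtain ⟨c, hcD, hc⟩ := hc
  have := hB.2 c D (fun y hy => ⟨hD hy, fun h => hcD (h ▸ hy)⟩) hne
    (fun a ha b hb hab => (hc a ha b hb.1 hab).resolve_right hb.2)
  by_cases h : x₁ = c
  · exact h₂' (this ⟨h₂, fun h' => h₁₂ (h.trans h'.symm)⟩)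
  · exact h₁' (this ⟨h₁, h⟩)

/-- `q 0, …, q (r + 1)` is a walk with distinct ends in `H` and interior in `Y`. -/
structure IsEar (G : SimpleGraph V) (H Y : Set V) (r : ℕ) (q : ℕ → V) : Prop where
  pos : 1 ≤ r
  first : q 0 ∈ H
  last : q (r + 1) ∈ H
  ne : q 0 ≠ q (r + 1)
  mem : ∀ i, 1 ≤ i → i ≤ r → q i ∈ Y
  adj : ∀ i, i ≤ r → G.Adj (q i) (q (i + 1))

/-- An ear of minimum length. -/
def IsMinEar (G : SimpleGraph V) (H Y : Set V) (r : ℕ) (q : ℕ → V) : Prop :=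
  IsEar G H Y r q ∧ ∀ r' q', IsEar G H Y r' q' → r ≤ r'

theorem exists_isMinEar {H Y : Set V} (hY : Pre G Y) {h h' : V} (hh : h ∈ H) (hh' : h' ∈ H)
    (hne : h ≠ h') (hy : ∃ y ∈ Y, G.Adj y h) (hy' : ∃ y ∈ Y, G.Adj y h') :
    ∃ r q, IsMinEar G H Y r q := by
  obtain ⟨y, hyY, hy⟩ := hy
  obtain ⟨y', hyY', hy'⟩ := hy'
  have hex : ∃ r, ∃ q, IsEar G H Y r q := by
    obtain ⟨n, q, h0, hn, hm, ha⟩ := hY.exists_seq hyY hyY'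
    refine ⟨n + 1, fun i => if i = 0 then h else if i ≤ n + 1 then q (i - 1) else h', ?_⟩
    refine ⟨by omega, by simpa, by simpa, by simpa, ?_, ?_⟩
    · intro i h1 h2
      have : i ≠ 0 := by omega
      simp only [this, h2, if_true, if_false]
      exact hm _ (by omega)
    · intro i hi
      rcases Nat.eq_zero_or_pos i with rfl | hpos
      · simpa [h0] using hy.symm
      · have h0' : i ≠ 0 := by omega
        by_cases hin : i = n + 1
        · subst hin
          simpa [hn] using hy'
        · have h1 : i ≤ n + 1 := hi
          have h2 : i + 1 ≤ n + 1 := by omega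
          have h3 := ha (i - 1) (by omega)
          rw [Nat.sub_add_cancel hpos] at h3
          simpa [h0', h1, h2, show i ≤ n by omega] using h3
  classical
  obtain ⟨q, hq⟩ := Nat.find_spec hex
  exact ⟨_, q, hq, fun r' q' h => Nat.find_min' hex ⟨q', h⟩⟩

theorem IsEar.shortcut {H Y : Set V} {r : ℕ} {q : ℕ → V} (hq : IsEar G H Y r q) {i j : ℕ}
    (hij : i + 2 ≤ j) (hj : j ≤ r + 1) (hne : 1 ≤ i ∨ j ≤ r) (hadj : G.Adj (q i) (q j)) :
    ∃ q', IsEar G H Y (r - (j - i - 1)) q' := by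
  obtain ⟨d, rfl⟩ : ∃ d, j = i + 1 + d := ⟨j - (i + 1), by omega⟩
  have hd : i + 1 + d - i - 1 = d := by omega
  rw [hd]
  refine ⟨fun t => if t ≤ i then q t else q (t + d), by omega, by simpa using hq.first, ?_, ?_, ?_,
    ?_⟩
  · have h1 : ¬ (r - d + 1 ≤ i) := by omega
    have h2 : r - d + 1 + d = r + 1 := by omega
    simpa [h1, h2] using hq.last
  · have h1 : ¬ (r - d + 1 ≤ i) := by omega
    have h2 : r - d + 1 + d = r + 1 := by omega
    simpa [h1, h2] using hq.ne
  · intro t h1 h2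
    by_cases ht : t ≤ i
    · simp only [ht, if_true]; exact hq.mem _ h1 (by omega)
    · simp only [ht, if_false]; exact hq.mem _ (by omega) (by omega)
  · intro t ht
    by_cases h1 : t ≤ i
    · by_cases h2 : t + 1 ≤ i
      · simp only [h1, h2, if_true]; exact hq.adj _ (by omega)
      · have : t = i := by omega
        subst this
        simp only [h1, h2, if_true, if_false]; exact hadj
    · have h2 : ¬ (t + 1 ≤ i) := by omega
      simp only [h1, h2, if_false]
      have := hq.adj (t + d) (by omega)
      rwa [show t + d + 1 = t + 1 + d by omega] at this

theorem IsMinEar.chordless {H Y : Set V} {r : ℕ} {q : ℕ → V} (hq : IsMinEar G H Y r q) {i j : ℕ}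
    (hij : i + 2 ≤ j) (hj : j ≤ r + 1) (hne : 1 ≤ i ∨ j ≤ r) : ¬ G.Adj (q i) (q j) := by
  intro h
  obtain ⟨q', h'⟩ := hq.1.shortcut hij hj hne h
  have := hq.2 _ _ h'
  omega

theorem IsMinEar.inj_lt {H Y : Set V} (hHY : ∀ y ∈ Y, y ∉ H) {r : ℕ} {q : ℕ → V}
    (hq : IsMinEar G H Y r q) {i j : ℕ} (hij : i < j) (hj : j ≤ r + 1) : q i ≠ q j := by
  intro h
  have hjr : j ≤ r ∨ j = r + 1 := by omega
  rcases Nat.eq_zero_or_pos i with rfl | hi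
  · rcases hjr with hjr | rfl
    · exact hHY _ (hq.1.mem j (by omega) hjr) (h ▸ hq.1.first)
    · exact hq.1.ne h
  · rcases hjr with hjr | rfl
    · refine hq.chordless (i := i) (j := j + 1) (by omega) (by omega) (Or.inl hi) ?_
      rw [h]; exact hq.1.adj j hjr
    · exact hHY _ (hq.1.mem i hi (by omega)) (h ▸ hq.1.last)

theorem IsMinEar.inj {H Y : Set V} (hHY : ∀ y ∈ Y, y ∉ H) {r : ℕ} {q : ℕ → V}
    (hq : IsMinEar G H Y r q) {i j : ℕ} (hi : i ≤ r + 1) (hj : j ≤ r + 1) (h : q i = q j) :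
    i = j := by
  rcases lt_trichotomy i j with h' | h' | h'
  · exact absurd h (hq.inj_lt hHY h' hj)
  · exact h'
  · exact absurd h.symm (hq.inj_lt hHY h' hi)

theorem IsMinEar.attach {H Y : Set V} {r : ℕ} {q : ℕ → V}
    (hq : IsMinEar G H Y r q) {i : ℕ} (hi : 1 ≤ i) (hir : i ≤ r) {h : V} (hh : h ∈ H)
    (hadj : G.Adj (q i) h) : (h ≠ q 0 → i = r) ∧ (h ≠ q (r + 1) → i = 1) := by
  constructor
  · intro hne
    have hear : IsEar G H Y i (fun t => if t ≤ i then q t else h) := by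
      refine ⟨hi, by simpa using hq.1.first, by simpa, by simpa using hne.symm, ?_, ?_⟩
      · intro t h1 h2
        simp only [h2, if_true]; exact hq.1.mem t h1 (by omega)
      · intro t ht
        by_cases h2 : t + 1 ≤ i
        · simp only [ht, h2, if_true]; exact hq.1.adj t (by omega)
        · have : t = i := by omega
          subst this
          simpa using hadj
    have := hq.2 _ _ hear
    omega
  · intro hne
    have hear : IsEar G H Y (r + 1 - i) (fun t => if t = 0 then h else q (t + i - 1)) := by
      refine ⟨by omega, by simpa, ?_, ?_, ?_, ?_⟩
      · have : r + 1 - i + 1 + i - 1 = r + 1 := by omega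
        simpa [this] using hq.1.last
      · have : r + 1 - i + 1 + i - 1 = r + 1 := by omega
        simpa [this] using hne
      · intro t h1 h2
        have : t ≠ 0 := by omega
        simp only [this, if_false]; exact hq.1.mem _ (by omega) (by omega)
      · intro t ht
        rcases Nat.eq_zero_or_pos t with rfl | hpos
        · simpa [show 0 + 1 + i - 1 = i by omega] using hadj.symm
        · have : t ≠ 0 := by omega
          simp only [this, if_false, Nat.succ_ne_zero]
          have := hq.1.adj (t + i - 1) (by omega)
          rwa [show t + i - 1 + 1 = t + 1 + i - 1 by omega] at this
    have := hq.2 _ _ hear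
    omega

/-- Adding a path with distinct ends in `H` preserves `TC`. -/
theorem tc_union_path [Finite V] {H : Set V} (hH : TC G H) {r : ℕ} {q : ℕ → V} (h0 : q 0 ∈ H)
    (hr : q (r + 1) ∈ H) (hinj : ∀ i j, i ≤ r + 1 → j ≤ r + 1 → q i = q j → i = j)
    (hadj : ∀ i, i ≤ r → G.Adj (q i) (q (i + 1))) : TC G (H ∪ q '' Set.Icc 1 r) := by
  refine tc_of_closed_meets hH Set.subset_union_left ?_
  intro c A hA ⟨a, ha⟩ hcl
  have hmem : ∀ i, i ≤ r + 1 → q i ∈ H ∪ q '' Set.Icc 1 r := by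
    intro i hi
    rcases Nat.eq_zero_or_pos i with rfl | hpos
    · exact Or.inl h0
    · rcases Nat.lt_or_ge r i with h | h
      · have : i = r + 1 := by omega
        subst this; exact Or.inl hr
      · exact Or.inr ⟨i, ⟨hpos, h⟩, rfl⟩
  rcases (hA ha).1 with haH | ⟨i, ⟨hi1, hi2⟩, rfl⟩
  · exact ⟨a, ha, haH⟩
  have hac : q i ≠ c := (hA ha).2
  by_cases hdown : ∃ t, t ≤ i ∧ q t = c
  · obtain ⟨t, hti, htc⟩ := hdown
    have hup : ∀ s, i ≤ s → s ≤ r + 1 → q s ∈ A := by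
      intro s hs
      induction s, hs using Nat.le_induction with
      | base => exact fun _ => ha
      | succ s hs ih =>
        intro h
        refine hcl _ (ih (by omega)) _ ⟨hmem _ h, ?_⟩ (hadj s (by omega))
        intro hsc
        have := hinj (s + 1) t (by omega) (by omega) (hsc.trans htc.symm)
        omega
    exact ⟨_, hup (r + 1) (by omega) le_rfl, hr⟩
  · push Not at hdown
    have hdn : ∀ s, s ≤ i → q (i - s) ∈ A := by
      intro s
      induction s with
      | zero => exact fun _ => ha
      | succ s ih =>
        intro h
        refine hcl _ (ih (by omega)) _ ⟨hmem _ (by omega), hdown _ (by omega)⟩ ?_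
        have := hadj (i - (s + 1)) (by omega)
        rw [show i - (s + 1) + 1 = i - s by omega] at this
        exact this.symm
    have := hdn i le_rfl
    rw [Nat.sub_self] at this
    exact ⟨_, this, h0⟩

theorem IsMinEar.tc [Finite V] {H Y : Set V} (hH : TC G H) (hHY : ∀ y ∈ Y, y ∉ H) {r : ℕ}
    {q : ℕ → V} (hq : IsMinEar G H Y r q) : TC G (H ∪ q '' Set.Icc 1 r) :=
  tc_union_path hH hq.1.first hq.1.last (fun _ _ hi hj h => hq.inj hHY hi hj h) hq.1.adj

theorem exists_ctr_of_ear [Finite V] (hG : TriConn G) {H Y S : Set V} (hH : TC G H)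
    (hY : Pre G Y) (hHY : ∀ y ∈ Y, y ∉ H) {h h' : V} (hh : h ∈ H) (hh' : h' ∈ H)
    (hne : h ≠ h') (hy : ∃ y ∈ Y, G.Adj y h) (hy' : ∃ y ∈ Y, G.Adj y h')
    (hS : Pre G S) (hSne : S.Nonempty) (hSH : ∀ s ∈ S, s ∉ H) (hSY : ∀ s ∈ S, s ∉ Y) :
    ∃ W, S ⊆ W ∧ Ctr G W ∧ (∀ w ∈ W, w ∉ H) ∧ ∃ y ∈ Y, y ∉ W := by
  obtain ⟨r, q, hq⟩ := exists_isMinEar hY hh hh' hne hy hy'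
  obtain ⟨W, h1, h2, h3, -⟩ := exists_ctr_superset hG (hq.tc hH hHY) hS hSne (by
    rintro s hs (h | ⟨i, ⟨hi1, hi2⟩, rfl⟩)
    · exact hSH s hs h
    · exact hSY _ hs (hq.1.mem i hi1 hi2))
  exact ⟨W, h1, h3, fun w hw hwH => h2 w hw (Or.inl hwH), q 1, hq.1.mem 1 le_rfl hq.1.pos,
    fun hw => h2 _ hw (Or.inr ⟨1, ⟨le_rfl, hq.1.pos⟩, rfl⟩)⟩

end Ears

section Chains
variable {V : Type*} {G : SimpleGraph V}

/-- `Z = {q 1, …, q r}` is the interior of an induced path attached to `K`, all of whose other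
neighbours lie in `K`. -/
structure ChainOver (G : SimpleGraph V) (K Z : Set V) (r : ℕ) (q : ℕ → V) : Prop where
  pos : 1 ≤ r
  eq : Z = q '' Set.Icc 1 r
  notMem : ∀ i, i ≤ r + 1 → q i ∉ K
  inj : ∀ i j, i ≤ r + 1 → j ≤ r + 1 → q i = q j → i = j
  adj : ∀ i, i ≤ r → G.Adj (q i) (q (i + 1))
  adjK : ∀ i, 1 ≤ i → i ≤ r → ∃ k ∈ K, G.Adj (q i) k
  nbr : 2 ≤ r → ∀ i, 1 ≤ i → i ≤ r → ∀ v, G.Adj (q i) v → v ∈ K ∨ v = q (i - 1) ∨ v = q (i + 1)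

namespace ChainOver
variable {K Z : Set V} {r : ℕ} {q : ℕ → V}

theorem mem (h : ChainOver G K Z r q) {i : ℕ} (h1 : 1 ≤ i) (h2 : i ≤ r) : q i ∈ Z := by
  rw [h.eq]; exact ⟨i, ⟨h1, h2⟩, rfl⟩

theorem exists_eq (h : ChainOver G K Z r q) {z : V} (hz : z ∈ Z) : ∃ i, 1 ≤ i ∧ i ≤ r ∧ q i = z := by
  rw [h.eq] at hz
  obtain ⟨i, ⟨h1, h2⟩, rfl⟩ := hz
  exact ⟨i, h1, h2, rfl⟩

theorem ncard_eq (h : ChainOver G K Z r q) : Z.ncard = r := by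
  rw [h.eq, Set.InjOn.ncard_image, Set.ncard_eq_toFinset_card']
  · simp
  · intro i hi j hj hij
    exact h.inj i j (by have := hi.2; omega) (by have := hj.2; omega) hij

theorem pre (h : ChainOver G K Z r q) : Pre G Z := by
  rw [h.eq]
  exact pre_path h.pos fun i _ h2 => h.adj i h2.le

theorem pre_Icc (h : ChainOver G K Z r q) {a b : ℕ} (hab : a ≤ b) (hb : b ≤ r + 1) :
    Pre G (q '' Set.Icc a b) :=
  pre_path hab fun i _ h2 => h.adj i (by omega)

theorem reverse (h : ChainOver G K Z r q) : ChainOver G K Z r (fun i => q (r + 1 - i)) where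
  pos := h.pos
  eq := by
    rw [h.eq]
    ext x
    constructor
    · rintro ⟨i, ⟨h1, h2⟩, rfl⟩
      exact ⟨r + 1 - i, ⟨by omega, by omega⟩, by simp only; congr 1; omega⟩
    · rintro ⟨i, ⟨h1, h2⟩, rfl⟩
      exact ⟨r + 1 - i, ⟨by omega, by omega⟩, rfl⟩
  notMem i _ := h.notMem _ (by omega)
  inj i j hi hj hij := by
    have := h.inj _ _ (by omega) (by omega) hij
    omega
  adj i hi := by
    have := h.adj (r - i) (by omega)
    rw [show r - i + 1 = r + 1 - i by omega] at this
    simpa [show r + 1 - (i + 1) = r - i by omega] using this.symm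
  adjK i h1 h2 := h.adjK _ (by omega) (by omega)
  nbr hr i h1 h2 v hv := by
    have := h.nbr hr _ (by omega) (by omega) v hv
    rw [show r + 1 - i - 1 = r + 1 - (i + 1) by omega,
      show r + 1 - i + 1 = r + 1 - (i - 1) by omega] at this
    tauto

end ChainOver

theorem TriConn.exists_third (hG : TriConn G) {U : Set V} (hne : U.Nonempty) {a b x : V}
    (ha : a ∉ U) (hb : b ∉ U) (hx : x ∉ U) (hxa : x ≠ a) (hxb : x ≠ b) :
    ∃ u ∈ U, ∃ w, G.Adj u w ∧ w ∉ U ∧ w ≠ a ∧ w ≠ b := by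
  by_contra hcon
  push Not at hcon
  obtain ⟨u, hu⟩ := hne
  rcases hG U a b (fun u hu w huw => by
    by_contra hw
    push Not at hw
    exact hw.2.2 (hcon u hu w huw hw.1 hw.2.1))
    ⟨u, hu, fun h => ha (h ▸ hu), fun h => hb (h ▸ hu)⟩ x with h' | h' | h'
  · exact hx h'
  · exact hxa h'
  · exact hxb h'

/-- `T` is a minimal `Ctr` set properly containing the `Ctr` set `K`. -/
structure CtrCover (G : SimpleGraph V) (K T : Set V) : Prop where
  lower : Ctr G K
  upper : Ctr G T
  subset : K ⊆ T
  ne : K ≠ T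
  min : ∀ X, Ctr G X → K ⊆ X → X ⊆ T → X = K ∨ X = T

theorem exists_ctrCover [Finite V] {K T : Set V} (hK : Ctr G K) (hT : Ctr G T) (hKT : K ⊆ T)
    (hne : K ≠ T) : ∃ T', T' ⊆ T ∧ CtrCover G K T' := by
  obtain ⟨T', ⟨h1, h2, h3, h4⟩, hmin⟩ := Set.Finite.exists_minimal
    (s := {X : Set V | Ctr G X ∧ K ⊆ X ∧ K ≠ X ∧ X ⊆ T}) (Set.toFinite _) ⟨T, hT, hKT, hne, le_rfl⟩
  refine ⟨T', h4, hK, h1, h2, h3, fun X hX hKX hXT => ?_⟩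
  by_cases h : K = X
  · exact Or.inl h.symm
  · exact Or.inr (hXT.antisymm (hmin ⟨hX, hKX, h, hXT.trans h4⟩ hXT))

theorem CtrCover.exists_mem {K T : Set V} (h : CtrCover G K T) : ∃ z ∈ T, z ∉ K :=
  Set.not_subset.1 fun h' => h.ne (h.subset.antisymm h')

/-- An ear in `T \ K` between vertices outside `T` contains all neighbours of `K` in `T`. -/
theorem CtrCover.mem_ear [Finite V] (hG : TriConn G) {K T Y : Set V} (h : CtrCover G K T)
    (hYT : Y ⊆ T \ K) {r : ℕ} {q : ℕ → V} (hq : IsMinEar G Tᶜ Y r q) {j : V} (hj : j ∈ T \ K)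
    {k : V} (hk : k ∈ K) (hjk : G.Adj k j) : ∃ i, 1 ≤ i ∧ i ≤ r ∧ q i = j := by
  have hYH : ∀ y ∈ Y, y ∉ Tᶜ := fun y hy hn => hn (hYT hy).1
  obtain ⟨W, h1, h2, h3, h4⟩ := exists_ctr_superset hG (hq.tc h.upper.2.2 hYH) h.lower.2.1
    h.lower.1 (by
      rintro s hs (hT | ⟨i, ⟨hi1, hi2⟩, rfl⟩)
      · exact hT (h.subset hs)
      · exact (hYT (hq.1.mem i hi1 hi2)).2 hs)
  have hWT : W ⊆ T := fun w hw => by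
    by_contra hn
    exact h2 w hw (Or.inl hn)
  have hq1 : q 1 ∉ W := fun hw => h2 _ hw (Or.inr ⟨1, ⟨le_rfl, hq.1.pos⟩, rfl⟩)
  have hWK : W = K := (h.min W h3 h1 hWT).resolve_right
    (fun hw => hq1 (hw ▸ (hYT (hq.1.mem 1 le_rfl hq.1.pos)).1))
  by_contra hcon
  have := h4 k (h1 hk) j (by
    rintro (hT | ⟨i, ⟨hi1, hi2⟩, rfl⟩)
    · exact hT hj.1
    · exact hcon ⟨i, hi1, hi2, rfl⟩) hjk
  rw [hWK] at this
  exact hj.2 this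

theorem CtrCover.mem_of_two_attachments [Finite V] (hG : TriConn G) {K T Y : Set V}
    (hc : CtrCover G K T) (hYT : Y ⊆ T \ K) (hY : Pre G Y) {h h' : V} (hh : h ∉ T) (hh' : h' ∉ T)
    (hne : h ≠ h') (hy : ∃ y ∈ Y, G.Adj y h) (hy' : ∃ y ∈ Y, G.Adj y h') {j : V}
    (hj : j ∈ T \ K) {k : V} (hk : k ∈ K) (hjk : G.Adj k j) : j ∈ Y := by
  obtain ⟨r, q, hq⟩ := exists_isMinEar (H := Tᶜ) hY hh hh' hne hy hy'
  obtain ⟨i, h1, h2, rfl⟩ := hc.mem_ear hG hYT hq hj hk hjk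
  exact hq.1.mem i h1 h2

theorem CtrCover.exists_isMinEar [Finite V] {K T : Set V} (h : CtrCover G K T) :
    ∃ r q, IsMinEar G Tᶜ (T \ K) r q := by
  obtain ⟨z, hzT, hzK⟩ := h.exists_mem
  obtain ⟨D, hzD, hDX, hD, hcl⟩ := exists_component (X := T \ K) (pre_singleton (G := G) z)
    (Set.singleton_nonempty z) (Set.singleton_subset_iff.2 ⟨hzT, hzK⟩)
  have h2 := h.upper.2.2.1
  obtain ⟨x₁, hx₁, x₂, hx₂, hne⟩ := (Set.one_lt_ncard).1 h2
  obtain ⟨a, ha, b, hb, haD, hbD, hab, hya, hyb⟩ := h.lower.2.2.exists_two_attachments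
    (D := D) (fun y hy => (hDX hy).2) ⟨z, hzD rfl⟩ (x₁ := x₁) (x₂ := x₂)
    (fun hk => hx₁ (h.subset hk)) (fun hk => hx₂ (h.subset hk))
    (fun hd => hx₁ (hDX hd).1) (fun hd => hx₂ (hDX hd).1) hne
  have key : ∀ c, c ∈ Kᶜ → c ∉ D → (∃ y ∈ D, G.Adj y c) → c ∈ Tᶜ := by
    rintro c hc hcD ⟨y, hy, hyc⟩ hcT
    exact hcD (hcl y hy c ⟨hcT, hc⟩ hyc)
  obtain ⟨r, q, hq⟩ := _root_.exists_isMinEar (H := Tᶜ) hD (key a ha haD hya) (key b hb hbD hyb)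
    hab hya hyb
  obtain ⟨r', q', hq'⟩ : ∃ r q, IsEar G Tᶜ (T \ K) r q :=
    ⟨r, q, hq.1.pos, hq.1.first, hq.1.last, hq.1.ne, fun i h1 h2 => hDX (hq.1.mem i h1 h2),
      hq.1.adj⟩
  classical
  have hex : ∃ r q, IsEar G Tᶜ (T \ K) r q := ⟨r', q', hq'⟩
  obtain ⟨q, hq⟩ := Nat.find_spec hex
  exact ⟨_, q, hq, fun r' q' h => Nat.find_min' hex ⟨q', h⟩⟩

theorem CtrCover.exists_adj [Finite V] (hG : TriConn G) {K T : Set V} (h : CtrCover G K T)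
    {v : V} (hv : v ∈ T \ K) : ∃ k ∈ K, G.Adj k v := by
  by_contra hvJ
  obtain ⟨r, q, hq⟩ := h.exists_isMinEar
  have hYH : ∀ y ∈ T \ K, y ∉ Tᶜ := fun y hy hn => hn hy.1
  let J : Set V := {z | z ∈ T \ K ∧ ∃ k ∈ K, G.Adj k z}
  have hJq : ∀ j ∈ J, ∃ i, 1 ≤ i ∧ i ≤ r ∧ q i = j := by
    rintro j ⟨hj, k, hk, hkj⟩
    exact h.mem_ear hG le_rfl hq hj hk hkj
  have hforce : ∀ Y, Y ⊆ T \ K → Pre G Y → ∀ a b, a ∉ T → b ∉ T → a ≠ b →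
      (∃ y ∈ Y, G.Adj y a) → (∃ y ∈ Y, G.Adj y b) → J ⊆ Y := by
    rintro Y h1 h2 a b h3 h4 h5 h6 h7 j ⟨hj, k, hk, hkj⟩
    exact h.mem_of_two_attachments hG h1 h2 h3 h4 h5 h6 h7 hj hk hkj
  obtain ⟨z, hzT, hzK⟩ := h.exists_mem
  obtain ⟨k₀, hk₀⟩ := h.lower.1
  have hJne : J.Nonempty := by
    obtain ⟨a, ha, b, hb, hbK, hab⟩ := h.upper.2.1.exists_adj h.subset h.lower.1 hzT hzK
    exact ⟨b, ⟨hb, hbK⟩, a, ha, hab⟩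
  obtain ⟨U, hvU, hUX, hU, hUcl⟩ := exists_component (X := (T \ K) \ J) (pre_singleton (G := G) v)
    (Set.singleton_nonempty v) (Set.singleton_subset_iff.2 ⟨hv, fun hj => hvJ hj.2⟩)
  have hvU : v ∈ U := hvU rfl
  have hUK : ∀ u ∈ U, ∀ w, G.Adj u w → w ∉ K := fun u hu w huw hw =>
    (hUX hu).2 ⟨(hUX hu).1, w, hw, huw.symm⟩
  have hUN : ∀ u ∈ U, ∀ w, G.Adj u w → w ∈ U ∨ w ∈ J ∨ w ∉ T := by
    intro u hu w huw
    by_contra hcon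
    push Not at hcon
    exact hcon.1 (hUcl u hu w ⟨⟨hcon.2.2, hUK u hu w huw⟩, hcon.2.1⟩ huw)
  have hH1 : ∀ a b, a ∉ T → b ∉ T → (∃ y ∈ U, G.Adj y a) → (∃ y ∈ U, G.Adj y b) → a = b := by
    intro a b ha hb hya hyb
    by_contra hab
    have := hforce U (hUX.trans Set.sdiff_subset) hU a b ha hb hab hya hyb
    obtain ⟨j, hj⟩ := hJne
    exact (hUX (this hj)).2 hj
  have hsep : ∀ a b, a ∉ K → b ∉ K → a ∉ U → b ∉ U →
      ∃ u ∈ U, ∃ w, G.Adj u w ∧ w ∉ U ∧ w ≠ a ∧ w ≠ b := by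
    intro a b ha hb haU hbU
    exact hG.exists_third ⟨v, hvU⟩ haU hbU (fun hk => (hUX hk).1.2 hk₀) (fun h => ha (h ▸ hk₀))
      (fun h => hb (h ▸ hk₀))
  have hJU : ∀ j ∈ J, j ∉ U := fun j hj hjU => (hUX hjU).2 hj
  have hHU : ∀ j, j ∉ T → j ∉ U := fun j hj hjU => hj (hUX hjU).1.1
  have hHK : ∀ j, j ∉ T → j ∉ K := fun j hj hjK => hj (h.subset hjK)
  let P : ℕ → Prop := fun i => 1 ≤ i ∧ i ≤ r ∧ q i ∈ J ∧ ∃ u ∈ U, G.Adj u (q i)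
  have hPex : ∃ i, P i := by
    obtain ⟨h0, hh0, hh0'⟩ : ∃ h0, h0 ∉ T ∧ ∀ a, a ∉ T → (∃ y ∈ U, G.Adj y a) → a = h0 := by
      by_cases hex : ∃ a, a ∉ T ∧ ∃ y ∈ U, G.Adj y a
      · obtain ⟨a, ha, hya⟩ := hex
        exact ⟨a, ha, fun b hb hyb => hH1 b a hb ha hyb hya⟩
      · push Not at hex
        exact ⟨q 0, hq.1.first, fun b hb ⟨y, hy, hyb⟩ => absurd hyb (hex b hb y hy)⟩
    obtain ⟨u, hu, w, huw, hwU, hw, -⟩ := hsep h0 h0 (hHK _ hh0) (hHK _ hh0) (hHU _ hh0)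
      (hHU _ hh0)
    rcases hUN u hu w huw with h' | h' | h'
    · exact absurd h' hwU
    · obtain ⟨i, h1, h2, rfl⟩ := hJq w h'
      exact ⟨i, h1, h2, h', u, hu, huw⟩
    · exact absurd (hh0' w h' ⟨u, hu, huw⟩) hw
  obtain ⟨a, ⟨ha1, har, haJ, ua, hua, haadj⟩, hamin⟩ : ∃ a, P a ∧ ∀ i, P i → a ≤ i := by
    classical
    exact ⟨Nat.find hPex, Nat.find_spec hPex, fun i hi => Nat.find_min' hPex hi⟩
  obtain ⟨b, ⟨hb1, hbr, hbJ, ub, hub, hbadj⟩, hbmax⟩ : ∃ b, P b ∧ ∀ i, P i → i ≤ b := by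
    classical
    obtain ⟨i, hi⟩ := hPex
    refine ⟨Nat.findGreatest P r, Nat.findGreatest_spec hi.2.1 hi, fun j hj =>
      Nat.le_findGreatest hj.2.1 hj⟩
  have hpA : Pre G (q '' Set.Icc 1 a ∪ U) :=
    pre_union (pre_path ha1 fun i _ h2 => hq.1.adj i (by omega)) hU ⟨a, ⟨ha1, le_rfl⟩, rfl⟩ hua
      (Or.inr haadj.symm)
  have hpB : Pre G (q '' Set.Icc b r ∪ U) :=
    pre_union (pre_path hbr fun i _ h2 => hq.1.adj i (by omega)) hU ⟨b, ⟨le_rfl, hbr⟩, rfl⟩ hub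
      (Or.inr hbadj.symm)
  have hsA : q '' Set.Icc 1 a ∪ U ⊆ T \ K := by
    rintro x (⟨i, ⟨h1, h2⟩, rfl⟩ | hx)
    · exact hq.1.mem i h1 (by omega)
    · exact (hUX hx).1
  have hsB : q '' Set.Icc b r ∪ U ⊆ T \ K := by
    rintro x (⟨i, ⟨h1, h2⟩, rfl⟩ | hx)
    · exact hq.1.mem i (by omega) h2
    · exact (hUX hx).1
  have hfirst : ∃ y ∈ q '' Set.Icc 1 a ∪ U, G.Adj y (q 0) :=
    ⟨q 1, Or.inl ⟨1, ⟨le_rfl, ha1⟩, rfl⟩, (hq.1.adj 0 (by omega)).symm⟩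
  have hlast : ∃ y ∈ q '' Set.Icc b r ∪ U, G.Adj y (q (r + 1)) :=
    ⟨q r, Or.inl ⟨r, ⟨hbr, le_rfl⟩, rfl⟩, hq.1.adj r le_rfl⟩
  obtain ⟨u, hu, w, huw, hwU, hwa, hwb⟩ := hsep (q a) (q b) haJ.1.2 hbJ.1.2 (hJU _ haJ) (hJU _ hbJ)
  rcases hUN u hu w huw with h' | h' | h'
  · exact hwU h'
  · obtain ⟨t, h1, h2, rfl⟩ := hJq w h'
    have hat := hamin t ⟨h1, h2, h', u, hu, huw⟩
    have htb := hbmax t ⟨h1, h2, h', u, hu, huw⟩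
    have hY := hforce ((q '' Set.Icc 1 a ∪ U) ∪ (q '' Set.Icc b r ∪ U))
      (Set.union_subset hsA hsB) (pre_union hpA hpB (Or.inr hua) (Or.inr hua) (Or.inl rfl))
      (q 0) (q (r + 1)) hq.1.first hq.1.last hq.1.ne
      (by obtain ⟨y, hy, hy'⟩ := hfirst; exact ⟨y, Or.inl hy, hy'⟩)
      (by obtain ⟨y, hy, hy'⟩ := hlast; exact ⟨y, Or.inr hy, hy'⟩) h'
    rcases hY with (⟨i, ⟨hi1, hi2⟩, hi⟩ | hY) | (⟨i, ⟨hi1, hi2⟩, hi⟩ | hY)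
    · have := hq.inj hYH (by omega) (by omega) hi
      exact hwa (by rw [show t = a by omega])
    · exact hwU hY
    · have := hq.inj hYH (by omega) (by omega) hi
      exact hwb (by rw [show t = b by omega])
    · exact hwU hY
  · by_cases hw0 : w = q 0
    · have hY := hforce _ hsB hpB w (q (r + 1)) h' hq.1.last (hw0 ▸ hq.1.ne)
        ⟨u, Or.inr hu, huw⟩ hlast
      obtain ⟨u', hu', w', huw', hwU', hwb', hww'⟩ := hsep (q b) w hbJ.1.2 (hHK _ h') (hJU _ hbJ)
        hwU
      rcases hUN u' hu' w' huw' with h'' | h'' | h''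
      · exact hwU' h''
      · rcases hY h'' with ⟨i, ⟨hi1, hi2⟩, rfl⟩ | hY
        · have := hbmax i ⟨by omega, hi2, h'', u', hu', huw'⟩
          exact hwb' (by rw [show i = b by omega])
        · exact hwU' hY
      · exact hww' (hH1 _ _ h'' h' ⟨u', hu', huw'⟩ ⟨u, hu, huw⟩)
    · have hY := hforce _ hsA hpA w (q 0) h' hq.1.first hw0
        ⟨u, Or.inr hu, huw⟩ hfirst
      obtain ⟨u', hu', w', huw', hwU', hwb', hww'⟩ := hsep (q a) w haJ.1.2 (hHK _ h') (hJU _ haJ)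
        hwU
      rcases hUN u' hu' w' huw' with h'' | h'' | h''
      · exact hwU' h''
      · rcases hY h'' with ⟨i, ⟨hi1, hi2⟩, rfl⟩ | hY
        · have := hamin i ⟨by omega, by omega, h'', u', hu', huw'⟩
          exact hwb' (by rw [show i = a by omega])
        · exact hwU' hY
      · exact hww' (hH1 _ _ h'' h' ⟨u', hu', huw'⟩ ⟨u, hu, huw⟩)

/-- Consecutive contractible sets differ by a chain. -/
theorem CtrCover.exists_chain [Finite V] (hG : TriConn G) {K T : Set V} (h : CtrCover G K T) :
    ∃ r q, ChainOver G K (T \ K) r q ∧ q 0 ∉ T ∧ q (r + 1) ∉ T := by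
  obtain ⟨r, q, hq⟩ := h.exists_isMinEar
  have hYH : ∀ y ∈ T \ K, y ∉ Tᶜ := fun y hy hn => hn hy.1
  have hJ : ∀ z ∈ T \ K, ∃ i, 1 ≤ i ∧ i ≤ r ∧ q i = z := by
    intro z hz
    obtain ⟨k, hk, hkz⟩ := h.exists_adj hG hz
    exact h.mem_ear hG le_rfl hq hz hk hkz
  refine ⟨r, q, ⟨hq.1.pos, ?_, ?_, fun i j hi hj => hq.inj hYH hi hj, hq.1.adj, ?_, ?_⟩,
    hq.1.first, hq.1.last⟩
  · ext z
    constructor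
    · intro hz
      obtain ⟨i, h1, h2, rfl⟩ := hJ z hz
      exact ⟨i, ⟨h1, h2⟩, rfl⟩
    · rintro ⟨i, ⟨h1, h2⟩, rfl⟩
      exact hq.1.mem i h1 h2
  · intro i hi
    by_cases h0 : i = 0
    · subst h0; exact fun hk => hq.1.first (h.subset hk)
    by_cases h1 : i = r + 1
    · subst h1; exact fun hk => hq.1.last (h.subset hk)
    exact (hq.1.mem i (by omega) (by omega)).2
  · intro i h1 h2
    obtain ⟨k, hk, hki⟩ := h.exists_adj hG (hq.1.mem i h1 h2)
    exact ⟨k, hk, hki.symm⟩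
  · intro hr i h1 h2 v hv
    by_cases hvK : v ∈ K
    · exact Or.inl hvK
    right
    by_cases hvT : v ∈ T
    · obtain ⟨j, hj1, hj2, rfl⟩ := hJ v ⟨hvT, hvK⟩
      have hij : i ≠ j := by rintro rfl; exact hv.ne rfl
      by_cases hlt : i < j
      · by_cases hj : j = i + 1
        · right; rw [hj]
        · exact absurd hv (hq.chordless (by omega) (by omega) (Or.inl h1))
      · by_cases hj : j = i - 1
        · left; rw [hj]
        · exact absurd hv.symm (hq.chordless (by omega) (by omega) (Or.inl hj1))
    · have hat := hq.attach h1 h2 hvT hv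
      by_cases hv0 : v = q 0
      · left
        have : v ≠ q (r + 1) := hv0 ▸ hq.1.ne
        rw [hv0, hat.2 this]
      · right
        have hir := hat.1 hv0
        by_cases hvr : v = q (r + 1)
        · rw [hvr, hir]
        · have := hat.2 hvr
          omega

end Chains

section Fans
variable {V : Type*} {G : SimpleGraph V}

theorem pre_of_closed_mem {S : Set V} (w : V)
    (h : ∀ A ⊆ S, A.Nonempty → (∀ a ∈ A, ∀ b ∈ S, G.Adj a b → b ∈ A) → w ∈ A) : Pre G S := by
  intro A hA hne hcl
  by_contra hcon
  obtain ⟨y, hy, hyA⟩ := Set.not_subset.1 hcon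
  exact (h (S \ A) Set.sdiff_subset ⟨y, hy, hyA⟩ (fun a ha b hb hab =>
    ⟨hb, fun hbA => ha.2 (hcl b hbA a ha.1 hab.symm)⟩)).2 (h A hA hne hcl)

theorem ncard_image_Icc {q : ℕ → V} {a b : ℕ}
    (hinj : ∀ i j, a ≤ i → i ≤ b → a ≤ j → j ≤ b → q i = q j → i = j) :
    (q '' Set.Icc a b).ncard = b + 1 - a := by
  rw [Set.InjOn.ncard_image, Set.ncard_eq_toFinset_card']
  · simp
  · exact fun i hi j hj hij => hinj i j hi.1 hi.2 hj.1 hj.2 hij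

/-- No contractible set has between `m` and `2m - 4` vertices. -/
def NoMid (G : SimpleGraph V) (m : ℕ) : Prop :=
  ∀ W, Ctr G W → W.ncard < m ∨ 2 * m - 4 < W.ncard

/-- An initial segment of a fan with centre `z` is contractible. -/
theorem ctr_fan [Finite V] (hG : TriConn G) {s : ℕ → V} {i : ℕ} {z : V}
    (hinj : ∀ a b, a ≤ i + 1 → b ≤ i + 1 → s a = s b → a = b) (hz : ∀ a, a ≤ i + 1 → s a ≠ z)
    (hadj : ∀ t, t < i → G.Adj (s t) (s (t + 1)))
    (hnbr : ∀ t, 1 ≤ t → t ≤ i → ∀ v, G.Adj (s t) v → v = z ∨ v = s (t - 1) ∨ v = s (t + 1))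
    (hlast : G.Adj (s (i + 1)) z) : Ctr G (s '' Set.Icc 0 i) := by
  have hzS : z ∉ s '' Set.Icc 0 i := by
    rintro ⟨t, ht, h⟩
    exact hz t (by have := ht.2; omega) h
  have hlS : s (i + 1) ∉ s '' Set.Icc 0 i := by
    rintro ⟨t, ht, h⟩
    have := hinj t (i + 1) (by have := ht.2; omega) le_rfl h
    have := ht.2
    omega
  refine ⟨⟨s 0, 0, ⟨le_rfl, by omega⟩, rfl⟩, pre_path (by omega) fun t _ ht => hadj t ht, ?_, ?_⟩
  · exact (Set.one_lt_ncard).2 ⟨z, hzS, s (i + 1), hlS, (hz _ le_rfl).symm⟩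
  · intro c
    obtain ⟨w, hw⟩ : ∃ w, (c ≠ z → w = z) ∧ (c = z → w = s (i + 1)) := by
      by_cases h : c = z
      · exact ⟨s (i + 1), fun h' => absurd h h', fun _ => rfl⟩
      · exact ⟨z, fun _ => rfl, fun h' => absurd h' h⟩
    have hws : w = z ∨ w = s (i + 1) := by
      by_cases h : c = z
      · exact Or.inr (hw.2 h)
      · exact Or.inl (hw.1 h)
    refine pre_of_closed_mem w fun A hA hne hcl => ?_
    by_contra hwA
    have hs0 : s 0 ∉ A := fun h => (hA h).1 ⟨0, ⟨le_rfl, by omega⟩, rfl⟩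
    have hws0 : w ≠ s 0 := by
      rcases hws with h | h
      · rw [h]; exact (hz 0 (by omega)).symm
      · rw [h]; intro h'
        have := hinj _ _ le_rfl (by omega) h'
        omega
    have hwc : w ≠ c := by
      intro h
      by_cases hcz : c = z
      · rw [hw.2 hcz, hcz] at h; exact hz _ le_rfl h
      · rw [hw.1 hcz] at h; exact hcz h.symm
    obtain ⟨u, hu, v, huv, hvA, hvc, hvs⟩ := hG.exists_third hne (fun h => (hA h).2 rfl) hs0 hwA
      hwc hws0
    by_cases hvS : v ∈ s '' Set.Icc 0 i
    · obtain ⟨t, ⟨-, ht⟩, rfl⟩ := hvS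
      have ht0 : t ≠ 0 := by rintro rfl; exact hvs rfl
      rcases hnbr t (by omega) ht u huv.symm with h | h | h
      · by_cases hcz : c = z
        · exact (hA hu).2 (h.trans hcz.symm)
        · exact hwA (by rw [hw.1 hcz, ← h]; exact hu)
      · exact (hA hu).1 ⟨t - 1, ⟨by omega, by omega⟩, h.symm⟩
      · by_cases hti : t + 1 ≤ i
        · exact (hA hu).1 ⟨t + 1, ⟨by omega, by omega⟩, h.symm⟩
        · have hti : t = i := by omega
          subst hti
          by_cases hcz : c = z
          · exact hwA (by rw [hw.2 hcz, ← h]; exact hu)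
          · refine hwA ?_
            rw [hw.1 hcz]
            exact hcl u hu z ⟨hzS, fun h => hcz h.symm⟩ (h ▸ hlast)
    · exact hvA (hcl u hu v ⟨hvS, hvc⟩ huv)

theorem ctr_tail_or [Finite V] (hG : TriConn G) {l : ℕ} {r : ℕ → V} {p y d : V}
    (hinj : ∀ i j, i ≤ l + 1 → j ≤ l + 1 → r i = r j → i = j)
    (hp : ∀ i, i ≤ l + 1 → r i ≠ p) (hy : ∀ i, i ≤ l + 1 → r i ≠ y) (hd : ∀ i, i ≤ l + 1 → r i ≠ d)
    (hadj : ∀ i, i ≤ l → G.Adj (r i) (r (i + 1))) (hpy : G.Adj p y) (hpd : G.Adj p d) (hdy : d ≠ y)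
    (hTC : TC G (({p, y} : Set V) ∪ r '' Set.Icc 1 l)ᶜ) {i : ℕ} (hi : 1 ≤ i) (hil : i < l) :
    (G.Adj (r (i + 1)) p → ∃ W, Ctr G W ∧ i ≤ W.ncard ∧ W.ncard ≤ i + 1 ∧
      ∀ t, 1 ≤ t → t ≤ i → G.Adj (r t) y → W.ncard = i + 1) ∧
    (G.Adj (r (i + 1)) y → ∃ W, Ctr G W ∧ W.ncard = i) := by
  have hdB : d ∈ (({p, y} : Set V) ∪ r '' Set.Icc 1 l)ᶜ := by
    rintro ((h | h) | ⟨t, ⟨h1, h2⟩, h⟩)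
    · exact hpd.ne h.symm
    · exact hdy h
    · exact hd t (by omega) h
  have hlB : r (l + 1) ∈ (({p, y} : Set V) ∪ r '' Set.Icc 1 l)ᶜ := by
    rintro ((h | h) | ⟨t, ⟨h1, h2⟩, h⟩)
    · exact hp _ le_rfl h
    · exact hy _ le_rfl h
    · have := hinj t (l + 1) (by omega) le_rfl h
      omega
  have hS : Pre G (r '' Set.Icc 1 i) := pre_path hi fun t _ ht => hadj t (by omega)
  have hSc : (r '' Set.Icc 1 i).ncard = i := by
    rw [ncard_image_Icc fun a b h1 h2 h3 h4 h => hinj a b (by omega) (by omega) h]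
    omega
  have hSne : (r '' Set.Icc 1 i).Nonempty := ⟨_, 1, ⟨le_rfl, hi⟩, rfl⟩
  have hyS : y ∉ r '' Set.Icc 1 i := by
    rintro ⟨t, ⟨h1, h2⟩, h⟩
    exact hy t (by omega) h
  have hnot : ∀ {B : Set V}, ({p, y} ∪ r '' Set.Icc 1 l)ᶜ ⊆ B → p ∈ B →
      (∀ t, i + 1 ≤ t → t ≤ l → r t ∈ B) → ∀ w, w ∉ B → w = y ∨ w ∈ r '' Set.Icc 1 i := by
    intro B h1 h2 h3 w hw
    by_contra hcon
    push Not at hcon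
    refine hw (h1 ?_)
    rintro ((h | h) | ⟨t, ⟨ht1, ht2⟩, h⟩)
    · exact hw (by rw [h]; exact h2)
    · exact hcon.1 h
    · by_cases hti : t ≤ i
      · exact hcon.2 ⟨t, ⟨ht1, hti⟩, h⟩
      · exact hw (h ▸ h3 t (by omega) ht2)
  constructor
  · intro hr
    let s : ℕ → V := fun t => if t = 0 then d else if t = 1 then p else r (i + t - 1)
    have hT := tc_union_path hTC (r := l - i + 1) (q := s) hdB (by
        have h1 : i + (l - i + 1 + 1) - 1 = l + 1 := by omega
        have h2 : ¬ (l - i + 1 + 1 = 1) := by omega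
        simpa only [s, h1, h2, if_false, Nat.succ_ne_zero] using hlB) (by
        intro a b ha hb hab
        simp only [s] at hab
        split_ifs at hab
        · omega
        · exact absurd hab.symm hpd.ne
        · exact absurd hab.symm (hd _ (by omega))
        · exact absurd hab hpd.ne
        · omega
        · exact absurd hab.symm (hp _ (by omega))
        · exact absurd hab (hd _ (by omega))
        · exact absurd hab (hp _ (by omega))
        · have := hinj _ _ (by omega) (by omega) hab
          omega) (by
        intro a ha
        simp only [s]
        rcases a with _ | _ | a
        · simpa using hpd.symm
        · simpa using hr.symm
        · rw [if_neg (by omega), if_neg (by omega), if_neg (by omega), if_neg (by omega),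
            show i + (a + 1 + 1 + 1) - 1 = i + (a + 1 + 1) - 1 + 1 by omega]
          exact hadj _ (by omega))
    obtain ⟨W, h1, h2, h3, h4⟩ := exists_ctr_superset hG hT hS hSne (by
      rintro _ ⟨t, ⟨ht1, ht2⟩, rfl⟩ (h | ⟨u, ⟨hu1, hu2⟩, hu⟩)
      · exact h (Or.inr ⟨t, ⟨ht1, by omega⟩, rfl⟩)
      · simp only [s] at hu
        split_ifs at hu
        · omega
        · exact hp _ (by omega) hu.symm
        · have := hinj _ _ (by omega) (by omega) hu
          omega)
    have hnot' := hnot (B := _ ∪ s '' Set.Icc 1 (l - i + 1)) Set.subset_union_left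
      (Or.inr ⟨1, ⟨le_rfl, by omega⟩, by simp [s]⟩)
      (fun t ht1 ht2 => Or.inr ⟨t + 1 - i, ⟨by omega, by omega⟩, by
        simp only [s]
        rw [if_neg (by omega), if_neg (by omega)]
        congr 1; omega⟩)
    have hWle : W ⊆ insert y (r '' Set.Icc 1 i) := fun w hw => hnot' w (h2 w hw)
    have hc := Set.ncard_le_ncard hWle
    rw [Set.ncard_insert_of_notMem hyS, hSc] at hc
    have hc' := Set.ncard_le_ncard h1
    rw [hSc] at hc'
    refine ⟨W, h3, hc', hc, fun t ht1 ht2 hty => ?_⟩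
    have hyW : y ∈ W := by
      refine h4 (r t) (h1 ⟨t, ⟨ht1, ht2⟩, rfl⟩) y ?_ hty
      rintro (h | ⟨u, ⟨hu1, hu2⟩, hu⟩)
      · exact h (Or.inl (Or.inr rfl))
      · simp only [s] at hu
        split_ifs at hu
        · omega
        · exact hpy.ne hu
        · exact hy _ (by omega) hu
    have := Set.ncard_le_ncard (Set.insert_subset hyW h1)
    rw [Set.ncard_insert_of_notMem hyS, hSc] at this
    omega
  · intro hr
    let s : ℕ → V := fun t => if t = 0 then d else if t = 1 then p else if t = 2 then y else
      r (i + t - 2)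
    have hT := tc_union_path hTC (r := l - i + 2) (q := s) hdB (by
        have h1 : i + (l - i + 2 + 1) - 2 = l + 1 := by omega
        have h2 : ¬ (l - i + 2 + 1 = 1) := by omega
        have h3 : ¬ (l - i + 2 + 1 = 2) := by omega
        simpa only [s, h1, h2, h3, if_false, Nat.succ_ne_zero] using hlB) (by
        intro a b ha hb hab
        simp only [s] at hab
        split_ifs at hab
        · omega
        · exact absurd hab.symm hpd.ne
        · exact absurd hab hdy
        · exact absurd hab.symm (hd _ (by omega))
        · exact absurd hab hpd.ne
        · omega
        · exact absurd hab hpy.ne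
        · exact absurd hab.symm (hp _ (by omega))
        · exact absurd hab.symm hdy
        · exact absurd hab.symm hpy.ne
        · omega
        · exact absurd hab.symm (hy _ (by omega))
        · exact absurd hab (hd _ (by omega))
        · exact absurd hab (hp _ (by omega))
        · exact absurd hab (hy _ (by omega))
        · have := hinj _ _ (by omega) (by omega) hab
          omega) (by
        intro a ha
        simp only [s]
        rcases a with _ | _ | _ | a
        · simpa using hpd.symm
        · simpa using hpy
        · simpa using hr.symm
        · rw [if_neg (by omega), if_neg (by omega), if_neg (by omega), if_neg (by omega),
            if_neg (by omega), if_neg (by omega),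
            show i + (a + 1 + 1 + 1 + 1) - 2 = i + (a + 1 + 1 + 1) - 2 + 1 by omega]
          exact hadj _ (by omega))
    obtain ⟨W, h1, h2, h3, h4⟩ := exists_ctr_superset hG hT hS hSne (by
      rintro _ ⟨t, ⟨ht1, ht2⟩, rfl⟩ (h | ⟨u, ⟨hu1, hu2⟩, hu⟩)
      · exact h (Or.inr ⟨t, ⟨ht1, by omega⟩, rfl⟩)
      · simp only [s] at hu
        split_ifs at hu
        · omega
        · exact hp _ (by omega) hu.symm
        · exact hy _ (by omega) hu.symm
        · have := hinj _ _ (by omega) (by omega) hu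
          omega)
    have hnot' := hnot (B := _ ∪ s '' Set.Icc 1 (l - i + 2)) Set.subset_union_left
      (Or.inr ⟨1, ⟨le_rfl, by omega⟩, by simp [s]⟩)
      (fun t ht1 ht2 => Or.inr ⟨t + 2 - i, ⟨by omega, by omega⟩, by
        simp only [s]
        rw [if_neg (by omega), if_neg (by omega), if_neg (by omega)]
        congr 1; omega⟩)
    have hWS : W = r '' Set.Icc 1 i := by
      refine Set.Subset.antisymm (fun w hw => (hnot' w (h2 w hw)).resolve_left ?_) h1
      rintro rfl
      exact h2 w hw (Or.inr ⟨2, ⟨by omega, by omega⟩, by simp [s]⟩)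
    exact ⟨W, h3, by rw [hWS, hSc]⟩

/-- An induced path `r 1, …, r l` all of whose vertices have a neighbour among two adjacent centres
`p` and `y`, with all other neighbours on the path extended by `r 0` and `r (l + 1)`, whose union
with the centres can be deleted, with or without a further neighbour `d` of `p`. -/
structure DoubleFan (G : SimpleGraph V) (l : ℕ) (r : ℕ → V) (p y d : V) : Prop where
  inj : ∀ i j, i ≤ l + 1 → j ≤ l + 1 → r i = r j → i = j
  ne_p : ∀ i, i ≤ l + 1 → r i ≠ p
  ne_y : ∀ i, i ≤ l + 1 → r i ≠ y
  ne_d : ∀ i, i ≤ l + 1 → r i ≠ d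
  adj : ∀ i, i ≤ l → G.Adj (r i) (r (i + 1))
  nbr : ∀ i, 1 ≤ i → i ≤ l → ∀ v, G.Adj (r i) v →
    v = p ∨ v = y ∨ v = r (i - 1) ∨ v = r (i + 1)
  adj_or : ∀ i, 1 ≤ i → i ≤ l → G.Adj (r i) p ∨ G.Adj (r i) y
  adj_py : G.Adj p y
  adj_pd : G.Adj p d
  ne_dy : d ≠ y
  tc : TC G (({p, y} : Set V) ∪ r '' Set.Icc 1 l)ᶜ
  tc' : TC G (insert d (({p, y} : Set V) ∪ r '' Set.Icc 1 l))ᶜ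

theorem DoubleFan.reverse {l : ℕ} {r : ℕ → V} {p y d : V} (h : DoubleFan G l r p y d) :
    DoubleFan G l (fun i => r (l + 1 - i)) p y d := by
  have heq : (fun i => r (l + 1 - i)) '' Set.Icc 1 l = r '' Set.Icc 1 l := by
    ext x
    constructor
    · rintro ⟨i, ⟨h1, h2⟩, rfl⟩
      exact ⟨l + 1 - i, ⟨by omega, by omega⟩, rfl⟩
    · rintro ⟨i, ⟨h1, h2⟩, rfl⟩
      exact ⟨l + 1 - i, ⟨by omega, by omega⟩, by simp only; congr 1; omega⟩
  refine ⟨fun i j hi hj hij => ?_, fun i hi => h.ne_p _ (by omega), fun i hi => h.ne_y _ (by omega),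
    fun i hi => h.ne_d _ (by omega), fun i hi => ?_, fun i h1 h2 v hv => ?_,
    fun i h1 h2 => h.adj_or _ (by omega) (by omega), h.adj_py, h.adj_pd, h.ne_dy,
    by rw [heq]; exact h.tc, by rw [heq]; exact h.tc'⟩
  · have := h.inj _ _ (by omega) (by omega) hij
    omega
  · have := h.adj (l - i) (by omega)
    rw [show l - i + 1 = l + 1 - i by omega] at this
    simpa [show l + 1 - (i + 1) = l - i by omega] using this.symm
  · have := h.nbr _ (by omega) (by omega) v hv
    rw [show l + 1 - i - 1 = l + 1 - (i + 1) by omega,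
      show l + 1 - i + 1 = l + 1 - (i - 1) by omega] at this
    tauto

theorem DoubleFan.exists_ctr [Finite V] (hG : TriConn G) {l : ℕ} {r : ℕ → V} {p y d : V}
    (h : DoubleFan G l r p y d) {i : ℕ} (hi : 1 ≤ i) (hil : i < l) :
    (G.Adj (r (i + 1)) p → ∃ W, Ctr G W ∧ i ≤ W.ncard ∧ W.ncard ≤ i + 1 ∧
      ∀ t, 1 ≤ t → t ≤ i → G.Adj (r t) y → W.ncard = i + 1) ∧
    (G.Adj (r (i + 1)) y → ∃ W, Ctr G W ∧ W.ncard = i) :=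
  ctr_tail_or hG h.inj h.ne_p h.ne_y h.ne_d h.adj h.adj_py h.adj_pd h.ne_dy h.tc hi hil

theorem DoubleFan.last_not_adj [Finite V] (hG : TriConn G) {m : ℕ} (hm : 5 ≤ m) (hmid : NoMid G m)
    {r : ℕ → V} {p y d : V} (h : DoubleFan G m r p y d) : ¬ G.Adj (r m) p := by
  intro hr
  by_cases hy : ∃ t, 1 ≤ t ∧ t ≤ m - 1 ∧ G.Adj (r t) y
  · obtain ⟨t, h1, h2, h3⟩ := hy
    have := (h.exists_ctr hG (i := m - 1) (by omega) (by omega)).1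
    rw [show m - 1 + 1 = m by omega] at this
    obtain ⟨W, hW, -, -, h4⟩ := this hr
    have h5 := h4 t h1 h2 h3
    have := hmid W hW
    omega
  · push Not at hy
    have := ctr_fan hG (s := r) (i := m - 1) (z := p)
      (fun a b ha hb => h.inj a b (by omega) (by omega)) (fun a ha => h.ne_p a (by omega))
      (fun t ht => h.adj t (by omega)) (fun t h1 h2 v hv => by
        rcases h.nbr t h1 (by omega) v hv with h' | rfl | h'
        · exact Or.inl h'
        · exact absurd hv (hy t h1 h2)
        · exact Or.inr h') (by rwa [show m - 1 + 1 = m by omega])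
    have h2 := hmid _ this
    rw [ncard_image_Icc fun a b _ ha _ hb => h.inj a b (by omega) (by omega)] at h2
    omega

theorem DoubleFan.false [Finite V] (hG : TriConn G) {m : ℕ} (hm : 5 ≤ m) (hmid : NoMid G m)
    {l : ℕ} (hl : m ≤ l) {r : ℕ → V} {p y d : V} (h : DoubleFan G l r p y d) : False := by
  by_cases hlm : m + 1 ≤ l
  · obtain ⟨h1, h2⟩ := h.exists_ctr hG (i := m) (by omega) (by omega)
    rcases h.adj_or (m + 1) (by omega) hlm with h' | h'
    · obtain ⟨W, hW, h3, h4, -⟩ := h1 h'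
      have := hmid W hW
      omega
    · obtain ⟨W, hW, h3⟩ := h2 h'
      have := hmid W hW
      omega
  have hlm : l = m := by omega
  subst hlm
  have hlast := h.last_not_adj hG hm hmid
  have hfirst := h.reverse.last_not_adj hG hm hmid
  simp only [show l + 1 - l = 1 by omega] at hfirst
  have hly := (h.adj_or l (by omega) le_rfl).resolve_left hlast
  have hfy := (h.adj_or 1 (by omega) (by omega)).resolve_left hfirst
  by_cases hp : ∃ t, 2 ≤ t ∧ t ≤ l - 1 ∧ G.Adj (r t) p
  · obtain ⟨t, ht1, ht2, ht⟩ := hp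
    let S : Set V := insert d (insert p (r '' Set.Icc 2 (l - 1)))
    have hpre : Pre G S := by
      refine pre_insert (pre_insert (pre_path (by omega) fun i _ hi => h.adj i (by omega))
        ⟨t, ⟨ht1, ht2⟩, rfl⟩ ht.symm) (Set.mem_insert _ _) h.adj_pd.symm
    let s : ℕ → V := fun i => if i = 2 then y else if i ≤ 1 then r i else r (l + i - 3)
    have hc := tc_union_path h.tc' (r := 3) (q := s) (by
        rintro (h' | (h' | h') | ⟨u, ⟨hu1, hu2⟩, hu⟩)
        · exact h.ne_d 0 (by omega) h'
        · exact h.ne_p 0 (by omega) h'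
        · exact h.ne_y 0 (by omega) h'
        · have := h.inj u 0 (by omega) (by omega) hu
          omega) (by
        have : s (3 + 1) = r (l + 1) := by simp [s]
        rw [this]
        rintro (h' | (h' | h') | ⟨u, ⟨hu1, hu2⟩, hu⟩)
        · exact h.ne_d _ (by omega) h'
        · exact h.ne_p _ (by omega) h'
        · exact h.ne_y _ (by omega) h'
        · have := h.inj u _ (by omega) (by omega) hu
          omega) (by
        intro a b ha hb hab
        simp only [s] at hab
        split_ifs at hab
        · omega
        · exact absurd hab.symm (h.ne_y _ (by omega))
        · exact absurd hab.symm (h.ne_y _ (by omega))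
        · exact absurd hab (h.ne_y _ (by omega))
        · exact h.inj _ _ (by omega) (by omega) hab
        · have := h.inj _ _ (by omega) (by omega) hab
          omega
        · exact absurd hab (h.ne_y _ (by omega))
        · have := h.inj _ _ (by omega) (by omega) hab
          omega
        · have := h.inj _ _ (by omega) (by omega) hab
          omega) (by
        intro a ha
        have : a = 0 ∨ a = 1 ∨ a = 2 ∨ a = 3 := by omega
        rcases this with rfl | rfl | rfl | rfl
        · simpa [s] using h.adj 0 (by omega)
        · simpa [s] using hfy
        · simpa [s] using hly.symm
        · simpa [s] using h.adj l le_rfl)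
    have hS : Sᶜ = (insert d (({p, y} : Set V) ∪ r '' Set.Icc 1 l))ᶜ ∪ s '' Set.Icc 1 3 := by
      ext v
      constructor
      · intro hv
        by_contra hcon
        rw [Set.mem_union, not_or] at hcon
        obtain ⟨h1, h2⟩ := hcon
        rcases not_not.1 h1 with rfl | (rfl | rfl) | ⟨u, ⟨hu1, hu2⟩, rfl⟩
        · exact hv (Or.inl rfl)
        · exact hv (Or.inr (Or.inl rfl))
        · exact h2 ⟨2, ⟨by omega, by omega⟩, by simp [s]⟩
        · by_cases hu : u = 1
          · exact h2 ⟨1, ⟨by omega, by omega⟩, by simp [s, hu]⟩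
          by_cases hu' : u = l
          · exact h2 ⟨3, ⟨by omega, by omega⟩, by simp [s, hu']⟩
          exact hv (Or.inr (Or.inr ⟨u, ⟨by omega, by omega⟩, rfl⟩))
      · rintro (hv | ⟨a, ⟨ha1, ha2⟩, rfl⟩) hvS
        · refine hv ?_
          rcases hvS with h' | h' | ⟨u, ⟨hu1, hu2⟩, h'⟩
          · exact Or.inl h'
          · exact Or.inr (Or.inl (Or.inl h'))
          · exact Or.inr (Or.inr ⟨u, ⟨by omega, by omega⟩, h'⟩)
        · have : a = 1 ∨ a = 2 ∨ a = 3 := by omega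
          rcases this with rfl | rfl | rfl
          · simp only [s] at hvS
            rcases hvS with h' | h' | ⟨u, ⟨hu1, hu2⟩, h'⟩
            · exact h.ne_d 1 (by omega) h'
            · exact h.ne_p 1 (by omega) h'
            · have := h.inj _ _ (by omega) (by omega) h'
              omega
          · simp only [s] at hvS
            rcases hvS with h' | h' | ⟨u, ⟨hu1, hu2⟩, h'⟩
            · exact h.ne_dy h'.symm
            · exact h.adj_py.ne h'.symm
            · exact h.ne_y _ (by omega) h'
          · simp only [s] at hvS
            rcases hvS with h' | h' | ⟨u, ⟨hu1, hu2⟩, h'⟩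
            · exact h.ne_d l (by omega) h'
            · exact h.ne_p l (by omega) h'
            · have := h.inj _ _ (by omega) (by omega) h'
              omega
    have hCS : Ctr G S := ⟨⟨d, Or.inl rfl⟩, hpre, by rw [hS]; exact hc⟩
    have hmS := hmid S hCS
    have hp' : p ∉ r '' Set.Icc 2 (l - 1) := by
      rintro ⟨u, ⟨hu1, hu2⟩, hu⟩
      exact h.ne_p u (by omega) hu
    have hd' : d ∉ insert p (r '' Set.Icc 2 (l - 1)) := by
      rintro (h' | ⟨u, ⟨hu1, hu2⟩, hu⟩)
      · exact h.adj_pd.ne h'.symm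
      · exact h.ne_d u (by omega) hu
    rw [Set.ncard_insert_of_notMem hd', Set.ncard_insert_of_notMem hp',
      ncard_image_Icc fun a b _ ha _ hb => h.inj a b (by omega) (by omega)] at hmS
    omega
  · push Not at hp
    have hrp : ∀ t, 1 ≤ t → t ≤ l → ¬ G.Adj (r t) p := by
      intro t h1 h2
      by_cases h3 : t = 1
      · rw [h3]; exact hfirst
      by_cases h4 : t = l
      · rw [h4]; exact hlast
      exact hp t (by omega) (by omega)
    have := ctr_fan hG (s := r) (i := l - 1) (z := y)
      (fun a b ha hb => h.inj a b (by omega) (by omega)) (fun a ha => h.ne_y a (by omega))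
      (fun t ht => h.adj t (by omega)) (fun t h1 h2 v hv => by
        rcases h.nbr t h1 (by omega) v hv with rfl | h' | h'
        · exact absurd hv (hrp t h1 (by omega))
        · exact Or.inl h'
        · exact Or.inr h') (by rwa [show l - 1 + 1 = l by omega])
    have h2 := hmid _ this
    rw [ncard_image_Icc fun a b _ ha _ hb => h.inj a b (by omega) (by omega)] at h2
    omega

end Fans

section SingleFans
variable {V : Type*} {G : SimpleGraph V}

/-- An induced path `q 1, …, q k` all of whose vertices are adjacent to the centre `w`, with all
other neighbours on the path extended by `q 0` and `q (k + 1)`, where `w` has at least five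
neighbours off the path. -/
structure SingleFan (G : SimpleGraph V) (k : ℕ) (q : ℕ → V) (w : V) : Prop where
  inj : ∀ i j, i ≤ k + 1 → j ≤ k + 1 → q i = q j → i = j
  ne_w : ∀ i, i ≤ k + 1 → q i ≠ w
  adj : ∀ i, i ≤ k → G.Adj (q i) (q (i + 1))
  nbr : ∀ i, 1 ≤ i → i ≤ k → ∀ v, G.Adj (q i) v → v = w ∨ v = q (i - 1) ∨ v = q (i + 1)
  adj_w : ∀ i, 1 ≤ i → i ≤ k → G.Adj (q i) w
  five_le : 5 ≤ {x | G.Adj w x ∧ ∀ i, 1 ≤ i → i ≤ k → x ≠ q i}.ncard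

namespace SingleFan
variable {k : ℕ} {q : ℕ → V} {w : V}

theorem exists_nbr [Finite V] (f : SingleFan G k q w) {C : Set V} (hC : C.ncard ≤ 1) (y : V) :
    ∃ x, G.Adj w x ∧ x ∉ q '' Set.Icc 0 k ∪ C ∧ x ≠ y := by
  have hcard : (insert y (insert (q 0) C)).ncard < {x | G.Adj w x ∧ ∀ i, 1 ≤ i → i ≤ k →
      x ≠ q i}.ncard := by
    have h1 := Set.ncard_insert_le y (insert (q 0) C)
    have h2 := Set.ncard_insert_le (q 0) C
    have := f.five_le
    omega
  obtain ⟨x, ⟨hx1, hx2⟩, hx⟩ := Set.exists_mem_notMem_of_ncard_lt_ncard hcard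
  refine ⟨x, hx1, ?_, fun h => hx (Or.inl h)⟩
  rintro (⟨i, ⟨-, hi⟩, rfl⟩ | h)
  · by_cases h0 : i = 0
    · subst h0; exact hx (Or.inr (Or.inl rfl))
    · exact hx2 i (by omega) hi rfl
  · exact hx (Or.inr (Or.inr h))

theorem nbr_off [Finite V] (f : SingleFan G k q w) {C : Set V} {i : ℕ} (h1 : 1 ≤ i) (h2 : i ≤ k)
    {v : V} (h : G.Adj (q i) v) (hvw : v ≠ w) (hv : v ∉ q '' Set.Icc 0 k ∪ C) :
    v = q (k + 1) := by
  rcases f.nbr i h1 h2 v h with h' | h' | h'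
  · exact absurd h' hvw
  · exact absurd (Or.inl ⟨i - 1, ⟨by omega, by omega⟩, h'.symm⟩) hv
  · by_cases hik : i = k
    · rw [h', hik]
    · exact absurd (Or.inl ⟨i + 1, ⟨by omega, by omega⟩, h'.symm⟩) hv

theorem exists_cover [Finite V] (hG : TriConn G) (f : SingleFan G k q w) (hk : 2 ≤ k) {C : Set V}
    (hC : C.ncard ≤ 1) (hCw : w ∉ C) (hCq : ∀ i, i ≤ k + 1 → q i ∉ C)
    (hA : Ctr G (q '' Set.Icc 0 (k - 1) ∪ C)) :
    ∃ T, CtrCover G (q '' Set.Icc 0 (k - 1) ∪ C) T ∧ w ∉ T ∧ q k ∉ T ∧ q (k + 1) ∉ T := by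
  set A := q '' Set.Icc 0 (k - 1) ∪ C with hAdef
  let G₁ : Set V := Aᶜ \ {q k}
  have hG₁ : Pre G G₁ := hA.2.2.2 (q k)
  have hqA : ∀ i, k ≤ i → i ≤ k + 1 → q i ∉ A := by
    rintro i hi1 hi2 (⟨j, ⟨-, hj⟩, h⟩ | h)
    · have := f.inj j i (by omega) hi2 h
      omega
    · exact hCq i hi2 h
  have hwA : w ∉ A := by
    rintro (⟨j, ⟨-, hj⟩, h⟩ | h)
    · exact f.ne_w j (by omega) h
    · exact hCw h
  have hw₁ : w ∈ G₁ := ⟨hwA, fun h => f.ne_w k (by omega) h.symm⟩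
  have hl₁ : q (k + 1) ∈ G₁ := ⟨hqA _ (by omega) le_rfl, fun h => by
    have := f.inj _ _ le_rfl (by omega) h
    omega⟩
  have hlw : q (k + 1) ≠ w := f.ne_w _ le_rfl
  let U₀ : Set V := q '' Set.Icc 0 k ∪ C
  have hU₀ : ∀ x, x ∈ U₀ ↔ x ∉ G₁ := by
    intro x
    constructor
    · rintro (⟨i, ⟨-, hi⟩, rfl⟩ | h) hx
      · by_cases hik : i = k
        · exact hx.2 (by rw [hik]; rfl)
        · exact hx.1 (Or.inl ⟨i, ⟨by omega, by omega⟩, rfl⟩)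
      · exact hx.1 (Or.inr h)
    · intro hx
      by_cases hxk : x = q k
      · exact Or.inl ⟨k, ⟨by omega, le_rfl⟩, hxk.symm⟩
      · have : x ∈ A := by
          by_contra h
          exact hx ⟨h, hxk⟩
        rcases this with ⟨i, ⟨-, hi⟩, rfl⟩ | h
        · exact Or.inl ⟨i, ⟨by omega, by omega⟩, rfl⟩
        · exact Or.inr h
  let Q : V → Set V → Prop := fun y L => (y ∈ G₁ ∧ y ≠ q (k + 1) ∧ y ≠ w ∧
    ∃ a, (a = q 0 ∨ a ∈ C) ∧ G.Adj a y) ∧ L ⊆ G₁ \ {y} ∧ Pre G L ∧ q (k + 1) ∈ L ∧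
    ∀ a ∈ L, ∀ b ∈ G₁ \ {y}, G.Adj a b → b ∈ L
  have hQex : ∀ y, (y ∈ G₁ ∧ y ≠ q (k + 1) ∧ y ≠ w ∧ ∃ a, (a = q 0 ∨ a ∈ C) ∧ G.Adj a y) →
      ∃ L, Q y L := by
    intro y hy
    obtain ⟨L, h1, h2, h3, h4⟩ := exists_component (X := G₁ \ {y}) (pre_singleton (G := G)
      (q (k + 1))) (Set.singleton_nonempty _) (Set.singleton_subset_iff.2 ⟨hl₁, fun h => hy.2.1 h.symm⟩)
    exact ⟨L, hy, h2, h3, h1 rfl, h4⟩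
  by_cases hgood : ∃ y L, Q y L ∧ w ∈ L
  · obtain ⟨y, L, ⟨⟨hy₁, hyl, hyw, a, ha, hay⟩, hL, hLpre, hlL, hLcl⟩, hwL⟩ := hgood
    obtain ⟨Y, hlY, hYL, hY, hYcl⟩ := exists_component (X := L \ {w}) (pre_singleton (G := G)
      (q (k + 1))) (Set.singleton_nonempty _) (Set.singleton_subset_iff.2 ⟨hlL, hlw⟩)
    have hYw : ∃ y ∈ Y, G.Adj y w := by
      obtain ⟨b, hb, c, hc, hcY, hbc⟩ := hLpre.exists_adj (fun x hx => (hYL hx).1) ⟨_, hlY rfl⟩ hwL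
        (fun h => (hYL h).2 rfl)
      by_cases hcw : c = w
      · exact ⟨b, hb, hcw ▸ hbc⟩
      · exact absurd (hYcl b hb c ⟨hc, hcw⟩ hbc) hcY
    have haA : a ∈ A := by
      rcases ha with rfl | ha
      · exact Or.inl ⟨0, ⟨le_rfl, by omega⟩, rfl⟩
      · exact Or.inr ha
    obtain ⟨T, hST, hT, hTH, z, hzY, hzT⟩ := exists_ctr_of_ear hG
      (tc_pair (f.adj_w k (by omega) le_rfl).symm) hY (by
        rintro x hx (h | h)
        · exact (hYL hx).2 h
        · exact (hL (hYL hx).1).1.2 h) (Or.inl rfl) (Or.inr rfl) (f.ne_w k (by omega)).symm hYw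
        ⟨_, hlY rfl, (f.adj k le_rfl).symm⟩
      (pre_insert hA.2.1 haA hay.symm) ⟨y, Or.inl rfl⟩ (by
        rintro x (rfl | hx) (h | h)
        · exact hyw h
        · exact hy₁.2 h
        · exact hwA (h ▸ hx)
        · exact hqA k le_rfl (by omega) (h ▸ hx)) (by
        rintro x (rfl | hx) h
        · exact (hL (hYL h).1).2 rfl
        · exact (hL (hYL h).1).1.1 hx)
    have hwT : w ∉ T := fun h => hTH w h (Or.inl rfl)
    have hkT : q k ∉ T := fun h => hTH _ h (Or.inr rfl)
    have hlT : q (k + 1) ∉ T := by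
      have hk1 : q (k - 1) ∈ T := hST (Or.inr (Or.inl ⟨k - 1, ⟨by omega, le_rfl⟩, rfl⟩))
      obtain ⟨h, hh, h', hh', -, -, hne, ⟨c, hc, hch⟩, ⟨c', hc', hch'⟩⟩ :=
        hT.2.2.exists_two_attachments (D := {q k}) (Set.singleton_subset_iff.2 hkT)
          (Set.singleton_nonempty _) hwT hzT (fun h => f.ne_w k (by omega) h.symm)
          (fun h => (hL (hYL hzY).1).1.2 h) (fun h => (hYL hzY).2 h.symm)
      rw [Set.mem_singleton_iff] at hc hc'
      subst hc hc'
      rcases f.nbr k (by omega) le_rfl h hch with h1 | h1 | h1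
      · rcases f.nbr k (by omega) le_rfl h' hch' with h2 | h2 | h2
        · exact absurd (h1.trans h2.symm) hne
        · exact absurd (h2 ▸ hk1) hh'
        · exact h2 ▸ hh'
      · exact absurd (h1 ▸ hk1) hh
      · exact h1 ▸ hh
    obtain ⟨T', hT'T, hT'⟩ := exists_ctrCover hA hT (fun x hx => hST (Or.inr hx))
      (fun h => hy₁.1 (by rw [h]; exact hST (Or.inl rfl)))
    exact ⟨T', hT', fun h => hwT (hT'T h), fun h => hkT (hT'T h), fun h => hlT (hT'T h)⟩
  exfalso
  by_cases hN : ∃ y L, Q y L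
  · obtain ⟨L, ⟨y, hyL⟩, hmax⟩ := Set.Finite.exists_maximal (s := {L | ∃ y, Q y L})
      (Set.toFinite _) (by obtain ⟨y, L, h⟩ := hN; exact ⟨L, y, h⟩)
    have hwL : w ∉ L := fun h => hgood ⟨y, L, hyL, h⟩
    obtain ⟨⟨hy₁, hyl, hyw, a, ha, hay⟩, hL, hLpre, hlL, hLcl⟩ := hyL
    obtain ⟨x, hwx, hxU, hxy⟩ := f.exists_nbr hC y
    have hx₁ : x ∈ G₁ := by
      by_contra h
      exact hxU ((hU₀ x).2 h)
    have hxL : x ∉ L := fun h => hwL (hLcl x h w ⟨hw₁, hyw.symm⟩ hwx.symm)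
    have hnU : ∀ v, v ∈ G₁ → v ∉ L → v ∉ L ∪ U₀ := by
      rintro v h1 h2 (h3 | h3)
      · exact h2 h3
      · exact (hU₀ v).1 h3 h1
    obtain ⟨u, hu, v, huv, hvU, hvy, hvw⟩ := hG.exists_third (U := L ∪ U₀) ⟨_, Or.inl hlL⟩
      (hnU y hy₁ fun h => (hL h).2 rfl) (hnU w hw₁ hwL) (hnU x hx₁ hxL) hxy hwx.ne.symm
    have hv₁ : v ∈ G₁ := by
      by_contra h
      exact hvU (Or.inr ((hU₀ v).2 h))
    have hvL : v ∉ L := fun h => hvU (Or.inl h)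
    have hvl : v ≠ q (k + 1) := fun h => hvL (h ▸ hlL)
    by_cases huL : u ∈ L
    · exact hvL (hLcl u huL v ⟨hv₁, hvy⟩ huv)
    have hu0 : u = q 0 ∨ u ∈ C := by
      rcases hu with hu | ⟨i, ⟨-, hi⟩, rfl⟩ | hu
      · exact absurd hu huL
      · by_cases hi0 : i = 0
        · left; rw [hi0]
        · exact absurd (f.nbr_off (by omega) hi huv hvw (fun h => hvU (Or.inr h))) hvl
      · exact Or.inr hu
    obtain ⟨L', h1, h2, h3, h4⟩ := exists_component (X := G₁ \ {v}) hLpre ⟨_, hlL⟩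
      (fun b hb => ⟨(hL hb).1, fun h => hvL (h ▸ hb)⟩)
    have hL'L : L' ⊆ L := hmax (y := L') ⟨v, ⟨hv₁, hvl, hvw, u, hu0, huv⟩, h2, h3, h1 hlL, h4⟩ h1
    obtain ⟨b, hb, c, hc, hcL, hbc⟩ := hG₁.exists_adj (fun b hb => (hL hb).1) ⟨_, hlL⟩ hy₁
      (fun h => (hL h).2 rfl)
    have hcy : c = y := by
      by_contra h
      exact hcL (hLcl b hb c ⟨hc, h⟩ hbc)
    exact hcL (hL'L (h4 b (h1 hb) c ⟨hc, fun h => hvy (h.symm.trans hcy)⟩ hbc))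
  · obtain ⟨x, hwx, hxU, hxl⟩ := f.exists_nbr hC (q (k + 1))
    obtain ⟨u, hu, v, huv, hvU, hvw, hvl⟩ := hG.exists_third (U := U₀)
      ⟨q 0, Or.inl ⟨0, ⟨le_rfl, by omega⟩, rfl⟩⟩ (fun h => (hU₀ _).1 h hw₁)
      (fun h => (hU₀ _).1 h hl₁) hxU hwx.ne.symm hxl
    have hv₁ : v ∈ G₁ := by
      by_contra h
      exact hvU ((hU₀ v).2 h)
    have hu0 : u = q 0 ∨ u ∈ C := by
      rcases hu with ⟨i, ⟨-, hi⟩, rfl⟩ | hu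
      · by_cases hi0 : i = 0
        · left; rw [hi0]
        · exact absurd (f.nbr_off (by omega) hi huv hvw hvU) hvl
      · exact Or.inr hu
    obtain ⟨L, hL⟩ := hQex v ⟨hv₁, hvl, hvw, u, hu0, huv⟩
    exact hN ⟨v, L, hL⟩

theorem release [Finite V] (f : SingleFan G k q w) {C : Set V} (hCw : w ∉ C)
    (hCq : ∀ i, i ≤ k + 1 → q i ∉ C) (hA : Ctr G (q '' Set.Icc 0 (k - 1) ∪ C)) {j : ℕ}
    (hj : j + 1 ≤ k) : Ctr G (q '' Set.Icc 0 j ∪ C) := by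
  have h0 : q 0 ∈ q '' Set.Icc 0 j ∪ C := Or.inl ⟨0, ⟨le_rfl, by omega⟩, rfl⟩
  refine ⟨⟨_, h0⟩, ?_, ?_⟩
  · refine pre_of_closed_mem (q 0) fun X hX hne hcl => ?_
    by_contra h0X
    have hno : ∀ i, i ≤ j → q i ∉ X := by
      intro i
      induction i with
      | zero => exact fun _ => h0X
      | succ i ih =>
        intro hi h
        exact ih (by omega) (hcl _ h _ (Or.inl ⟨i, ⟨by omega, by omega⟩, rfl⟩)
          (f.adj i (by omega)).symm)
    have hXC : X ⊆ C := by
      intro x hx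
      rcases hX hx with ⟨i, ⟨-, hi⟩, rfl⟩ | h
      · exact absurd hx (hno i hi)
      · exact h
    refine h0X (hA.2.1 X (fun x hx => Or.inr (hXC hx)) hne ?_ (Or.inl ⟨0, ⟨le_rfl, by omega⟩, rfl⟩))
    rintro a ha b (⟨i, ⟨-, hi⟩, rfl⟩ | hb) hab
    · by_cases hij : i ≤ j
      · exact hcl a ha _ (Or.inl ⟨i, ⟨by omega, hij⟩, rfl⟩) hab
      · rcases f.nbr i (by omega) (by omega) a hab.symm with h | h | h
        · exact absurd (hXC ha) (h ▸ hCw)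
        · exact absurd (hXC ha) (h ▸ hCq _ (by omega))
        · exact absurd (hXC ha) (h ▸ hCq _ (by omega))
    · exact hcl a ha b (Or.inr hb) hab
  · by_cases hjk : j = k - 1
    · rw [hjk]; exact hA.2.2
    let s : ℕ → V := fun t => if t = 0 then w else q (j + t)
    have hk1 : j + (k - 1 - j + 1) = k := by omega
    have hT := tc_union_path hA.2.2 (r := k - 1 - j) (q := s) (by
        rintro (⟨i, ⟨-, hi⟩, h⟩ | h)
        · exact f.ne_w i (by omega) h
        · exact hCw h) (by
        simp only [s, hk1, if_false, Nat.succ_ne_zero]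
        rintro (⟨i, ⟨-, hi⟩, h⟩ | h)
        · have := f.inj i k (by omega) (by omega) h
          omega
        · exact hCq k (by omega) h) (by
        intro a b ha hb hab
        simp only [s] at hab
        split_ifs at hab
        · omega
        · exact absurd hab.symm (f.ne_w _ (by omega))
        · exact absurd hab (f.ne_w _ (by omega))
        · have := f.inj _ _ (by omega) (by omega) hab
          omega) (by
        intro a ha
        rcases a with _ | a
        · simpa [s] using (f.adj_w (j + 1) (by omega) (by omega)).symm
        · have := f.adj (j + (a + 1)) (by omega)
          simpa [s, add_assoc] using this)
    have heq : (q '' Set.Icc 0 j ∪ C)ᶜ = (q '' Set.Icc 0 (k - 1) ∪ C)ᶜ ∪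
        s '' Set.Icc 1 (k - 1 - j) := by
      ext x
      constructor
      · intro hx
        by_contra hcon
        rw [Set.mem_union, not_or] at hcon
        rcases not_not.1 hcon.1 with ⟨i, ⟨-, hi⟩, rfl⟩ | h
        · by_cases hij : i ≤ j
          · exact hx (Or.inl ⟨i, ⟨by omega, hij⟩, rfl⟩)
          · refine hcon.2 ⟨i - j, ⟨by omega, by omega⟩, ?_⟩
            have h1 : i - j ≠ 0 := by omega
            simp only [s, h1, if_false]
            congr 1; omega
        · exact hx (Or.inr h)
      · rintro (hx | ⟨t, ⟨ht1, ht2⟩, rfl⟩) hx'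
        · refine hx ?_
          rcases hx' with ⟨i, ⟨-, hi⟩, rfl⟩ | h
          · exact Or.inl ⟨i, ⟨by omega, by omega⟩, rfl⟩
          · exact Or.inr h
        · have h1 : t ≠ 0 := by omega
          simp only [s, h1, if_false] at hx'
          rcases hx' with ⟨i, ⟨-, hi⟩, h⟩ | h
          · have := f.inj _ _ (by omega) (by omega) h
            omega
          · exact hCq _ (by omega) h
    rw [heq]
    exact hT

theorem ncard_release [Finite V] (f : SingleFan G k q w) {C : Set V}
    (hCq : ∀ i, i ≤ k + 1 → q i ∉ C) {j : ℕ} (hj : j + 1 ≤ k) :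
    (q '' Set.Icc 0 j ∪ C).ncard = j + 1 + C.ncard := by
  rw [Set.ncard_union_eq, ncard_image_Icc fun a b _ ha _ hb => f.inj a b (by omega) (by omega)]
  · omega
  · rw [Set.disjoint_left]
    rintro _ ⟨i, ⟨-, hi⟩, rfl⟩
    exact hCq i (by omega)

theorem ncard_lt_or [Finite V] {m : ℕ} (hm : 5 ≤ m) (hmid : NoMid G m)
    (f : SingleFan G (m - 2) q w) {C : Set V} (hCw : w ∉ C)
    (hCq : ∀ i, i ≤ m - 2 + 1 → q i ∉ C) (hA : Ctr G (q '' Set.Icc 0 (m - 2 - 1) ∪ C)) :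
    C.ncard < 2 ∨ 2 * m - 5 < C.ncard := by
  by_contra hcon
  push Not at hcon
  have h1 := hmid _ (f.release hCw hCq hA (j := m - 1 - C.ncard) (by omega))
  rw [f.ncard_release hCq (by omega)] at h1
  omega

set_option maxHeartbeats 1000000 in
theorem false [Finite V] (hG : TriConn G) {m : ℕ} (hm : 5 ≤ m) (hmid : NoMid G m)
    (f : SingleFan G (m - 2) q w) : False := by
  have hK : Ctr G (q '' Set.Icc 0 (m - 2 - 1) ∪ ∅) := by
    rw [Set.union_empty]
    refine ctr_fan hG (z := w) (fun a b ha hb => f.inj a b (by omega) (by omega))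
      (fun a ha => f.ne_w a (by omega)) (fun t ht => f.adj t (by omega))
      (fun t h1 h2 => f.nbr t h1 (by omega)) ?_
    exact f.adj_w _ (by omega) (by omega)
  obtain ⟨T, hT, hwT, hkT, hlT⟩ := f.exists_cover hG (by omega) (by simp) (by simp) (by simp) hK
  rw [Set.union_empty] at hT
  set K := q '' Set.Icc 0 (m - 2 - 1) with hKdef
  have hKq : ∀ v ∈ K, ∃ i, i ≤ m - 3 ∧ v = q i := by
    rintro v ⟨i, ⟨-, hi⟩, rfl⟩
    exact ⟨i, by omega, rfl⟩
  have hqT : ∀ i, i ≤ m - 2 + 1 → q i ∉ T \ K := by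
    intro i hi h
    by_cases h1 : i ≤ m - 3
    · exact h.2 ⟨i, ⟨by omega, by omega⟩, rfl⟩
    by_cases h2 : i = m - 2
    · exact hkT (h2 ▸ h.1)
    · have : i = m - 2 + 1 := by omega
      exact hlT (this ▸ h.1)
  have hwTK : w ∉ T \ K := fun h => hwT h.1
  have hTeq : K ∪ T \ K = T := Set.union_sdiff_cancel hT.subset
  have hcard := f.ncard_lt_or hm hmid hwTK hqT (by rw [← hKdef, hTeq]; exact hT.upper)
  obtain ⟨l, r, hr, hr0, hrl⟩ := hT.exists_chain hG
  -- vertices outside the fan see `K` only in `q 0`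
  have hadjK : ∀ v, v ∉ K → v ≠ w → v ≠ q (m - 2) → ∀ x ∈ K, G.Adj v x → x = q 0 := by
    intro v hv1 hv2 hv3 x hx hvx
    obtain ⟨i, hi, rfl⟩ := hKq x hx
    by_contra h0
    have hi0 : i ≠ 0 := fun h => h0 (by rw [h])
    rcases f.nbr i (by omega) (by omega) v hvx.symm with h | h | h
    · exact hv2 h
    · exact hv1 ⟨i - 1, ⟨by omega, by omega⟩, h.symm⟩
    · by_cases h4 : i + 1 = m - 2
      · exact hv3 (h4 ▸ h)
      · exact hv1 ⟨i + 1, ⟨by omega, by omega⟩, h.symm⟩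
  have hrz : ∀ z ∈ T \ K, ∀ x ∈ K, G.Adj z x → x = q 0 := fun z hz => hadjK z hz.2
    (fun h => hwT (h ▸ hz.1)) (fun h => hkT (h ▸ hz.1))
  have h0K : q 0 ∈ K := ⟨0, ⟨le_rfl, by omega⟩, rfl⟩
  rw [hr.ncard_eq] at hcard
  have hl1 : l = 1 := by
    by_contra hl1
    have hpos := hr.pos
    have hadj0 : ∀ i, 1 ≤ i → i ≤ l → G.Adj (r i) (q 0) := by
      intro i h1 h2
      obtain ⟨x, hx, hix⟩ := hr.adjK i h1 h2
      rwa [hrz _ (hr.mem h1 h2) x hx hix] at hix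
    have := ctr_fan hG (s := r) (i := m - 1) (z := q 0)
      (fun a b ha hb => hr.inj a b (by omega) (by omega))
      (fun a ha h => hr.notMem a (by omega) (h ▸ h0K)) (fun t ht => hr.adj t (by omega))
      (fun t h1 h2 v hv => by
        rcases hr.nbr (by omega) t h1 (by omega) v hv with h | h
        · exact Or.inl (hrz _ (hr.mem h1 (by omega)) v h hv)
        · exact Or.inr h) (hadj0 _ (by omega) (by omega))
    have h2 := hmid _ this
    rw [ncard_image_Icc fun a b _ ha _ hb => hr.inj a b (by omega) (by omega)] at h2
    omega
  subst hl1
  obtain ⟨y, hy⟩ : ∃ y, y = r 1 := ⟨_, rfl⟩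
  have hTy : T \ K = {y} := by
    rw [hr.eq, hy]; simp
  have hyTK : y ∈ T \ K := by rw [hTy]; rfl
  have hKy : K ∪ {y} = T := by rw [← hTy]; exact hTeq
  have hyq0 : G.Adj (q 0) y := by
    obtain ⟨x, hx, hix⟩ := hr.adjK 1 le_rfl le_rfl
    rw [← hy] at hix
    rw [hrz y hyTK x hx hix] at hix
    exact hix.symm
  obtain ⟨T', hT', hwT', hkT', hlT'⟩ := f.exists_cover hG (by omega) (C := {y}) (by simp)
    (fun h => hwTK (by rw [hTy]; exact h)) (fun i hi h => hqT i hi (by rw [hTy]; exact h))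
    (by rw [← hKdef, hKy]; exact hT.upper)
  rw [← hKdef, hKy] at hT'
  obtain ⟨l, s, hs, hs0, hsl⟩ := hT'.exists_chain hG
  have hKT' : K ⊆ T' := hT.subset.trans hT'.subset
  have hCeq : T' \ K = insert y (T' \ T) := by
    ext x
    constructor
    · rintro ⟨h1, h2⟩
      by_cases hx : x ∈ T
      · left
        have : x ∈ T \ K := ⟨hx, h2⟩
        rw [hTy] at this; exact this
      · exact Or.inr ⟨h1, hx⟩
    · rintro (rfl | h)
      · exact ⟨hT'.subset hyTK.1, hyTK.2⟩
      · exact ⟨h.1, fun h' => h.2 (hT.subset h')⟩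
  have hqT' : ∀ i, i ≤ m - 2 + 1 → q i ∉ T' \ K := by
    intro i hi h
    by_cases h1 : i ≤ m - 3
    · exact h.2 ⟨i, ⟨by omega, by omega⟩, rfl⟩
    by_cases h2 : i = m - 2
    · exact hkT' (h2 ▸ h.1)
    · have : i = m - 2 + 1 := by omega
      exact hlT' (this ▸ h.1)
  have hwT'K : w ∉ T' \ K := fun h => hwT' h.1
  have hTeq' : K ∪ T' \ K = T' := Set.union_sdiff_cancel hKT'
  have hA' : Ctr G (q '' Set.Icc 0 (m - 2 - 1) ∪ T' \ K) := by
    rw [← hKdef, hTeq']; exact hT'.upper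
  have hcard' := f.ncard_lt_or hm hmid hwT'K hqT' hA'
  rw [hCeq, Set.ncard_insert_of_notMem (fun h => h.2 hyTK.1), hs.ncard_eq] at hcard'
  have hl1 := hs.pos
  have hl : m ≤ l := by omega
  have hrel0 := (f.release hwT'K hqT' hA' (j := 0) (by omega)).2.2
  have hrel1 := (f.release hwT'K hqT' hA' (j := 1) (by omega)).2.2
  have hsK : ∀ i, i ≤ l + 1 → s i ∉ K := fun i hi h => hs.notMem i hi (hT.subset h)
  have h1K : q 1 ∈ K := ⟨1, ⟨by omega, by omega⟩, rfl⟩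
  have hsx : ∀ i, 1 ≤ i → i ≤ l → ∀ v ∈ T, G.Adj (s i) v → v = q 0 ∨ v = y := by
    intro i h1 h2 v hv hiv
    by_cases hvK : v ∈ K
    · have hsi := hs.mem h1 h2
      exact Or.inl (hadjK _ (hsK i (by omega)) (fun h => hwT' (h ▸ hsi.1))
        (fun h => hkT' (h ▸ hsi.1)) v hvK hiv)
    · right
      have : v ∈ T \ K := ⟨hv, hvK⟩
      rw [hTy] at this; exact this
  have hset0 : q '' Set.Icc 0 0 ∪ T' \ K = {q 0, y} ∪ s '' Set.Icc 1 l := by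
    rw [hCeq, hs.eq, Set.Icc_self, Set.image_singleton]
    ext x; simp only [Set.mem_union, Set.mem_insert_iff, Set.mem_singleton_iff]; tauto
  have hset1 : q '' Set.Icc 0 1 ∪ T' \ K = insert (q 1) ({q 0, y} ∪ s '' Set.Icc 1 l) := by
    have : Set.Icc 0 1 = ({0, 1} : Set ℕ) := by
      ext i; simp only [Set.mem_Icc, Set.mem_insert_iff, Set.mem_singleton_iff]; omega
    rw [hCeq, hs.eq, this, Set.image_pair]
    ext x; simp only [Set.mem_union, Set.mem_insert_iff, Set.mem_singleton_iff]; tauto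
  exact DoubleFan.false hG hm hmid hl (r := s) (p := q 0) (y := y) (d := q 1)
    { inj := hs.inj
      ne_p := fun i hi h => hsK i hi (h ▸ h0K)
      ne_y := fun i hi h => hs.notMem i hi (h ▸ hyTK.1)
      ne_d := fun i hi h => hsK i hi (h ▸ h1K)
      adj := hs.adj
      nbr := fun i h1 h2 v hv => by
        rcases hs.nbr (by omega) i h1 h2 v hv with h | h
        · rcases hsx i h1 h2 v h hv with h | h
          · exact Or.inl h
          · exact Or.inr (Or.inl h)
        · exact Or.inr (Or.inr h)
      adj_or := fun i h1 h2 => by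
        obtain ⟨x, hx, hix⟩ := hs.adjK i h1 h2
        rcases hsx i h1 h2 x hx hix with h | h
        · left; rwa [h] at hix
        · right; rwa [h] at hix
      adj_py := hyq0
      adj_pd := f.adj 0 (by omega)
      ne_dy := fun h => hyTK.2 (h ▸ h1K)
      tc := by rw [← hset0]; exact hrel0
      tc' := by rw [← hset1]; exact hrel1 }

end SingleFan

end SingleFans

section Minimal
variable {V : Type*} {G : SimpleGraph V}

theorem TC.insert [Finite V] {H : Set V} (hH : TC G H) {k h h' : V} (hh : h ∈ H)
    (hh' : h' ∈ H) (hne : h ≠ h') (hkh : G.Adj k h) (hkh' : G.Adj k h') :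
    TC G (insert k H) := by
  have := tc_union_path hH (r := 1) (q := fun i => if i = 0 then h else if i = 1 then k else h')
    (by simpa using hh) (by simpa using hh') (by
      have h1 : k ≠ h := hkh.ne
      have h2 : k ≠ h' := hkh'.ne
      intro i j hi hj hij
      split_ifs at hij
      · omega
      · exact absurd hij.symm h1
      · exact absurd hij hne
      · exact absurd hij h1
      · omega
      · exact absurd hij h2
      · exact absurd hij.symm hne
      · exact absurd hij.symm h2
      · omega) (by
      intro i hi
      have : i = 0 ∨ i = 1 := by omega
      rcases this with rfl | rfl
      · simpa using hkh.symm
      · simpa using hkh')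
  rw [Set.Icc_self, Set.image_singleton] at this
  simpa [Set.union_singleton] using this

theorem TC.exists_two_nbrs [Finite V] {B : Set V} (hB : TC G B) (h3 : 3 ≤ B.ncard) {v : V}
    (hv : v ∈ B) : ∃ h ∈ B, ∃ h' ∈ B, h ≠ h' ∧ G.Adj v h ∧ G.Adj v h' := by
  have h2 : 1 < (B \ {v}).ncard := by
    have := Set.ncard_sdiff_singleton_add_one hv
    omega
  obtain ⟨x₁, x₂, h₁, h₂, hne⟩ := (Set.one_lt_ncard_iff).1 h2
  obtain ⟨h, hh, h', hh', -, -, h1, ⟨y, rfl, h4⟩, ⟨y', rfl, h5⟩⟩ := hB.exists_two_attachments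
    (D := {v}) (Set.singleton_subset_iff.2 hv) (Set.singleton_nonempty _) h₁.1 h₂.1 h₁.2 h₂.2 hne
  exact ⟨h, hh, h', hh', h1, h4, h5⟩

/-- If `W` is an inclusion-minimal large contractible set, `W \ K` is connected and large, and
`k ∈ K` has two neighbours outside `W`, then `insert k (W \ K)` is contractible. -/
theorem ctr_insert_of_two_attachments [Finite V] (hG : TriConn G) {m : ℕ} {W K : Set V} {k h h' : V}
    (hW : Ctr G W) (hmin : ∀ X, Ctr G X → X ⊆ W → X ≠ W → X.ncard < m) (hWm : m < W.ncard)
    (hKW : K ⊆ W) (hP : Pre G (W \ K)) (hne : (W \ K).Nonempty) (hPm : m - 2 ≤ (W \ K).ncard)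
    (hk : k ∈ K) (hh : h ∉ W) (hh' : h' ∉ W) (hhh : h ≠ h') (hkh : G.Adj k h) (hkh' : G.Adj k h') :
    Ctr G (insert k (W \ K)) ∧ (W \ K).ncard = m - 2 ∧
      ∀ p ∈ W \ K, ∀ x ∈ K, G.Adj p x → x = k := by
  have hB : TC G (insert k Wᶜ) := hW.2.2.insert hh hh' hhh hkh hkh'
  obtain ⟨D, hPD, hDB, hD, hDcl⟩ := exists_ctr_superset hG hB hP hne (by
    rintro s hs (rfl | h)
    · exact hs.2 hk
    · exact h hs.1)
  have hDW : D ⊆ W := fun x hx => by_contra fun h => hDB x hx (Or.inr h)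
  have hkD : k ∉ D := fun h => hDB k h (Or.inl rfl)
  have hDm := hmin D hD hDW (fun h => hkD (h ▸ hKW hk))
  have hB' : ∀ x ∈ W, x ≠ k → x ∉ insert k Wᶜ := by
    rintro x hx hxk (h | h)
    · exact hxk h
    · exact h hx
  obtain ⟨x, hxW, hx⟩ := Set.exists_mem_notMem_of_ncard_lt_ncard (s := insert k D) (t := W) (by
    have := Set.ncard_insert_le k D
    omega)
  have hxk : x ≠ k := fun h => hx (Or.inl h)
  have hxD : x ∉ D := fun h => hx (Or.inr h)
  obtain ⟨D', hxD', hD'X, hD', hD'cl⟩ := exists_component (X := {v | v ∈ W ∧ v ≠ k ∧ v ∉ D})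
    (pre_singleton (G := G) x) (Set.singleton_nonempty _)
    (Set.singleton_subset_iff.2 ⟨hxW, hxk, hxD⟩)
  have hxD' : x ∈ D' := hxD' rfl
  have hout : ∀ u ∈ D', ∀ w, G.Adj u w → w ∉ D' → w ≠ k → w ∉ W := by
    intro u hu w huw hw hwk hwW
    refine hw (hD'cl u hu w ⟨hwW, hwk, fun hwD => ?_⟩ huw)
    obtain ⟨h1, h2, h3⟩ := hD'X hu
    exact h3 (hDcl w hwD u (hB' u h1 h2) huw.symm)
  have hkD' : k ∉ D' := fun h => (hD'X h).2.1 rfl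
  have hD'W : ∀ y ∈ D', y ∉ Wᶜ := fun y hy h => h (hD'X hy).1
  have hhk : h ≠ k := fun e => hh (e ▸ hKW hk)
  have hhk' : h' ≠ k := fun e => hh' (e ▸ hKW hk)
  obtain ⟨u, hu, w, huw, hwD', hwk, -⟩ := hG.exists_third ⟨x, hxD'⟩ hkD' hkD'
    (fun h1 => hD'W h h1 hh) hhk hhk
  have hwW := hout u hu w huw hwD' hwk
  obtain ⟨g, hgW, hgw⟩ : ∃ g, g ∉ W ∧ g ≠ w := by
    by_cases e : h = w
    · exact ⟨h', hh', fun e' => hhh (e.trans e'.symm)⟩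
    · exact ⟨h, hh, e⟩
  obtain ⟨u', hu', w', huw', hwD'', hwk', hww⟩ := hG.exists_third ⟨x, hxD'⟩ hkD' hwD'
    (fun h1 => hD'W g h1 hgW) (fun e => hgW (e ▸ hKW hk)) hgw
  have hwW' := hout u' hu' w' huw' hwD'' hwk'
  have hS : Pre G (W \ D') := by
    refine pre_of_closed_mem k fun A hA hAne hAcl => ?_
    by_contra hkA
    refine hkA (hW.2.1 A (fun a ha => (hA ha).1) hAne (fun a ha b hb hab => ?_) (hKW hk))
    by_cases hbD : b ∈ D'
    · exfalso
      by_cases haD : a ∈ D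
      · obtain ⟨h1, h2, h3⟩ := hD'X hbD
        exact h3 (hDcl a haD b (hB' b h1 h2) hab)
      · exact (hA ha).2 (hD'cl b hbD a ⟨(hA ha).1, fun e => hkA (e ▸ ha), haD⟩ hab.symm)
    · exact hAcl a ha b ⟨hb, hbD⟩ hab
  obtain ⟨W', hSW', hW', hW'H, y, hyD', hyW'⟩ := exists_ctr_of_ear hG hW.2.2 hD' hD'W hwW hwW'
    hww.symm ⟨u, hu, huw⟩ ⟨u', hu', huw'⟩ hS ⟨k, hKW hk, hkD'⟩ (fun s hs h => h hs.1)
    (fun s hs => hs.2)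
  have hW'W : W' ⊆ W := fun v hv => not_not.1 (hW'H v hv)
  have hW'm := hmin W' hW' hW'W (fun e => hyW' (e ▸ (hD'X hyD').1))
  have hkP : k ∉ W \ K := fun h => h.2 hk
  have hPS : insert k (W \ K) ⊆ W \ D' := by
    rintro v (rfl | hv)
    · exact ⟨hKW hk, hkD'⟩
    · exact ⟨hv.1, fun h => (hD'X h).2.2 (hPD hv)⟩
  have hPW' := hPS.trans hSW'
  have hcard := Set.ncard_insert_of_notMem hkP
  have hle := Set.ncard_le_ncard hPW'
  have heq : insert k (W \ K) = W' := Set.eq_of_subset_of_ncard_le hPW' (by omega)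
  refine ⟨heq ▸ hW', by omega, fun p hp z hz hpz => ?_⟩
  by_contra hzk
  have hzD : z ∈ D := hDcl p (hPD hp) z (hB' z (hKW hz) hzk) hpz
  have : z ∈ W' := hSW' ⟨hKW hz, fun h => (hD'X h).2.2 hzD⟩
  rw [← heq] at this
  rcases this with h | h
  · exact hzk h
  · exact h.2 hz

theorem unique_attachment [Finite V] (hG : TriConn G) {m : ℕ} (hm : 5 ≤ m) (hmid : NoMid G m)
    {W K : Set V} {k h h' : V} (hW : Ctr G W) (hmin : ∀ X, Ctr G X → m ≤ X.ncard → W.ncard ≤ X.ncard)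
    (hWm : m < W.ncard) (hKW : K ⊆ W) (hKm : K.ncard = m - 1) {r : ℕ} {q : ℕ → V}
    (hq : ChainOver G K (W \ K) r q) (hr : m - 2 ≤ r)
    (hk : k ∈ K) (hh : h ∉ W) (hh' : h' ∉ W) (hkh : G.Adj k h) (hkh' : G.Adj k h') : h = h' := by
  by_contra hhh
  have hmin' : ∀ X, Ctr G X → X ⊆ W → X ≠ W → X.ncard < m := by
    intro X hX hXW hne
    by_contra hcon
    exact hne (Set.eq_of_subset_of_ncard_le hXW (hmin X hX (by omega)))
  have hP1 : q 1 ∈ W \ K := hq.mem le_rfl hq.pos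
  obtain ⟨hC, hPc, hPk⟩ := ctr_insert_of_two_attachments hG hW hmin' hWm hKW hq.pre ⟨_, hP1⟩
    (by rw [hq.ncard_eq]; exact hr) hk hh hh' hhh hkh hkh'
  rw [hq.ncard_eq] at hPc
  subst hPc
  have hkP : k ∉ W \ K := fun h => h.2 hk
  have hcard := Set.ncard_insert_of_notMem hkP
  rw [hq.ncard_eq] at hcard
  have hsub : insert k (W \ K) ⊆ W := Set.insert_subset (hKW hk) Set.sdiff_subset
  have hcov : CtrCover G (insert k (W \ K)) W := by
    refine ⟨hC, hW, hsub, fun e => ?_, fun X hX h1 h2 => ?_⟩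
    · rw [e] at hcard; omega
    · by_cases hXW : X = W
      · exact Or.inr hXW
      · have := hmin' X hX h2 hXW
        exact Or.inl (Set.eq_of_subset_of_ncard_le h1 (by omega)).symm
  have hkadj : ∀ v ∈ K, v ≠ k → G.Adj k v := by
    intro v hv hvk
    obtain ⟨z, hz, hzv⟩ := hcov.exists_adj hG (v := v) ⟨hKW hv, by
      rintro (h | h)
      · exact hvk h
      · exact h.2 hv⟩
    rcases hz with rfl | hz
    · exact hzv
    · exact absurd (hPk z hz v hv hzv) hvk
  refine SingleFan.false hG hm hmid (q := q) (w := k)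
    ⟨hq.inj, fun i hi e => hq.notMem i hi (e ▸ hk), hq.adj, fun i h1 h2 v hv => ?_,
      fun i h1 h2 => ?_, ?_⟩
  · rcases hq.nbr (by omega) i h1 h2 v hv with h | h
    · exact Or.inl (hPk _ (hq.mem h1 h2) v h hv)
    · exact Or.inr h
  · obtain ⟨z, hz, hqz⟩ := hq.adjK i h1 h2
    rwa [hPk _ (hq.mem h1 h2) z hz hqz] at hqz
  · have h1 : insert h (insert h' (K \ {k})) ⊆
        {x | G.Adj k x ∧ ∀ i, 1 ≤ i → i ≤ m - 2 → x ≠ q i} := by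
      rintro x (rfl | rfl | hx)
      · exact ⟨hkh, fun i h1 h2 e => hh (e ▸ (hq.mem h1 h2).1)⟩
      · exact ⟨hkh', fun i h1 h2 e => hh' (e ▸ (hq.mem h1 h2).1)⟩
      · exact ⟨hkadj x hx.1 hx.2, fun i h1 h2 e => hq.notMem i (by omega) (e ▸ hx.1)⟩
    have h2 := Set.ncard_le_ncard h1
    have h3 : h' ∉ K \ {k} := fun h => hh' (hKW h.1)
    rw [Set.ncard_insert_of_notMem, Set.ncard_insert_of_notMem h3] at h2
    · have := Set.ncard_sdiff_singleton_add_one hk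
      omega
    · rintro (h | h)
      · exact hhh h
      · exact hh (hKW h.1)

end Minimal

section ExtremalPairs
variable {V : Type*} {G : SimpleGraph V}

/-- A large contractible set `W` of minimum size covering a contractible set `K` of maximum size
among the contractible proper subsets of `W`, with `W \ K` listed as a chain. -/
structure Extremal (G : SimpleGraph V) (m : ℕ) (W K : Set V) (r : ℕ) (q : ℕ → V) : Prop where
  cover : CtrCover G K W
  large : 2 * m - 3 ≤ W.ncard
  min : ∀ X, Ctr G X → m ≤ X.ncard → W.ncard ≤ X.ncard
  small : K.ncard ≤ m - 1
  max : ∀ X, Ctr G X → X ⊆ W → X ≠ W → X.ncard ≤ K.ncard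
  chain : ChainOver G K (W \ K) r q
  first : q 0 ∉ W
  last : q (r + 1) ∉ W

namespace Extremal
variable {m : ℕ} {W K : Set V} {r : ℕ} {q : ℕ → V}

theorem reverse (h : Extremal G m W K r q) : Extremal G m W K r (fun i => q (r + 1 - i)) where
  cover := h.cover
  large := h.large
  min := h.min
  small := h.small
  max := h.max
  chain := h.chain.reverse
  first := by simpa using h.last
  last := by simpa using h.first

theorem ncard_add [Finite V] (h : Extremal G m W K r q) : K.ncard + r = W.ncard := by
  rw [← h.chain.ncard_eq, add_comm]
  exact Set.ncard_sdiff_add_ncard_of_subset h.cover.subset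

theorem le_length [Finite V] (h : Extremal G m W K r q) : m - 2 ≤ r := by
  have := h.ncard_add
  have := h.large
  have := h.small
  omega

theorem min_attach [Finite V] (h : Extremal G m W K r q) (hm : 5 ≤ m) {i : ℕ} (h1 : 1 ≤ i)
    (h2 : i ≤ r) {v : V} (hv : G.Adj (q i) v) : v ∈ K ∨ v = q (i - 1) ∨ v = q (i + 1) :=
  h.chain.nbr (by have := h.le_length; omega) i h1 h2 v hv

/-- A connected subset of `W` avoiding an ear inside `W` lies in a contractible subset of `W` that
is at most as large as `K`. -/
theorem exists_ctr [Finite V] (hG : TriConn G) (e : Extremal G m W K r q) {Y S : Set V}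
    (hY : Pre G Y) (hYW : Y ⊆ W) {h h' : V} (hh : h ∉ W) (hh' : h' ∉ W) (hne : h ≠ h')
    (hy : ∃ y ∈ Y, G.Adj y h) (hy' : ∃ y ∈ Y, G.Adj y h') (hS : Pre G S) (hSne : S.Nonempty)
    (hSW : S ⊆ W) (hSY : ∀ s ∈ S, s ∉ Y) :
    ∃ X, S ⊆ X ∧ Ctr G X ∧ X ⊆ W ∧ X ≠ W ∧ X.ncard ≤ K.ncard := by
  obtain ⟨X, h1, h2, h3, y, hyY, hyX⟩ := exists_ctr_of_ear hG e.cover.upper.2.2 hY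
    (fun y hy h => h (hYW hy)) hh hh' hne hy hy' hS hSne (fun s hs h => h (hSW hs)) hSY
  have hXW : X ⊆ W := fun v hv => not_not.1 (h3 v hv)
  have hXne : X ≠ W := fun e => hyX (e ▸ hYW hyY)
  exact ⟨X, h1, h2, hXW, hXne, e.max X h2 hXW hXne⟩

theorem ncard_le [Finite V] (hG : TriConn G) (e : Extremal G m W K r q) {Y S : Set V}
    (hY : Pre G Y) (hYW : Y ⊆ W) {h h' : V} (hh : h ∉ W) (hh' : h' ∉ W) (hne : h ≠ h')
    (hy : ∃ y ∈ Y, G.Adj y h) (hy' : ∃ y ∈ Y, G.Adj y h') (hS : Pre G S) (hSne : S.Nonempty)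
    (hSW : S ⊆ W) (hSY : ∀ s ∈ S, s ∉ Y) : S.ncard ≤ K.ncard := by
  obtain ⟨X, h1, -, -, -, h2⟩ := e.exists_ctr hG hY hYW hh hh' hne hy hy' hS hSne hSW hSY
  exact (Set.ncard_le_ncard h1).trans h2

/-- A vertex outside `W` other than the two ends of the chain is adjacent to `K`. -/
theorem exists_attachment [Finite V] (hG : TriConn G) (hm : 5 ≤ m)
    (hcard : 2 * m + 1 ≤ Nat.card V) (e : Extremal G m W K r q) :
    ∃ y, y ∉ W ∧ y ≠ q 0 ∧ y ≠ q (r + 1) ∧ ∃ k ∈ K, G.Adj k y := by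
  have hr := e.le_length
  by_cases hx : ∃ x, x ∉ W ∧ x ≠ q 0 ∧ x ≠ q (r + 1)
  · obtain ⟨x, hx1, hx2, hx3⟩ := hx
    obtain ⟨u, hu, w, huw, hw, hw1, hw2⟩ := hG.exists_third ⟨_, e.cover.exists_mem.choose_spec.1⟩
      e.first e.last hx1 hx2 hx3
    refine ⟨w, hw, hw1, hw2, u, ?_, huw⟩
    by_contra huK
    obtain ⟨i, h1, h2, rfl⟩ := e.chain.exists_eq ⟨hu, huK⟩
    rcases e.min_attach hm h1 h2 huw with h | h | h
    · exact hw (e.cover.subset h)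
    · by_cases hi : i = 1
      · exact hw1 (by rw [h, hi])
      · exact hw (h ▸ (e.chain.mem (i := i - 1) (by omega) (by omega)).1)
    · by_cases hi : i = r
      · exact hw2 (by rw [h, hi])
      · exact hw (h ▸ (e.chain.mem (i := i + 1) (by omega) (by omega)).1)
  · exfalso
    push Not at hx
    have hW := e.ncard_add
    have hc := Set.ncard_add_ncard_compl W
    have hH : Wᶜ ⊆ {q 0, q (r + 1)} := by
      intro x hxW
      by_cases h0 : x = q 0
      · exact Or.inl h0
      · exact Or.inr (hx x hxW h0)
    have h2 := Set.ncard_le_ncard hH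
    have h2' : ({q 0, q (r + 1)} : Set V).ncard ≤ 2 := by
      simpa using Set.ncard_insert_le (q 0) {q (r + 1)}
    have hsm := e.small
    have h0l : q 0 ≠ q (r + 1) := fun h => by
      have := e.chain.inj _ _ (by omega) le_rfl h
      omega
    have hadj : G.Adj (q 0) (q (r + 1)) := by
      obtain ⟨a, ha, b, hb, hba, hab⟩ := (e.cover.upper.2.2.pre (c := q 1)
        (fun h => h (e.chain.mem le_rfl e.chain.pos).1)).exists_adj (A := {q 0})
        (Set.singleton_subset_iff.2 e.first) (Set.singleton_nonempty _) e.last h0l.symm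
      rw [Set.mem_singleton_iff] at ha
      subst ha
      rcases hH hb with h | h
      · exact absurd h hba
      · rwa [h] at hab
    have hmem : ∀ i, 1 ≤ i → i ≤ r → q i ∈ W := fun i h1 h2 => (e.chain.mem h1 h2).1
    have hqne : ∀ i j, i ≤ r + 1 → j ≤ r + 1 → i ≠ j → q i ≠ q j :=
      fun i j hi hj hij h => hij (e.chain.inj i j hi hj h)
    have hS0 : q 0 ∉ q '' Set.Icc 3 (r + 1) := by
      rintro ⟨i, ⟨h1, h2⟩, h⟩
      exact hqne i 0 h2 (by omega) (by omega) h
    have hSc : (insert (q 0) (q '' Set.Icc 3 (r + 1))).ncard = r := by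
      rw [Set.ncard_insert_of_notMem hS0, ncard_image_Icc fun a b _ ha _ hb => e.chain.inj a b ha hb]
      omega
    obtain ⟨X, h1, h2, h3, y, hyK, hyX⟩ := exists_ctr_of_ear hG
      (tc_pair (e.chain.adj 1 (by omega))) e.cover.lower.2.1 (by
        rintro y hy (rfl | rfl)
        · exact e.chain.notMem _ (by omega) hy
        · exact e.chain.notMem _ (by omega) hy) (Or.inl rfl) (Or.inr rfl)
      (hqne 1 2 (by omega) (by omega) (by omega))
      (by
        obtain ⟨k, hk, h⟩ := e.chain.adjK 1 le_rfl (by omega)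
        exact ⟨k, hk, h.symm⟩)
      (by
        obtain ⟨k, hk, h⟩ := e.chain.adjK 2 (by omega) (by omega)
        exact ⟨k, hk, h.symm⟩)
      (pre_insert (e.chain.pre_Icc (a := 3) (b := r + 1) (by omega) le_rfl)
        ⟨r + 1, ⟨by omega, le_rfl⟩, rfl⟩ hadj) ⟨_, Or.inl rfl⟩ (by
        rintro _ (rfl | ⟨i, ⟨h1, h2⟩, rfl⟩) (h | h)
        · exact hqne 0 1 (by omega) (by omega) (by omega) h
        · exact hqne 0 2 (by omega) (by omega) (by omega) h
        · exact hqne i 1 (by omega) (by omega) (by omega) h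
        · exact hqne i 2 (by omega) (by omega) (by omega) h) (by
        rintro _ (rfl | ⟨i, ⟨h1, h2⟩, rfl⟩) h
        · exact e.chain.notMem _ (by omega) h
        · exact e.chain.notMem _ (by omega) h)
    have hX1 := Set.ncard_le_ncard h1
    have hX2 := e.min X h2 (by omega)
    have hX3 := Set.ncard_add_ncard_compl X
    have hX4 : ({y, q 1, q 2} : Set V) ⊆ Xᶜ := by
      rintro x (rfl | rfl | rfl) h
      · exact hyX h
      · exact h3 _ h (Or.inl rfl)
      · exact h3 _ h (Or.inr rfl)
    have hX5 := Set.ncard_le_ncard hX4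
    rw [Set.ncard_insert_of_notMem, Set.ncard_pair (hqne 1 2 (by omega) (by omega) (by omega))] at hX5
    · omega
    · rintro (h | h)
      · exact e.chain.notMem 1 (by omega) (h ▸ hyK)
      · exact e.chain.notMem 2 (by omega) (h ▸ hyK)

/-- If all edges from `K` to the outside of `W` end in `h₀`, then `insert h₀ K` is contractible. -/
theorem ctr_insert [Finite V] (hG : TriConn G) (hm : 5 ≤ m) (e : Extremal G m W K r q) {h₀ k : V}
    (h0 : h₀ ∉ W) (h0f : h₀ ≠ q 0) (h0l : h₀ ≠ q (r + 1)) (hk : k ∈ K) (hk0 : G.Adj k h₀)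
    (huniq : ∀ x ∈ K, ∀ v, v ∉ W → G.Adj x v → v = h₀) : Ctr G (insert h₀ K) := by
  have hr := e.le_length
  have hmem : ∀ i, 1 ≤ i → i ≤ r → q i ∈ W := fun i h1 h2 => (e.chain.mem h1 h2).1
  have hqB : ∀ i, i ≤ r + 1 → q i ∈ (insert h₀ K)ᶜ := by
    rintro i hi (h | h)
    · by_cases h1 : i = 0
      · exact h0f (by rw [← h, h1])
      · by_cases h2 : i = r + 1
        · exact h0l (by rw [← h, h2])
        · exact h0 (h ▸ hmem i (by omega) (by omega))
    · exact e.chain.notMem i hi h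
  refine ⟨⟨h₀, Or.inl rfl⟩, pre_insert e.cover.lower.2.1 hk hk0.symm, ?_, fun c => ?_⟩
  · have hsub : ({q 0, q 1} : Set V) ⊆ (insert h₀ K)ᶜ := by
      rintro x (rfl | rfl)
      · exact hqB 0 (by omega)
      · exact hqB 1 (by omega)
    have := Set.ncard_le_ncard hsub
    rwa [Set.ncard_pair (e.chain.adj 0 (by omega)).ne] at this
  by_cases hc : c ∈ W \ K
  · obtain ⟨i, h1, h2, rfl⟩ := e.chain.exists_eq hc
    have hqS : ∀ j, j ≤ r + 1 → j ≠ i → q j ∈ (insert h₀ K)ᶜ \ {q i} := fun j hj hji =>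
      ⟨hqB j hj, fun h => hji (e.chain.inj j i hj (by omega) h)⟩
    have hinter : (insert h₀ K)ᶜ \ {q i} ∩ (Wᶜ \ {h₀}) = Wᶜ \ {h₀} := by
      refine Set.inter_eq_right.2 fun x hx => ⟨?_, ?_⟩
      · rintro (h | h)
        · exact hx.2 h
        · exact hx.1 (e.cover.subset h)
      · rintro rfl
        exact hx.1 hc.1
    refine pre_of_closed_meets (B := Wᶜ \ {h₀}) (by rw [hinter]; exact e.cover.upper.2.2.2 h₀) ?_
    rintro A hA ⟨a, ha⟩ hcl
    by_cases haW : a ∈ W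
    · obtain ⟨j, h3, h4, rfl⟩ := e.chain.exists_eq ⟨haW, fun h => (hA ha).1 (Or.inr h)⟩
      have hji : j ≠ i := by
        rintro rfl
        exact (hA ha).2 rfl
      by_cases hlt : j < i
      · have : ∀ t, t ≤ j → q (j - t) ∈ A := by
          intro t
          induction t with
          | zero => intro _; exact ha
          | succ t ih =>
            intro ht
            refine hcl _ (ih (by omega)) _ (hqS _ (by omega) (by omega)) ?_
            have := e.chain.adj (j - (t + 1)) (by omega)
            rw [show j - (t + 1) + 1 = j - t by omega] at this
            exact this.symm
        have h5 := this j le_rfl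
        rw [Nat.sub_self] at h5
        exact ⟨q 0, h5, e.first, fun h => h0f h.symm⟩
      · have : ∀ t, j + t ≤ r + 1 → q (j + t) ∈ A := by
          intro t
          induction t with
          | zero => intro _; exact ha
          | succ t ih =>
            intro ht
            exact hcl _ (ih (by omega)) _ (hqS _ (by omega) (by omega))
              (e.chain.adj (j + t) (by omega))
        have h5 := this (r + 1 - j) (by omega)
        rw [show j + (r + 1 - j) = r + 1 by omega] at h5
        exact ⟨_, h5, e.last, fun h => h0l h.symm⟩
    · exact ⟨a, ha, haW, fun h => (hA ha).1 (Or.inl h)⟩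
  · have hqS : ∀ j, 1 ≤ j → j ≤ r → q j ∈ (insert h₀ K)ᶜ \ {c} := fun j h1 h2 =>
      ⟨hqB j (by omega), fun h => hc (h ▸ e.chain.mem h1 h2)⟩
    have hinter : (insert h₀ K)ᶜ \ {c} ∩ (W \ K) = W \ K := by
      refine Set.inter_eq_right.2 fun x hx => ?_
      obtain ⟨i, h1, h2, rfl⟩ := e.chain.exists_eq hx
      exact hqS i h1 h2
    refine pre_of_closed_meets (B := W \ K) (by rw [hinter]; exact e.chain.pre) ?_
    rintro A hA ⟨a, ha⟩ hcl
    by_contra hcon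
    have hAW : ∀ a ∈ A, a ∉ W := fun a ha haW =>
      hcon ⟨a, ha, haW, fun h => (hA ha).1 (Or.inr h)⟩
    have := hG A h₀ c (fun u hu v huv => by
      by_contra hcon'
      push Not at hcon'
      refine hcon'.1 (hcl u hu v ⟨?_, hcon'.2.2⟩ huv)
      rintro (h | h)
      · exact hcon'.2.1 h
      · exact (hA hu).1 (Or.inl (huniq v h u (hAW u hu) huv.symm)))
      ⟨a, ha, fun h => (hA ha).1 (Or.inl h), (hA ha).2⟩ (q 1)
    have h1 := hqS 1 le_rfl (by omega)
    rcases this with h | h | h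
    · exact hAW _ h (hmem 1 le_rfl (by omega))
    · exact h1.1 (Or.inl h)
    · exact h1.2 h

/-- When all edges from `K` to the outside of `W` end in `h₀`, the vertices of `K` and the last
vertex of the chain form a path ending in a neighbour of `h₀`. -/
theorem exists_far_end [Finite V] (hG : TriConn G) (hm : 5 ≤ m) (hmid : NoMid G m)
    (e : Extremal G m W K r q) {h₀ k : V} (h0 : h₀ ∉ W) (h0f : h₀ ≠ q 0) (h0l : h₀ ≠ q (r + 1))
    (hk : k ∈ K) (hk0 : G.Adj k h₀) (huniq : ∀ x ∈ K, ∀ v, v ∉ W → G.Adj x v → v = h₀) :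
    r = m - 1 ∧ K.ncard = m - 2 ∧ ∃ u ∈ K, G.Adj u h₀ ∧ (∀ x ∈ K, G.Adj x h₀ → x = u) ∧
      ¬ G.Adj u (q r) ∧ (∃ j, 1 ≤ j ∧ j ≤ r ∧ G.Adj u (q j)) ∧ Pre G (insert (q r) (K \ {u})) := by
  have hr := e.le_length
  have hmem : ∀ i, 1 ≤ i → i ≤ r → q i ∈ W := fun i h1 h2 => (e.chain.mem h1 h2).1
  have hadd := e.ncard_add
  have hlarge := e.large
  have hK1 : K.ncard ≤ m - 2 := by
    have h1 := hmid _ (e.ctr_insert hG hm h0 h0f h0l hk hk0 huniq)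
    rw [Set.ncard_insert_of_notMem fun h => h0 (e.cover.subset h)] at h1
    have := e.small
    omega
  have hY : Pre G (insert (q r) K) := by
    obtain ⟨x, hx, h⟩ := e.chain.adjK r (by omega) le_rfl
    exact pre_insert e.cover.lower.2.1 hx h
  have hSW : q '' Set.Icc 1 (r - 1) ⊆ W := by
    rintro _ ⟨i, ⟨h1, h2⟩, rfl⟩
    exact hmem i h1 (by omega)
  have hSc : (q '' Set.Icc 1 (r - 1)).ncard = r - 1 := by
    rw [ncard_image_Icc fun a b _ ha _ hb => e.chain.inj a b (by omega) (by omega)]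
    omega
  obtain ⟨X, hSX, hX, hXW, hXne, hXc⟩ := e.exists_ctr hG hY
    (Set.insert_subset (hmem r (by omega) le_rfl) e.cover.subset) e.last h0 h0l.symm
    ⟨q r, Or.inl rfl, e.chain.adj r le_rfl⟩ ⟨k, Or.inr hk, hk0⟩
    (e.chain.pre_Icc (a := 1) (b := r - 1) (by omega) (by omega)) ⟨q 1, 1, ⟨le_rfl, by omega⟩, rfl⟩
    hSW (by
      rintro _ ⟨i, ⟨h1, h2⟩, rfl⟩ (h | h)
      · have := e.chain.inj _ _ (by omega) (by omega) h
        omega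
      · exact e.chain.notMem i (by omega) h)
  have hle := Set.ncard_le_ncard hSX
  have hSXeq : q '' Set.Icc 1 (r - 1) = X := Set.eq_of_subset_of_ncard_le hSX (by omega)
  refine ⟨by omega, by omega, ?_⟩
  rw [← hSXeq] at hX hXne
  have hcov : CtrCover G (q '' Set.Icc 1 (r - 1)) W := by
    refine ⟨hX, e.cover.upper, hSW, hXne, fun T hT h1 h2 => ?_⟩
    by_cases hTW : T = W
    · exact Or.inr hTW
    · have := e.max T hT h2 hTW
      exact Or.inl (Set.eq_of_subset_of_ncard_le h1 (by omega)).symm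
  have hZ : W \ q '' Set.Icc 1 (r - 1) = insert (q r) K := by
    ext x
    constructor
    · rintro ⟨h1, h2⟩
      by_cases hx : x ∈ K
      · exact Or.inr hx
      obtain ⟨i, h3, h4, rfl⟩ := e.chain.exists_eq ⟨h1, hx⟩
      by_cases hi : i = r
      · exact Or.inl (by rw [hi])
      · exact absurd ⟨i, ⟨h3, by omega⟩, rfl⟩ h2
    · rintro (rfl | h)
      · refine ⟨hmem r (by omega) le_rfl, ?_⟩
        rintro ⟨i, ⟨h1, h2⟩, h⟩
        have := e.chain.inj _ _ (by omega) (by omega) h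
        omega
      · refine ⟨e.cover.subset h, ?_⟩
        rintro ⟨i, ⟨h1, h2⟩, rfl⟩
        exact e.chain.notMem i (by omega) h
  obtain ⟨s, z, hz, hz0, hzl⟩ := hcov.exists_chain hG
  rw [hZ] at hz
  have hs : s = m - 1 := by
    rw [← hz.ncard_eq, Set.ncard_insert_of_notMem (e.chain.notMem r (by omega))]
    omega
  -- orient the path so that it ends in the last vertex of the chain
  obtain ⟨z, hz, hz0, hzl, hzr⟩ : ∃ z, ChainOver G (q '' Set.Icc 1 (r - 1)) (insert (q r) K) s z ∧
      z 0 ∉ W ∧ z (s + 1) ∉ W ∧ z s = q r := by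
    obtain ⟨j, h1, h2, hj⟩ := hz.exists_eq (z := q r) (Or.inl rfl)
    have hzW : ∀ i, 1 ≤ i → i ≤ s → z i ∈ W := by
      intro i h1 h2
      have := hz.mem h1 h2
      rw [← hZ] at this
      exact this.1
    have := hz.nbr (by omega) j h1 h2 (q (r + 1)) (by rw [hj]; exact e.chain.adj r le_rfl)
    rcases this with h | h | h
    · exact absurd (hSW h) e.last
    · by_cases hj1 : j = 1
      · refine ⟨_, hz.reverse, by simpa using hzl, by simpa using hz0, ?_⟩
        simp only [show s + 1 - s = 1 by omega]
        rw [← hj, hj1]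
      · exact absurd (h ▸ hzW (j - 1) (by omega) (by omega)) e.last
    · by_cases hj1 : j = s
      · exact ⟨z, hz, hz0, hzl, by rw [← hj, hj1]⟩
      · exact absurd (h ▸ hzW (j + 1) (by omega) (by omega)) e.last
  have hzK : ∀ i, 1 ≤ i → i < s → z i ∈ K := by
    intro i h1 h2
    rcases hz.mem h1 h2.le with h | h
    · rw [← hzr] at h
      have := hz.inj _ _ (by omega) (by omega) h
      omega
    · exact h
  have hz1 : z 0 = h₀ := huniq (z 1) (hzK 1 le_rfl (by omega)) _ hz0 (hz.adj 0 (by omega)).symm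
  have hKz : ∀ x ∈ K, ∃ i, 1 ≤ i ∧ i < s ∧ z i = x := by
    intro x hx
    obtain ⟨i, h1, h2, h3⟩ := hz.exists_eq (z := x) (Or.inr hx)
    refine ⟨i, h1, lt_of_le_of_ne h2 ?_, h3⟩
    rintro rfl
    exact e.chain.notMem r (by omega) (by rw [← hzr, h3]; exact hx)
  refine ⟨z 1, hzK 1 le_rfl (by omega), hz1 ▸ (hz.adj 0 (by omega)).symm, ?_, ?_, ?_, ?_⟩
  · intro x hx hxh
    obtain ⟨i, h1, h2, rfl⟩ := hKz x hx
    rcases hz.nbr (by omega) i h1 (by omega) _ hxh with h | h | h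
    · exact absurd (hSW h) h0
    · rw [← hz1] at h
      have := hz.inj _ _ (by omega) (by omega) h
      rw [show i = 1 by omega]
    · rw [← hz1] at h
      have := hz.inj _ _ (by omega) (by omega) h
      omega
  · intro h
    rw [← hzr] at h
    rcases hz.nbr (by omega) 1 le_rfl (by omega) _ h with h | h | h
    · obtain ⟨i, ⟨h1, h2⟩, h3⟩ := h
      rw [hzr] at h3
      have := e.chain.inj _ _ (by omega) (by omega) h3
      omega
    · have := hz.inj _ _ (by omega) (by omega) h
      omega
    · have := hz.inj _ _ (by omega) (by omega) h
      omega
  · obtain ⟨_, ⟨i, ⟨h1, h2⟩, rfl⟩, h⟩ := hz.adjK 1 le_rfl (by omega)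
    exact ⟨i, h1, by omega, h⟩
  · have : insert (q r) (K \ {z 1}) = z '' Set.Icc 2 s := by
      ext x
      constructor
      · rintro (rfl | ⟨hx, hx1⟩)
        · exact ⟨s, ⟨by omega, le_rfl⟩, hzr⟩
        · obtain ⟨i, h1, h2, rfl⟩ := hKz x hx
          refine ⟨i, ⟨?_, h2.le⟩, rfl⟩
          by_contra hi
          exact hx1 (by rw [show i = 1 by omega]; rfl)
      · rintro ⟨i, ⟨h1, h2⟩, rfl⟩
        by_cases hi : i = s
        · exact Or.inl (by rw [hi, hzr])
        · refine Or.inr ⟨hzK i (by omega) (by omega), fun h => ?_⟩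
          have := hz.inj _ _ (by omega) (by omega) h
          omega
    rw [this]
    exact hz.pre_Icc (by omega) (by omega)

theorem false_of_forall_eq [Finite V] (hG : TriConn G) (hm : 5 ≤ m) (hmid : NoMid G m)
    (e : Extremal G m W K r q) {h₀ k : V} (h0 : h₀ ∉ W) (h0f : h₀ ≠ q 0) (h0l : h₀ ≠ q (r + 1))
    (hk : k ∈ K) (hk0 : G.Adj k h₀) (huniq : ∀ x ∈ K, ∀ v, v ∉ W → G.Adj x v → v = h₀) :
    False := by
  have key : ∀ {q : ℕ → V}, Extremal G m W K r q → h₀ ≠ q 0 → h₀ ≠ q (r + 1) → ∀ j, 1 ≤ j →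
      j < r → ∀ u ∈ K, G.Adj u h₀ → G.Adj u (q j) → r ≤ j + 1 := by
    intro q e h0f h0l j h1 h2 u hu huh huj
    obtain ⟨hr, hKc, u', hu', -, hu2, -, -, hpre⟩ :=
      e.exists_far_end hG hm hmid h0 h0f h0l hk hk0 huniq
    obtain rfl := hu2 u hu huh
    have hmem : ∀ i, 1 ≤ i → i ≤ r → q i ∈ W := fun i h1 h2 => (e.chain.mem h1 h2).1
    have hdis : Disjoint (q '' Set.Icc (j + 1) r) (K \ {u}) := by
      rw [Set.disjoint_left]
      rintro _ ⟨i, ⟨h3, h4⟩, rfl⟩ h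
      exact e.chain.notMem i (by omega) h.1
    have hS : Pre G (q '' Set.Icc (j + 1) r ∪ K \ {u}) := by
      have := pre_union (e.chain.pre_Icc (a := j + 1) (b := r) h2 (by omega)) hpre (a := q r)
        (b := q r) ⟨r, ⟨h2, le_rfl⟩, rfl⟩ (Or.inl rfl) (Or.inl rfl)
      have hr' : q r ∈ q '' Set.Icc (j + 1) r ∪ K \ {u} := Or.inl ⟨r, ⟨h2, le_rfl⟩, rfl⟩
      rwa [Set.union_insert, Set.insert_eq_of_mem hr'] at this
    have := e.ncard_le hG (pre_insert (e.chain.pre_Icc h1 (by omega)) ⟨j, ⟨h1, le_rfl⟩, rfl⟩ huj)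
      (by
        rintro _ (rfl | ⟨i, ⟨h3, h4⟩, rfl⟩)
        · exact e.cover.subset hu
        · exact hmem i h3 (by omega)) e.first h0 h0f.symm
      ⟨q 1, Or.inr ⟨1, ⟨le_rfl, h1⟩, rfl⟩, (e.chain.adj 0 (by omega)).symm⟩ ⟨u, Or.inl rfl, huh⟩
      hS ⟨q r, Or.inl ⟨r, ⟨h2, le_rfl⟩, rfl⟩⟩ (by
        rintro _ (⟨i, ⟨h3, h4⟩, rfl⟩ | h)
        · exact hmem i (by omega) h4
        · exact e.cover.subset h.1) (by
        rintro _ (⟨i, ⟨h3, h4⟩, rfl⟩ | h) (h' | ⟨i', ⟨h5, h6⟩, h'⟩)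
        · exact e.chain.notMem i (by omega) (h' ▸ hu)
        · have := e.chain.inj _ _ (by omega) (by omega) h'
          omega
        · exact h.2 h'
        · exact e.chain.notMem i' (by omega) (h' ▸ h.1))
    rw [Set.ncard_union_eq hdis, ncard_image_Icc fun a b _ ha _ hb => e.chain.inj a b (by omega)
      (by omega)] at this
    have := Set.ncard_sdiff_singleton_add_one hu
    omega
  have e' := e.reverse
  obtain ⟨hr, -, u, hu, huh, -, hur, ⟨j, h1, h2, huj⟩, -⟩ :=
    e.exists_far_end hG hm hmid h0 h0f h0l hk hk0 huniq
  obtain ⟨-, -, u', hu', huh', huu', hur', -, -⟩ :=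
    e'.exists_far_end hG hm hmid h0 (by simpa using h0l) (by simpa using h0f) hk hk0 huniq
  obtain rfl := huu' u hu huh
  simp only [show r + 1 - r = 1 by omega] at hur'
  have hj1 : j ≠ 1 := by
    rintro rfl
    exact hur' huj
  have hjr : j ≠ r := by
    rintro rfl
    exact hur huj
  have h3 := key e h0f h0l j h1 (by omega) u hu huh huj
  have h4 := key e' (by simpa using h0l) (by simpa using h0f) (r + 1 - j) (by omega) (by omega)
    u hu huh (by simpa [show r + 1 - (r + 1 - j) = j by omega] using huj)
  omega

end Extremal
end ExtremalPairs

section TwoAttachments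
variable {V : Type*} {G : SimpleGraph V}

namespace Extremal
variable {m : ℕ} {W K : Set V} {r : ℕ} {q : ℕ → V}

/-- A set covering `K` and disjoint from the chain of `W` and its two ends. -/
theorem exists_opposite_cover [Finite V] (hG : TriConn G) (hm : 5 ≤ m)
    (e : Extremal G m W K r q) {y k : V} (hy : y ∉ W) (hyf : y ≠ q 0) (hyl : y ≠ q (r + 1))
    (hk : k ∈ K) (hky : G.Adj k y) : ∃ T, CtrCover G K T ∧
      ∀ x ∈ T, x ∉ K → x ∉ W ∧ x ≠ q 0 ∧ x ≠ q (r + 1) := by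
  have hr := e.le_length
  have hmem : ∀ i, 1 ≤ i → i ≤ r → q i ∈ W := fun i h1 h2 => (e.chain.mem h1 h2).1
  have hqne : ∀ i j, i ≤ r + 1 → j ≤ r + 1 → i ≠ j → q i ≠ q j :=
    fun i j hi hj hij h => hij (e.chain.inj i j hi hj h)
  let Y : Set V := q '' Set.Icc 3 (r + 1) ∪ Wᶜ \ {y}
  have hY : Pre G Y := pre_union (e.chain.pre_Icc (a := 3) (b := r + 1) (by omega) le_rfl)
    (e.cover.upper.2.2.2 y) (a := q (r + 1)) (b := q (r + 1)) ⟨r + 1, ⟨by omega, le_rfl⟩, rfl⟩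
    ⟨e.last, fun h => hyl h.symm⟩ (Or.inl rfl)
  have hYB : ∀ x ∈ Y, x ∉ ({q 1, q 2} : Set V) := by
    rintro _ (⟨i, ⟨h1, h2⟩, rfl⟩ | h) (h' | h')
    · exact hqne i 1 (by omega) (by omega) (by omega) h'
    · exact hqne i 2 (by omega) (by omega) (by omega) h'
    · exact h.1 (h' ▸ hmem 1 (by omega) (by omega))
    · exact h.1 (h' ▸ hmem 2 (by omega) (by omega))
  have hYK : ∀ x ∈ Y, x ∉ K ∧ x ≠ y := by
    rintro _ (⟨i, ⟨h1, h2⟩, rfl⟩ | h)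
    · refine ⟨e.chain.notMem i (by omega), fun h => ?_⟩
      by_cases hi : i = r + 1
      · exact hyl (by rw [← h, hi])
      · exact hy (h ▸ hmem i (by omega) (by omega))
    · exact ⟨fun hK => h.1 (e.cover.subset hK), h.2⟩
  obtain ⟨l, p, hp⟩ := exists_isMinEar hY (H := {q 1, q 2}) (Or.inl rfl) (Or.inr rfl)
    (hqne 1 2 (by omega) (by omega) (by omega))
    ⟨q 0, Or.inr ⟨e.first, fun h => hyf h.symm⟩, e.chain.adj 0 (by omega)⟩
    ⟨q 3, Or.inl ⟨3, ⟨by omega, by omega⟩, rfl⟩, (e.chain.adj 2 (by omega)).symm⟩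
  have hB := hp.tc (tc_pair (e.chain.adj 1 (by omega))) hYB
  have hBK : ∀ x ∈ ({q 1, q 2} : Set V) ∪ p '' Set.Icc 1 l, x ∉ K ∧ x ≠ y := by
    rintro x ((rfl | rfl) | ⟨i, ⟨h1, h2⟩, rfl⟩)
    · exact ⟨e.chain.notMem 1 (by omega), fun h => hy (h ▸ hmem 1 (by omega) (by omega))⟩
    · exact ⟨e.chain.notMem 2 (by omega), fun h => hy (h ▸ hmem 2 (by omega) (by omega))⟩
    · exact hYK _ (hp.1.mem i h1 h2)
  have hB3 : 3 ≤ (({q 1, q 2} : Set V) ∪ p '' Set.Icc 1 l).ncard := by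
    have hp1 := hYB _ (hp.1.mem 1 le_rfl hp.1.pos)
    have hsub : insert (p 1) ({q 1, q 2} : Set V) ⊆ {q 1, q 2} ∪ p '' Set.Icc 1 l :=
      Set.insert_subset (Or.inr ⟨1, ⟨le_rfl, hp.1.pos⟩, rfl⟩) Set.subset_union_left
    have := Set.ncard_le_ncard hsub
    rwa [Set.ncard_insert_of_notMem hp1,
      Set.ncard_pair (hqne 1 2 (by omega) (by omega) (by omega))] at this
  set B := ({q 1, q 2} : Set V) ∪ p '' Set.Icc 1 l
  have hprop : ∀ i, 1 ≤ i → i ≤ r → q i ∈ B → q (i - 1) ∈ B ∧ q (i + 1) ∈ B := by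
    intro i h1 h2 hi
    obtain ⟨a, ha, b, hb, hab, hia, hib⟩ := hB.exists_two_nbrs hB3 hi
    rcases (e.min_attach hm h1 h2 hia).resolve_left (hBK a ha).1 with rfl | rfl <;>
    rcases (e.min_attach hm h1 h2 hib).resolve_left (hBK b hb).1 with rfl | rfl
    · exact absurd rfl hab
    · exact ⟨ha, hb⟩
    · exact ⟨hb, ha⟩
    · exact absurd rfl hab
  have hqB : ∀ i, i ≤ r → q i ∈ B ∧ q (i + 1) ∈ B := by
    intro i
    induction i with
    | zero =>
      intro _
      have h1 : q 1 ∈ B := Or.inl (Or.inl rfl)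
      exact ⟨(hprop 1 le_rfl (by omega) h1).1, h1⟩
    | succ i ih =>
      intro hi
      have := (ih (by omega)).2
      exact ⟨this, (hprop (i + 1) (by omega) hi this).2⟩
  obtain ⟨T₀, hST, hTB, hT, -⟩ := exists_ctr_superset hG hB
    (pre_insert e.cover.lower.2.1 hk hky.symm) ⟨y, Or.inl rfl⟩ (by
      rintro s (rfl | hs) h
      · exact (hBK _ h).2 rfl
      · exact (hBK _ h).1 hs)
  obtain ⟨T, hTT, hcov⟩ := exists_ctrCover e.cover.lower hT
    ((Set.subset_insert _ _).trans hST) (fun h => hy (e.cover.subset (h ▸ hST (Or.inl rfl))))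
  refine ⟨T, hcov, fun x hx hxK => ⟨fun hxW => ?_, ?_, ?_⟩⟩
  · obtain ⟨i, h1, h2, rfl⟩ := e.chain.exists_eq ⟨hxW, hxK⟩
    exact hTB _ (hTT hx) (hqB i h2).1
  · rintro rfl
    exact hTB _ (hTT hx) (hqB 0 (by omega)).1
  · rintro rfl
    exact hTB _ (hTT hx) (hqB r le_rfl).2

theorem false_of_adj_pair [Finite V] (hG : TriConn G) (e : Extremal G m W K 3 q)
    (hK : K.ncard ≤ 4) (huniq : ∀ k ∈ K, ∀ p ∈ W \ K, ∀ p' ∈ W \ K, G.Adj k p → G.Adj k p' → p = p')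
    {a b c d xa xb : V} (ha : a ∈ K) (hb : b ∈ K) (hc : c ∈ K) (hd : d ∈ K)
    (hab : G.Adj a b) (hcd : G.Adj c d) (hca : c ≠ a) (hcb : c ≠ b) (hda : d ≠ a) (hdb : d ≠ b)
    (hall : ∀ x ∈ K, x = a ∨ x = b ∨ x = c ∨ x = d) (hxa : xa ∉ W) (hxb : xb ∉ W)
    (hxx : xa ≠ xb) (haxa : G.Adj a xa) (hbxb : G.Adj b xb) : False := by
  have hKW := e.cover.subset
  have h1 := e.chain.mem (i := 1) (by omega) (by omega)
  have h2 := e.chain.mem (i := 2) (by omega) (by omega)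
  have h3 := e.chain.mem (i := 3) (by omega) (by omega)
  by_cases hp : ∃ p ∈ W \ K, G.Adj p c ∨ G.Adj p d
  · obtain ⟨p, hp, hpcd⟩ := hp
    have hS : Pre G (W \ K ∪ {c, d}) := by
      have hcd' : Pre G ({c, d} : Set V) := pre_insert (pre_singleton d) rfl hcd
      rcases hpcd with h | h
      · exact pre_union e.chain.pre hcd' hp (Or.inl rfl) (Or.inr h)
      · exact pre_union e.chain.pre hcd' hp (Or.inr rfl) (Or.inr h)
    have := e.ncard_le hG (Y := {a, b}) (pre_insert (pre_singleton b) rfl hab)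
      (Set.insert_subset (hKW ha) (Set.singleton_subset_iff.2 (hKW hb))) hxa hxb hxx
      ⟨a, Or.inl rfl, haxa⟩ ⟨b, Or.inr rfl, hbxb⟩ hS ⟨p, Or.inl hp⟩
      (Set.union_subset Set.sdiff_subset
        (Set.insert_subset (hKW hc) (Set.singleton_subset_iff.2 (hKW hd)))) (by
        rintro s (hs | rfl | rfl) (h | h)
        · exact hs.2 (h ▸ ha)
        · exact hs.2 (h ▸ hb)
        · exact hca h
        · exact hcb h
        · exact hda h
        · exact hdb h)
    rw [Set.ncard_union_eq, e.chain.ncard_eq, Set.ncard_pair hcd.ne] at this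
    · omega
    · rw [Set.disjoint_left]
      rintro s hs (rfl | rfl)
      · exact hs.2 hc
      · exact hs.2 hd
  · push Not at hp
    have hadj : ∀ p ∈ W \ K, (∃ k ∈ K, G.Adj p k) → G.Adj a p ∨ G.Adj b p := by
      rintro p hpP ⟨k, hk, hpk⟩
      rcases hall k hk with rfl | rfl | rfl | rfl
      · exact Or.inl hpk.symm
      · exact Or.inr hpk.symm
      · exact absurd hpk (hp p hpP).1
      · exact absurd hpk (hp p hpP).2
    have hne : ∀ i j, i ≤ 4 → j ≤ 4 → i ≠ j → q i ≠ q j :=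
      fun i j hi hj hij h => hij (e.chain.inj i j hi hj h)
    have h12 := hne 1 2 (by omega) (by omega) (by omega)
    have h13 := hne 1 3 (by omega) (by omega) (by omega)
    have h23 := hne 2 3 (by omega) (by omega) (by omega)
    rcases hadj _ h1 (e.chain.adjK 1 (by omega) (by omega)) with g1 | g1 <;>
    rcases hadj _ h2 (e.chain.adjK 2 (by omega) (by omega)) with g2 | g2 <;>
    rcases hadj _ h3 (e.chain.adjK 3 (by omega) (by omega)) with g3 | g3
    · exact h12 (huniq a ha _ h1 _ h2 g1 g2)
    · exact h12 (huniq a ha _ h1 _ h2 g1 g2)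
    · exact h13 (huniq a ha _ h1 _ h3 g1 g3)
    · exact h23 (huniq b hb _ h2 _ h3 g2 g3)
    · exact h23 (huniq a ha _ h2 _ h3 g2 g3)
    · exact h13 (huniq b hb _ h1 _ h3 g1 g3)
    · exact h12 (huniq b hb _ h1 _ h2 g1 g2)
    · exact h12 (huniq b hb _ h1 _ h2 g1 g2)

theorem not_adj_first [Finite V] (hG : TriConn G) (e : Extremal G m W K 3 q)
    (huniq : ∀ k ∈ K, ∀ p ∈ W \ K, ∀ p' ∈ W \ K, G.Adj k p → G.Adj k p' → p = p')
    {k x : V} (hk : k ∈ K) (hx : x ∉ W) (hx0 : x ≠ q 0) (hkx : G.Adj k x)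
    (hpre : Pre G (K \ {k})) : ¬ G.Adj (q 1) k := by
  intro hqk
  have hKW := e.cover.subset
  have h1 := e.chain.mem (i := 1) (by omega) (by omega)
  have h2 := e.chain.mem (i := 2) (by omega) (by omega)
  obtain ⟨z, hz, h2z⟩ := e.chain.adjK 2 (by omega) (by omega)
  have hzk : z ≠ k := by
    rintro rfl
    have := e.chain.inj _ _ (by omega) (by omega) (huniq z hz _ h1 _ h2 hqk.symm h2z.symm)
    omega
  have := e.ncard_le hG (Y := {q 1, k}) (pre_insert (pre_singleton k) rfl hqk)
    (Set.insert_subset h1.1 (Set.singleton_subset_iff.2 (hKW hk))) e.first hx hx0.symm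
    ⟨q 1, Or.inl rfl, (e.chain.adj 0 (by omega)).symm⟩ ⟨k, Or.inr rfl, hkx⟩
    (pre_union (e.chain.pre_Icc (a := 2) (b := 3) (by omega) (by omega)) hpre
      ⟨2, ⟨le_rfl, by omega⟩, rfl⟩ ⟨hz, hzk⟩ (Or.inr h2z)) ⟨z, Or.inr ⟨hz, hzk⟩⟩
    (Set.union_subset (by
      rintro _ ⟨i, ⟨h3, h4⟩, rfl⟩
      exact (e.chain.mem (by omega) h4).1) (Set.sdiff_subset.trans hKW)) (by
      rintro s (⟨i, ⟨h3, h4⟩, rfl⟩ | hs) (h | h)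
      · have := e.chain.inj _ _ (by omega) (by omega) h
        omega
      · exact e.chain.notMem i (by omega) (h ▸ hk)
      · exact h1.2 (h ▸ hs.1)
      · exact hs.2 h)
  rw [Set.ncard_union_eq, ncard_image_Icc fun a b _ ha _ hb => e.chain.inj a b (by omega)
    (by omega)] at this
  · have := Set.ncard_sdiff_singleton_add_one hk
    omega
  · rw [Set.disjoint_left]
    rintro _ ⟨i, ⟨h3, h4⟩, rfl⟩ h
    exact e.chain.notMem i (by omega) h.1

theorem false_of_star [Finite V] (hG : TriConn G) (e : Extremal G m W K 3 q)
    (huniq : ∀ k ∈ K, ∀ p ∈ W \ K, ∀ p' ∈ W \ K, G.Adj k p → G.Adj k p' → p = p')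
    {c : V} (hpre : ∀ k ∈ K, k ≠ c → Pre G (K \ {k}))
    (hatt : ∀ k ∈ K, k ≠ c → ∃ x, x ∉ W ∧ x ≠ q 0 ∧ x ≠ q 4 ∧ G.Adj k x) : False := by
  have h1 := e.chain.mem (i := 1) (by omega) (by omega)
  have h3 := e.chain.mem (i := 3) (by omega) (by omega)
  obtain ⟨z, hz, h1z⟩ := e.chain.adjK 1 (by omega) (by omega)
  obtain ⟨z', hz', h3z⟩ := e.chain.adjK 3 (by omega) (by omega)
  have hzc : z = c := by
    by_contra hne
    obtain ⟨x, hx1, hx2, hx3, hx4⟩ := hatt z hz hne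
    exact e.not_adj_first hG huniq hz hx1 hx2 hx4 (hpre z hz hne) h1z
  have hzc' : z' = c := by
    by_contra hne
    obtain ⟨x, hx1, hx2, hx3, hx4⟩ := hatt z' hz' hne
    exact e.reverse.not_adj_first hG huniq hz' hx1 hx3 hx4 (hpre z' hz' hne) h3z
  subst hzc
  subst hzc'
  have := e.chain.inj _ _ (by omega) (by omega) (huniq _ hz _ h1 _ h3 h1z.symm h3z.symm)
  omega

end Extremal
end TwoAttachments

section Main
variable {V : Type*} {G : SimpleGraph V}

namespace Extremal
variable {m : ℕ} {W K : Set V} {r : ℕ} {q : ℕ → V}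

/-- A contractible set of maximum size between `W \ K` and `W`, covered by `W`. -/
theorem exists_max_ctr [Finite V] (hG : TriConn G) (e : Extremal G m W K r q) {k k' h h' : V}
    (hh : h ∉ W) (hh' : h' ∉ W) (hne : h ≠ h') (hk : k ∈ K) (hk' : k' ∈ K) (hkh : G.Adj k h)
    (hkh' : G.Adj k' h') : ∃ D, W \ K ⊆ D ∧ CtrCover G D W ∧ D.ncard ≤ K.ncard := by
  obtain ⟨X, h1, h2, h3, h4, -⟩ := e.exists_ctr hG e.cover.lower.2.1 e.cover.subset hh hh' hne
    ⟨k, hk, hkh⟩ ⟨k', hk', hkh'⟩ e.chain.pre ⟨q 1, e.chain.mem le_rfl e.chain.pos⟩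
    Set.sdiff_subset (fun s hs => hs.2)
  obtain ⟨D, ⟨hD1, hD2, hD3, hD4⟩, hDmax⟩ := Set.exists_max_image
    {X : Set V | W \ K ⊆ X ∧ Ctr G X ∧ X ⊆ W ∧ X ≠ W} Set.ncard (Set.toFinite _)
    ⟨X, h1, h2, h3, h4⟩
  refine ⟨D, hD1, ⟨hD2, e.cover.upper, hD3, hD4, fun X hX h1 h2 => ?_⟩, e.max D hD2 hD3 hD4⟩
  by_cases hXW : X = W
  · exact Or.inr hXW
  · exact Or.inl (Set.eq_of_subset_of_ncard_le h1 (hDmax X ⟨hD1.trans h1, hX, h2, hXW⟩)).symm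

theorem false_of_ne [Finite V] (hG : TriConn G) (hm : 5 ≤ m) (hmid : NoMid G m)
    (e : Extremal G m W K r q) {y k₀ k k' h h' : V} (hy : y ∉ W) (hyf : y ≠ q 0)
    (hyl : y ≠ q (r + 1)) (hk₀ : k₀ ∈ K) (hky : G.Adj k₀ y)
    (hh : h ∉ W) (hh' : h' ∉ W) (hne : h ≠ h') (hk : k ∈ K) (hk' : k' ∈ K) (hkh : G.Adj k h)
    (hkh' : G.Adj k' h') : False := by
  have hKW := e.cover.subset
  have hr := e.le_length
  have hadd := e.ncard_add
  have hlarge := e.large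
  have hsmall := e.small
  have hrK : r ≤ K.ncard := by
    rw [← e.chain.ncard_eq]
    exact e.ncard_le hG e.cover.lower.2.1 hKW hh hh' hne
      ⟨k, hk, hkh⟩ ⟨k', hk', hkh'⟩ e.chain.pre ⟨q 1, e.chain.mem le_rfl e.chain.pos⟩
      Set.sdiff_subset (fun s hs => hs.2)
  have hKm : K.ncard = m - 1 := by omega
  have huniq : ∀ k ∈ K, ∀ h, h ∉ W → ∀ h', h' ∉ W → G.Adj k h → G.Adj k h' → h = h' :=
    fun k hk h hh h' hh' => unique_attachment hG hm hmid e.cover.upper e.min (by omega) hKW hKm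
      e.chain hr hk hh hh'
  obtain ⟨T, hT, hTW⟩ := e.exists_opposite_cover hG hm hy hyf hyl hk₀ hky
  obtain ⟨s, t, ht, ht0, htl⟩ := hT.exists_chain hG
  have hTc : K.ncard + s = T.ncard := by
    rw [← ht.ncard_eq, add_comm]
    exact Set.ncard_sdiff_add_ncard_of_subset hT.subset
  have hTm := hmid T hT.upper
  have hs := ht.pos
  obtain ⟨D, hPD, hD, hDK⟩ := e.exists_max_ctr hG hh hh' hne hk hk' hkh hkh'
  obtain ⟨l, z, hz, hz0, hzl⟩ := hD.exists_chain hG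
  have hDc : D.ncard + l = W.ncard := by
    rw [← hz.ncard_eq, add_comm]
    exact Set.ncard_sdiff_add_ncard_of_subset hD.subset
  have hDE : r + (D ∩ K).ncard = D.ncard := by
    rw [← e.chain.ncard_eq, ← Set.ncard_union_eq]
    · congr 1
      ext x
      constructor
      · rintro (h | h)
        · exact hPD h
        · exact h.1
      · intro hx
        by_cases hxK : x ∈ K
        · exact Or.inr ⟨hx, hxK⟩
        · exact Or.inl ⟨hD.subset hx, hxK⟩
    · rw [Set.disjoint_left]
      exact fun x hx hx' => hx.2 hx'.2
  have hzW : ∀ i, 1 ≤ i → i ≤ l → z i ∈ W := fun i h1 h2 => (hz.mem h1 h2).1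
  have hzK : ∀ i, 1 ≤ i → i ≤ l → z i ∈ K := fun i h1 h2 =>
    by_contra fun h => (hz.mem h1 h2).2 (hPD ⟨hzW i h1 h2, h⟩)
  have hKz : ∀ x ∈ K, x ∉ D → ∃ i, 1 ≤ i ∧ i ≤ l ∧ z i = x := fun x hx hxD =>
    hz.exists_eq ⟨hKW hx, hxD⟩
  let L : Set V := insert (z 1) (insert (z l) (D ∩ K))
  have hKL : ∀ x ∈ K, ∀ v, v ∉ W → G.Adj x v → x ∈ L := by
    intro x hx v hv hxv
    by_cases hxD : x ∈ D
    · exact Or.inr (Or.inr ⟨hxD, hx⟩)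
    obtain ⟨i, h1, h2, rfl⟩ := hKz x hx hxD
    rcases hz.nbr (by omega) i h1 h2 v hxv with h | h | h
    · exact absurd (hD.subset h) hv
    · by_cases hi : i = 1
      · left; rw [hi]
      · exact absurd (h ▸ hzW (i - 1) (by omega) (by omega)) hv
    · by_cases hi : i = l
      · right; left; rw [hi]
      · exact absurd (h ▸ hzW (i + 1) (by omega) (by omega)) hv
  have hex : ∀ x, ∃ k, x ∈ T \ K → k ∈ K ∧ G.Adj k x := by
    intro x
    by_cases hx : x ∈ T \ K
    · obtain ⟨k, hk, h⟩ := hT.exists_adj hG hx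
      exact ⟨k, fun _ => ⟨hk, h⟩⟩
    · exact ⟨x, fun h => absurd h hx⟩
  choose f hf using hex
  have hfL : f '' (T \ K) ⊆ L := by
    rintro _ ⟨x, hx, rfl⟩
    exact hKL _ (hf x hx).1 x (hTW x hx.1 hx.2).1 (hf x hx).2
  have hfinj : Set.InjOn f (T \ K) := by
    intro x hx x' hx' hxx
    refine huniq (f x) (hf x hx).1 x (hTW x hx.1 hx.2).1 x' (hTW x' hx'.1 hx'.2).1 (hf x hx).2 ?_
    rw [hxx]
    exact (hf x' hx').2
  have hfc := hfinj.ncard_image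
  rw [ht.ncard_eq] at hfc
  have hLc := Set.ncard_le_ncard hfL
  have hL1 := Set.ncard_insert_le (z 1) (insert (z l) (D ∩ K))
  have hL2 := Set.ncard_insert_le (z l) (D ∩ K)
  change L.ncard ≤ _ at hL1
  obtain rfl : m = 5 := by omega
  obtain rfl : r = 3 := by omega
  obtain rfl : s = 3 := by omega
  obtain rfl : l = 3 := by omega
  have hE : (D ∩ K).ncard = 1 := by omega
  obtain ⟨w, hw⟩ := Set.ncard_eq_one.1 hE
  have hwDK : w ∈ D ∩ K := by rw [hw]; rfl
  have hwK := hwDK.2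
  have hLeq : f '' (T \ K) = L := Set.eq_of_subset_of_ncard_le hfL (by omega)
  have hatt : ∀ k ∈ L, ∃ x, x ∈ T \ K ∧ f x = k := by
    intro k hk
    rw [← hLeq] at hk
    exact hk
  have hpW : ∀ p ∈ W \ K, p ∉ T := fun p hp hpT => (hTW p hpT hp.2).1 hp.1
  have hPuniq : ∀ k ∈ K, ∀ p ∈ W \ K, ∀ p' ∈ W \ K, G.Adj k p → G.Adj k p' → p = p' :=
    fun k hk p hp p' hp' => unique_attachment hG hm hmid hT.upper
      (fun X hX hXm => by have := e.min X hX hXm; omega) (by omega) hT.subset hKm ht (by omega) hk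
      (hpW p hp) (hpW p' hp')
  have hzne : ∀ i j, i ≤ 4 → j ≤ 4 → i ≠ j → z i ≠ z j :=
    fun i j hi hj hij h => hij (hz.inj i j hi hj h)
  have hwz : ∀ i, 1 ≤ i → i ≤ 3 → w ≠ z i := fun i h1 h2 h => (hz.mem h1 h2).2 (h ▸ hwDK.1)
  have hall : ∀ x ∈ K, x = w ∨ x = z 1 ∨ x = z 2 ∨ x = z 3 := by
    intro x hx
    by_cases hxD : x ∈ D
    · left
      have : x ∈ D ∩ K := ⟨hxD, hx⟩
      rw [hw] at this
      exact this
    · obtain ⟨i, h1, h2, rfl⟩ := hKz x hx hxD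
      right
      have : i = 1 ∨ i = 2 ∨ i = 3 := by omega
      rcases this with rfl | rfl | rfl
      · exact Or.inl rfl
      · exact Or.inr (Or.inl rfl)
      · exact Or.inr (Or.inr rfl)
  have hz1 := hzK 1 (by omega) (by omega)
  have hz2 := hzK 2 (by omega) (by omega)
  have hz3 := hzK 3 (by omega) (by omega)
  have h12 := hz.adj 1 (by omega)
  have h23 := hz.adj 2 (by omega)
  have n12 := hzne 1 2 (by omega) (by omega) (by omega)
  have n13 := hzne 1 3 (by omega) (by omega) (by omega)
  have n23 := hzne 2 3 (by omega) (by omega) (by omega)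
  have nw1 := hwz 1 (by omega) (by omega)
  have nw2 := hwz 2 (by omega) (by omega)
  have nw3 := hwz 3 (by omega) (by omega)
  obtain ⟨xw, hxw, rfl⟩ := hatt w (Or.inr (Or.inr hwDK))
  obtain ⟨x1, hx1, hx1'⟩ := hatt (z 1) (Or.inl rfl)
  obtain ⟨x3, hx3, hx3'⟩ := hatt (z 3) (Or.inr (Or.inl rfl))
  have hax1 : G.Adj (z 1) x1 := hx1' ▸ (hf x1 hx1).2
  have hax3 : G.Adj (z 3) x3 := hx3' ▸ (hf x3 hx3).2
  have hxwW := hTW xw hxw.1 hxw.2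
  have hx1W := hTW x1 hx1.1 hx1.2
  have hx3W := hTW x3 hx3.1 hx3.2
  have hw1 : ¬ G.Adj (f xw) (z 1) := fun hadj => by
    refine e.false_of_adj_pair hG hsmall hPuniq hwK hz1 hz2 hz3 hadj h23 nw2.symm
      n12.symm nw3.symm n13.symm hall hxwW.1 hx1W.1 ?_ (hf xw hxw).2 hax1
    rintro rfl
    exact nw1 hx1'
  have hw3 : ¬ G.Adj (f xw) (z 3) := fun hadj => by
    refine e.false_of_adj_pair hG hsmall hPuniq hwK hz3 hz1 hz2 hadj h12 nw1.symm
      n13 nw2.symm n23 (fun x hx => by have := hall x hx; tauto) hxwW.1 hx3W.1 ?_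
      (hf xw hxw).2 hax3
    rintro rfl
    exact nw3 hx3'
  have hw2 : G.Adj (f xw) (z 2) := by
    obtain ⟨a, rfl, b, hb, hba, hab⟩ := e.cover.lower.2.1.exists_adj (A := {f xw})
      (Set.singleton_subset_iff.2 hwK) (Set.singleton_nonempty _) hz1 (fun h => nw1 h.symm)
    rcases hall b hb with rfl | rfl | rfl | rfl
    · exact absurd rfl hba
    · exact absurd hab hw1
    · exact hab
    · exact absurd hab hw3
  have hstar : ∀ x ∈ K, x ≠ z 2 → G.Adj (z 2) x := by
    intro x hx hx2
    rcases hall x hx with rfl | rfl | rfl | rfl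
    · exact hw2.symm
    · exact h12.symm
    · exact absurd rfl hx2
    · exact h23
  refine e.false_of_star hG hPuniq (c := z 2) (fun k hk hk2 => ?_) (fun k hk hk2 => ?_)
  · refine pre_of_closed_mem (z 2) fun A hA ⟨a, ha⟩ hcl => ?_
    by_cases ha2 : a = z 2
    · exact ha2 ▸ ha
    · exact hcl a ha _ ⟨hz2, hk2.symm⟩ (hstar a (hA ha).1 ha2).symm
  · rcases hall k hk with rfl | rfl | rfl | rfl
    · exact ⟨xw, hxwW.1, hxwW.2.1, hxwW.2.2, (hf xw hxw).2⟩
    · exact ⟨x1, hx1W.1, hx1W.2.1, hx1W.2.2, hax1⟩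
    · exact absurd rfl hk2
    · exact ⟨x3, hx3W.1, hx3W.2.1, hx3W.2.2, hax3⟩

theorem false [Finite V] (hG : TriConn G) (hm : 5 ≤ m) (hmid : NoMid G m)
    (hcard : 2 * m + 1 ≤ Nat.card V) (e : Extremal G m W K r q) : False := by
  obtain ⟨y, hy, hyf, hyl, k, hk, hky⟩ := e.exists_attachment hG hm hcard
  by_cases h : ∀ x ∈ K, ∀ v, v ∉ W → G.Adj x v → v = y
  · exact e.false_of_forall_eq hG hm hmid hy hyf hyl hk hky h
  · push Not at h
    obtain ⟨x, hx, v, hv, hxv, hvy⟩ := h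
    exact e.false_of_ne hG hm hmid hy hyf hyl hk hky hv hy hvy hx hk hxv hky

end Extremal

theorem TriConn.ctr_singleton [Finite V] (hG : TriConn G) (hV : 4 ≤ Nat.card V) (v : V) :
    Ctr G {v} := by
  have hc := Set.ncard_add_ncard_compl ({v} : Set V)
  rw [Set.ncard_singleton] at hc
  refine ⟨⟨v, rfl⟩, pre_singleton v, by omega, fun c A hA ⟨a, ha⟩ hcl x hx => ?_⟩
  rcases hG A v c (fun u hu w huw => by
    by_contra h
    push Not at h
    exact h.1 (hcl u hu w ⟨h.2.1, h.2.2⟩ huw)) ⟨a, ha, (hA ha).1, (hA ha).2⟩ x with h | h | h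
  · exact h
  · exact absurd h hx.1
  · exact absurd h hx.2

theorem TriConn.ctr_compl_pair [Finite V] (hG : TriConn G) (hV : 4 ≤ Nat.card V) {a b : V}
    (hab : G.Adj a b) : Ctr G ({a, b} : Set V)ᶜ := by
  have hc := Set.ncard_add_ncard_compl ({a, b} : Set V)
  rw [Set.ncard_pair hab.ne] at hc
  refine ⟨Set.nonempty_of_ncard_ne_zero (by omega), fun A hA ⟨z, hz⟩ hcl x hx => ?_,
    by rw [compl_compl]; exact tc_pair hab⟩
  have hn : ∀ y ∈ ({a, b} : Set V)ᶜ, y ≠ a ∧ y ≠ b :=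
    fun y hy => ⟨fun h => hy (Or.inl h), fun h => hy (Or.inr h)⟩
  rcases hG A a b (fun u hu w huw => by
    by_contra h
    push Not at h
    refine h.1 (hcl u hu w ?_ huw)
    rintro (h' | h')
    · exact h.2.1 h'
    · exact h.2.2 h') ⟨z, hz, hn z (hA hz)⟩ x with h | h | h
  · exact h
  · exact absurd h (hn x hx).1
  · exact absurd h (hn x hx).2

theorem TriConn.exists_extremal [Finite V] (hG : TriConn G) {m : ℕ} (hm : 5 ≤ m)
    (hmid : NoMid G m) (hcard : 2 * m + 1 ≤ Nat.card V) : ∃ W K r q, Extremal G m W K r q := by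
  obtain ⟨a, b, hab⟩ : ∃ a b, G.Adj a b := by
    have h3 : 2 < (Set.univ : Set V).ncard := by rw [Set.ncard_univ]; omega
    obtain ⟨x, y, z, -, -, -, hxy, hxz, hyz⟩ := (Set.two_lt_ncard_iff).1 h3
    obtain ⟨u, -, w, huw, -⟩ := hG.exists_third (U := {x}) ⟨x, rfl⟩ (a := y) (b := y) (x := z)
      hxy.symm hxy.symm hxz.symm hyz.symm hyz.symm
    exact ⟨u, w, huw⟩
  have hc := Set.ncard_add_ncard_compl ({a, b} : Set V)
  rw [Set.ncard_pair hab.ne] at hc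
  obtain ⟨W, ⟨hW, hWm⟩, hWmin⟩ := Set.exists_min_image {X : Set V | Ctr G X ∧ m ≤ X.ncard}
    Set.ncard (Set.toFinite _) ⟨_, hG.ctr_compl_pair (by omega) hab, by omega⟩
  obtain ⟨v, hv⟩ := hW.1
  obtain ⟨K, ⟨hK, hKW, hne⟩, hKmax⟩ := Set.exists_max_image
    {X : Set V | Ctr G X ∧ X ⊆ W ∧ X ≠ W} Set.ncard (Set.toFinite _)
    ⟨{v}, hG.ctr_singleton (by omega) v, Set.singleton_subset_iff.2 hv, fun h => by
      rw [← h, Set.ncard_singleton] at hWm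
      omega⟩
  have hlt := Set.ncard_lt_ncard (hKW.ssubset_of_ne hne)
  have hcov : CtrCover G K W := by
    refine ⟨hK, hW, hKW, hne, fun X hX h1 h2 => ?_⟩
    by_cases hXW : X = W
    · exact Or.inr hXW
    · exact Or.inl (Set.eq_of_subset_of_ncard_le h1 (hKmax X ⟨hX, h2, hXW⟩)).symm
  obtain ⟨r, q, hq, h0, hl⟩ := hcov.exists_chain hG
  refine ⟨W, K, r, q, hcov, ?_, fun X hX hXm => hWmin X ⟨hX, hXm⟩, ?_,
    fun X hX h1 h2 => hKmax X ⟨hX, h1, h2⟩, hq, h0, hl⟩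
  · have := hmid W hW
    omega
  · by_contra h
    have := hWmin K ⟨hK, by omega⟩
    omega

end Main
section Bridge
variable {V : Type*} {G : SimpleGraph V}

theorem Pre.induce_connected {S : Set V} (hS : Pre G S) (hne : S.Nonempty) :
    (G.induce S).Connected := by
  have := hne.to_subtype
  refine ⟨fun x y => ?_⟩
  have h := hS (Subtype.val '' {z : S | (G.induce S).Reachable x z}) (by
    rintro _ ⟨z, -, rfl⟩
    exact z.2) ⟨x, x, Reachable.refl x, rfl⟩ (by
    rintro _ ⟨z, hz, rfl⟩ b hb hzb
    refine ⟨⟨b, hb⟩, Reachable.trans hz (Adj.reachable ?_), rfl⟩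
    exact hzb) y.2
  obtain ⟨z, hz, hzy⟩ := h
  rwa [Subtype.ext hzy] at hz

theorem pre_of_induce_connected {S : Set V} (h : (G.induce S).Connected) : Pre G S := by
  intro A hA ⟨a, ha⟩ hcl x hx
  have key : ∀ u v : S, (G.induce S).Walk u v → u.1 ∈ A → v.1 ∈ A := by
    intro u v p
    induction p with
    | nil => exact id
    | cons h _ ih => exact fun hu => ih (hcl _ hu _ (Subtype.prop _) h)
  obtain ⟨p⟩ := h.preconnected ⟨a, hA ha⟩ ⟨x, hx⟩
  exact key _ _ p ha

theorem NConnected.triConn [Finite V] (h : NConnected G 3) : TriConn G := by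
  intro U a b hcl ⟨u, hu, hua, hub⟩ v
  by_cases hv : v = a ∨ v = b
  · exact Or.inr hv
  push Not at hv
  have h2 : ({a, b} : Set V).ncard < 3 := by
    have := Set.ncard_insert_le a {b}
    rw [Set.ncard_singleton] at this
    omega
  have hn : ∀ y, y ≠ a → y ≠ b → y ∈ ({a, b} : Set V)ᶜ := by
    rintro y h1 h2 (h | h)
    · exact h1 h
    · exact h2 h
  have hpre := pre_of_induce_connected (h.2 _ h2)
  refine Or.inl (hpre (U ∩ ({a, b} : Set V)ᶜ) Set.inter_subset_right ⟨u, hu, hn u hua hub⟩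
    (fun x hx y hy hxy => ⟨?_, hy⟩) (hn v hv.1 hv.2)).1
  rcases hcl x hx.1 y hxy with h | h | h
  · exact h
  · exact absurd (Or.inl h) hy
  · exact absurd (Or.inr h) hy

theorem pre_induce {B : Set V} {T : Set B} (h : Pre G (Subtype.val '' T)) :
    Pre (G.induce B) T := by
  intro A hA hne hcl x hx
  obtain ⟨y, hy, hyx⟩ := h (Subtype.val '' A) (Set.image_mono hA) (hne.image _) (by
    rintro _ ⟨a, ha, rfl⟩ _ ⟨b, hb, rfl⟩ hab
    exact ⟨b, hcl a ha b hb hab, rfl⟩) ⟨x, hx, rfl⟩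
  rwa [← Subtype.ext hyx]

theorem Ctr.contractibleSet [Finite V] {W : Set V} (hW : Ctr G W) (h3 : 3 ≤ Wᶜ.ncard) :
    ContractibleSet G W := by
  refine ⟨hW.2.1.induce_connected hW.1, by rwa [Nat.card_coe_set_eq], fun S hS => ?_⟩
  have hSc := Set.ncard_add_ncard_compl S
  rw [Nat.card_coe_set_eq] at hSc
  refine Pre.induce_connected (pre_induce ?_) (Set.nonempty_of_ncard_ne_zero (by omega))
  have hex : ∃ c, Subtype.val '' Sᶜ = Wᶜ \ {c} := by
    rcases Nat.lt_or_ge S.ncard 1 with h | h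
    · obtain ⟨c, hc⟩ := hW.1
      refine ⟨c, ?_⟩
      rw [(Set.ncard_eq_zero).1 (by omega : S.ncard = 0), Set.compl_empty, Set.image_univ,
        Subtype.range_coe]
      exact (Set.sdiff_singleton_eq_self (not_not.2 hc)).symm
    · obtain ⟨c, rfl⟩ := Set.ncard_eq_one.1 (by omega : S.ncard = 1)
      refine ⟨c, ?_⟩
      ext x
      constructor
      · rintro ⟨y, hy, rfl⟩
        exact ⟨y.2, fun h => hy (Subtype.ext h)⟩
      · rintro ⟨hx, hxc⟩
        exact ⟨⟨x, hx⟩, fun h => hxc (congrArg Subtype.val h), rfl⟩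
  obtain ⟨c, hc⟩ := hex
  rw [hc]
  exact hW.2.2.2 c

end Bridge
/-- Karpov's theorem: a `3`-connected graph on at least `2m + 1` vertices (`m ≥ 5`)
has a contractible set `W` with `m ≤ |W| ≤ 2m − 4`. -/
theorem stmt_6 {V : Type*} [Fintype V] (G : SimpleGraph V)
    (m : ℕ) (hm : 5 ≤ m) (hG : NConnected G 3)
    (hv : 2 * m + 1 ≤ Fintype.card V) :
    ∃ W : Set V, m ≤ W.ncard ∧ W.ncard ≤ 2 * m - 4 ∧ ContractibleSet G W := by
  have hT := hG.triConn
  rw [← Nat.card_eq_fintype_card] at hv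
  by_contra hcon
  have hmid : NoMid G m := by
    intro W hW
    by_contra h
    push Not at h
    refine hcon ⟨W, h.1, h.2, hW.contractibleSet ?_⟩
    have := Set.ncard_add_ncard_compl W
    omega
  obtain ⟨W, K, r, q, e⟩ := hT.exists_extremal hm hmid hv
  exact e.false hT hm hmid hv
end

section
/- Let G be a finite 2-connected simple graph on n vertices and let n₁, n₂ be positive integers with n₁ + n₂ = n. Then V(G) can be partitioned into two sets V₁ and V₂ such that the induced subgraphs G[V₁] and G[V₂] are both connected, |V₁| = n₁ and |V₂| = n₂. -/
open SimpleGraph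

/-- An induced subgraph is connected iff its vertex set is nonempty and has no proper nonempty
subset closed under adjacency. -/
theorem induce_connected_iff_forall_closed {V : Type*} (G : SimpleGraph V) (R : Set V) :
    (G.induce R).Connected ↔ R.Nonempty ∧
      ∀ S ⊆ R, S.Nonempty → (∀ x ∈ S, ∀ y ∈ R, G.Adj x y → y ∈ S) → R ⊆ S := by
  constructor
  · intro h
    refine ⟨Set.nonempty_coe_sort.mp h.nonempty, ?_⟩
    rintro S hSR ⟨x, hx⟩ hS y hy
    obtain ⟨p⟩ := h.preconnected ⟨x, hSR hx⟩ ⟨y, hy⟩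
    have key : ∀ (a b : R), (G.induce R).Walk a b → (a : V) ∈ S → (b : V) ∈ S := by
      intro a b p
      induction p with
      | nil => exact id
      | cons hab _ ih => exact fun ha => ih (hS _ ha _ (Subtype.property _) hab)
    exact key _ _ p hx
  · rintro ⟨hne, h⟩
    have : Nonempty R := hne.to_subtype
    refine ⟨fun x y => ?_⟩
    have hsub := h {z | ∃ hz : z ∈ R, (G.induce R).Reachable x ⟨z, hz⟩} (fun z hz => hz.1)
      ⟨x, x.2, Reachable.refl _⟩ (by
        rintro a ⟨ha, hxa⟩ b hb hab
        exact ⟨hb, hxa.trans (Adj.reachable (G := G.induce R) (u := ⟨a, ha⟩) (v := ⟨b, hb⟩) hab)⟩)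
    exact (hsub y.2).2

/-- Adding a neighbour of a connected set keeps it connected. -/
theorem induce_insert_connected {V : Type*} {G : SimpleGraph V} {A : Set V} {a v : V}
    (hA : (G.induce A).Connected) (ha : a ∈ A) (hav : G.Adj a v) :
    (G.induce (insert v A)).Connected := by
  rw [induce_connected_iff_forall_closed] at hA ⊢
  refine ⟨Set.insert_nonempty _ _, fun S hS hne hcl => ?_⟩
  have hmeet : (S ∩ A).Nonempty := by
    obtain ⟨x, hx⟩ := hne
    rcases hS hx with rfl | hxA
    · exact ⟨a, hcl _ hx _ (Or.inr ha) hav.symm, ha⟩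
    · exact ⟨x, hx, hxA⟩
  have hsub := hA.2 (S ∩ A) Set.inter_subset_right hmeet
    fun x hx y hy hxy => ⟨hcl x hx.1 y (Or.inr hy) hxy, hy⟩
  have hAS : A ⊆ S := fun x hx => (hsub hx).1
  exact Set.insert_subset (hcl a (hAS ha) v (Or.inl rfl) hav) hAS

/-- In a graph without cut vertices, if `B` is connected with at least two vertices and has
nonempty complement, then some vertex of `B` with a neighbour outside `B` can be removed from `B`
leaving a connected set. -/
theorem exists_adj_induce_diff_connected {V : Type*} [Finite V] {G : SimpleGraph V}
    (hG : ∀ c : V, (G.induce ({c}ᶜ : Set V)).Connected) {B : Set V}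
    (hB : (G.induce B).Connected) (hB2 : B.Nontrivial) (hBc : Bᶜ.Nonempty) :
    ∃ v ∈ B, ∃ a ∈ Bᶜ, G.Adj a v ∧ (G.induce (B \ {v})).Connected := by
  let P : Set V → Prop := fun C => C.Nonempty ∧ ∃ c ∈ B, C ⊆ B \ {c} ∧
    ∀ x ∈ C, ∀ y ∈ B \ {c}, G.Adj x y → y ∈ C
  have hP : ∃ C, P C := by
    obtain ⟨c, hc, d, hd, hcd⟩ := hB2
    exact ⟨B \ {c}, ⟨d, hd, hcd.symm⟩, c, hc, subset_rfl, fun _ _ _ hy _ => hy⟩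
  obtain ⟨C, ⟨hCne, c, hc, hCB, hCcl⟩, hmin⟩ := exists_minimal_of_wellFoundedLT P hP
  obtain ⟨v, hvC, a, haB, hav⟩ : ∃ v ∈ C, ∃ a ∈ Bᶜ, G.Adj a v := by
    by_contra! hno
    obtain ⟨a, ha⟩ := hBc
    have hsub := ((induce_connected_iff_forall_closed _ _).mp (hG c)).2 C
      (fun x hx => (hCB hx).2) hCne fun x hx y hy hxy => by
        by_cases hyB : y ∈ B
        · exact hCcl x hx y ⟨hyB, hy⟩ hxy
        · exact (hno x hx y hyB hxy.symm).elim
    have hac : a ≠ c := fun h => ha (h ▸ hc)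
    exact ha (hCB (hsub hac)).1
  have hvB : v ∈ B := (hCB hvC).1
  have hvc : v ≠ c := (hCB hvC).2
  refine ⟨v, hvB, a, haB, hav, ?_⟩
  have hclosed : ∀ D ⊆ B \ {v}, D.Nonempty → c ∉ D →
      (∀ x ∈ D, ∀ y ∈ B \ {v}, G.Adj x y → y ∈ D) → False := by
    intro D hDB hDne hcD hDcl
    by_cases hDC : (D ∩ C).Nonempty
    · have hle := hmin (y := D ∩ C)
        ⟨hDC, v, hvB, fun x hx => hDB hx.1, fun x hx y hy hxy => by
          have hyD := hDcl x hx.1 y hy hxy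
          exact ⟨hyD, hCcl x hx.2 y ⟨hy.1, fun h => hcD (h ▸ hyD)⟩ hxy⟩⟩ Set.inter_subset_right
      exact (hDB (hle hvC).1).2 rfl
    · have hsub := ((induce_connected_iff_forall_closed _ _).mp hB).2 D
        (fun x hx => (hDB hx).1) hDne fun x hx y hy hxy => by
          refine hDcl x hx y ⟨hy, ?_⟩ hxy
          rintro rfl
          exact hDC ⟨x, hx, hCcl _ hvC x ⟨(hDB hx).1, fun h => hcD (h ▸ hx)⟩ hxy.symm⟩
      exact hcD (hsub hc)
  rw [induce_connected_iff_forall_closed]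
  refine ⟨⟨c, hc, hvc.symm⟩, fun S hS hne hcl => ?_⟩
  by_cases hcS : c ∈ S
  · by_contra hnot
    obtain ⟨z, hz, hzS⟩ := Set.not_subset.mp hnot
    refine hclosed ((B \ {v}) \ S) Set.sdiff_subset ⟨z, hz, hzS⟩ (fun h => h.2 hcS) ?_
    exact fun x hx y hy hxy => ⟨hy, fun hyS => hx.2 (hcl y hyS x hx.1 hxy.symm)⟩
  · exact (hclosed S hS hne hcS hcl).elim

/-- In a `2`-connected graph there is a connected set with connected complement of every size
between `1` and `Nat.card V - 1`. -/
theorem exists_connected_compl_connected_ncard {V : Type*} [Finite V] {G : SimpleGraph V}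
    (hG : NConnected G 2) {k : ℕ} (hk : 0 < k) (hkV : k < Nat.card V) :
    ∃ A : Set V, (G.induce A).Connected ∧ (G.induce Aᶜ).Connected ∧ A.ncard = k := by
  have hcut : ∀ c : V, (G.induce ({c}ᶜ : Set V)).Connected := fun c => hG.2 {c} (by simp)
  induction k, hk using Nat.le_induction with
  | base =>
    have : Nonempty V := (Nat.card_pos_iff.mp (by omega)).1
    obtain ⟨a⟩ := this
    refine ⟨{a}, ?_, hcut a, by simp⟩
    rw [induce_connected_iff_forall_closed]
    refine ⟨Set.singleton_nonempty a, fun S hS hne _ => ?_⟩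
    exact (hne.subset_singleton_iff.mp hS).ge
  | succ k hk ih =>
    obtain ⟨A, hA, hAc, hcard⟩ := ih (by omega)
    have hadd := Set.ncard_add_ncard_compl A
    obtain ⟨v, hv, a, ha, hav, hconn⟩ := exists_adj_induce_diff_connected hcut hAc
      ((Set.one_lt_ncard_iff_nontrivial).mp (by omega))
      (by rw [compl_compl]; exact Set.nonempty_coe_sort.mp hA.nonempty)
    rw [compl_compl] at ha
    refine ⟨insert v A, induce_insert_connected hA ha hav, ?_, ?_⟩
    · rwa [Set.insert_eq, Set.compl_union, Set.inter_comm]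
    · rw [Set.ncard_insert_of_notMem hv, hcard]

/-- The vertex set of a `2`-connected graph on `n = n₁ + n₂` vertices can be
partitioned into two connected sets of sizes `n₁` and `n₂`. -/
theorem stmt_8 {V : Type*} [Fintype V] (G : SimpleGraph V)
    (hG : NConnected G 2) (n₁ n₂ : ℕ) (hn₁ : 0 < n₁) (hn₂ : 0 < n₂)
    (hsum : n₁ + n₂ = Fintype.card V) :
    ∃ V₁ V₂ : Set V, V₁ ∪ V₂ = Set.univ ∧ V₁ ∩ V₂ = ∅ ∧
      (G.induce V₁).Connected ∧ (G.induce V₂).Connected ∧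
      V₁.ncard = n₁ ∧ V₂.ncard = n₂ := by
  rw [← Nat.card_eq_fintype_card] at hsum
  obtain ⟨A, hA, hAc, hcard⟩ := exists_connected_compl_connected_ncard hG hn₁ (by omega)
  have hadd := Set.ncard_add_ncard_compl A
  exact ⟨A, Aᶜ, Set.union_compl_self A, Set.inter_compl_self A, hA, hAc, hcard, by omega⟩
end
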